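/- Key bootstrap improvement: let λ = (λ_η) be nonnegative loop activities on ℤ^d satisfying the symmetry assumption and the boundedness assumption. There exist constants c > 0 and d₀ (depending only on λ) such that for every dimension d ≥ d₀ and every z ∈ (0, z_c(λ)): if f(z) ≤ 4 then f(z) ≤ 1 + c/d, where f = max(f₁, f₂, f₃) is defined below. -/

import Mathlib

open scoped ENNReal NNReal BigOperators Classical

noncomputable section

namespace LWW

/-- A point of the lattice ℤ^d. -/
abbrev Pt (d : ℕ) := Fin d → ℤ

/-- ℓ¹ distance on ℤ^d. -/
def dist1 {d : ℕ} (x y : Pt d) : ℕ := ∑ i, (x i - y i).natAbs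

/-- Nearest-neighbour adjacency on ℤ^d. -/
def Adj {d : ℕ} (x y : Pt d) : Prop := dist1 x y = 1

/-- Auxiliary function for single loop erasure: scan the list, keeping the
self-avoiding prefix `pre`; when the first repeated vertex is met, return the
loop-erased list together with the removed loop. -/
def le1Aux {α : Type*} [DecidableEq α] : List α → List α → List α × Option (List α)
  | pre, [] => (pre, none)
  | pre, x :: rest =>
    if x ∈ pre then
      (pre.takeWhile (fun y => y ≠ x) ++ x :: rest,
        some (pre.dropWhile (fun y => y ≠ x) ++ [x]))
    else le1Aux (pre ++ [x]) rest

/-- Single loop erasure LE¹. -/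
def LE1 {α : Type*} [DecidableEq α] (l : List α) : List α := (le1Aux [] l).1

/-- The loop removed by a single loop erasure (if the list is not self-avoiding). -/
def removedLoop {α : Type*} [DecidableEq α] (l : List α) : Option (List α) := (le1Aux [] l).2

/-- Iterate single loop erasure (with fuel), collecting the multiset of removed loops. -/
def leAux {α : Type*} [DecidableEq α] : ℕ → List α → List α × Multiset (List α)
  | 0, l => (l, 0)
  | n + 1, l =>
    match le1Aux ([] : List α) l with
    | (_, none) => (l, 0)
    | (l', some c) => ((leAux n l').1, c ::ₘ (leAux n l').2)

/-- Loop erasure LE. -/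
def LE {α : Type*} [DecidableEq α] (l : List α) : List α := (leAux l.length l).1

/-- The multiset of loops removed by loop erasure. -/
def erasedLoops {α : Type*} [DecidableEq α] (l : List α) : Multiset (List α) :=
  (leAux l.length l).2

/-- The number of loops removed by loop erasure. -/
def nLoops {α : Type*} [DecidableEq α] (l : List α) : ℕ := Multiset.card (erasedLoops l)

/-- A (finite) nearest-neighbour walk on ℤ^d, recorded as its (nonempty) list of vertices. -/
structure Walk (d : ℕ) where
  pts : List (Pt d)
  ne : pts ≠ []
  chain : pts.Chain' Adj

namespace Walk

variable {d : ℕ}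

/-- The number of steps of a walk. -/
def len (ω : Walk d) : ℕ := ω.pts.length - 1

/-- The initial vertex of a walk. -/
def start (ω : Walk d) : Pt d := ω.pts.headI

/-- The final vertex of a walk. -/
def finish (ω : Walk d) : Pt d := ω.pts.getLastD default

/-- The range (set of visited vertices) of a walk. -/
def range (ω : Walk d) : Set (Pt d) := {x | x ∈ ω.pts}

/-- The `i`-th vertex of a walk. -/
def nth (ω : Walk d) (i : ℕ) : Pt d := ω.pts.getD i default

/-- A walk is a loop if it has at least one step and ends where it began. -/
def IsLoop (ω : Walk d) : Prop := 1 ≤ ω.len ∧ ω.finish = ω.start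

end Walk

/-- The list of vertices of a self-avoiding polygon: a closed nearest-neighbour
walk all of whose vertices are distinct except that the last equals the first. -/
def IsSAPList {d : ℕ} (l : List (Pt d)) : Prop :=
  l.Chain' Adj ∧ 3 ≤ l.length ∧ l.getLastD default = l.headI ∧ l.dropLast.Nodup

/-- Change the initial vertex of a polygon list by a cyclic rotation. -/
def polyRot {d : ℕ} (l : List (Pt d)) (r : ℕ) : List (Pt d) :=
  l.dropLast.rotate r ++ [(l.dropLast.rotate r).headI]

/-- An isometry of the lattice ℤ^d: a bijection preserving ℓ¹ distance. -/
def IsLatticeIso {d : ℕ} (R : Pt d ≃ Pt d) : Prop :=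
  ∀ x y : Pt d, dist1 (R x) (R y) = dist1 x y

/-- The symmetry assumption on the loop activities: invariance under isometries of ℤ^d
and under change of initial vertex and of orientation of the polygon. -/
def SymmAssumption {d : ℕ} (lam : List (Pt d) → ℝ≥0) : Prop :=
  (∀ R : Pt d ≃ Pt d, IsLatticeIso R → ∀ l : List (Pt d), IsSAPList l →
      lam (l.map R) = lam l) ∧
  (∀ l : List (Pt d), IsSAPList l → ∀ r : ℕ, lam (polyRot l r) = lam l) ∧
  (∀ l : List (Pt d), IsSAPList l → lam l.reverse = lam l)

/-- The boundedness assumption: sup over self-avoiding polygons of the activity is finite. -/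
def BoundedAssumption {d : ℕ} (lam : List (Pt d) → ℝ≥0) : Prop :=
  ∃ M : ℝ≥0, ∀ l : List (Pt d), IsSAPList l → lam l ≤ M

/-- The product of the loop activities over the loops erased from `ω`, i.e. λ^{n_L(ω)}. -/
def wt0 {d : ℕ} (lam : List (Pt d) → ℝ≥0) (ω : Walk d) : ℝ≥0∞ :=
  ((erasedLoops ω.pts).map (fun η => (lam η : ℝ≥0∞))).prod

/-- The λ-LWW weight w_{λ,z}(ω) = z^{|ω|} λ^{n_L(ω)}. -/
def wt {d : ℕ} (lam : List (Pt d) → ℝ≥0) (z : ℝ≥0) (ω : Walk d) : ℝ≥0∞ :=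
  (z : ℝ≥0∞) ^ ω.len * wt0 lam ω

/-- The λ-LWW two-point function. -/
def G {d : ℕ} (lam : List (Pt d) → ℝ≥0) (z : ℝ≥0) (x y : Pt d) : ℝ≥0∞ :=
  ∑' ω : Walk d, if ω.start = x ∧ ω.finish = y then wt lam z ω else 0

/-- The λ-LWW loop measure μ_{λ,z}(A;B). -/
def mu {d : ℕ} (lam : List (Pt d) → ℝ≥0) (z : ℝ≥0) (A B : Set (Pt d)) : ℝ≥0∞ :=
  ∑' ω : Walk d,
    if ω.IsLoop ∧ (ω.range ∩ A).Nonempty ∧ ω.range ∩ B = ∅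
    then wt lam z ω / (ω.len : ℝ≥0∞) else 0

/-- The generalized λ-LWW loop measure μ_{λ,z}(A,B;C) with two hitting sets. -/
def mu2 {d : ℕ} (lam : List (Pt d) → ℝ≥0) (z : ℝ≥0) (A B C : Set (Pt d)) : ℝ≥0∞ :=
  ∑' ω : Walk d,
    if ω.IsLoop ∧ (ω.range ∩ A).Nonempty ∧ (ω.range ∩ B).Nonempty ∧ ω.range ∩ C = ∅
    then wt lam z ω / (ω.len : ℝ≥0∞) else 0

/-- exp : [0,∞] → [0,∞] with exp(∞) = ∞. -/
def eexp (x : ℝ≥0∞) : ℝ≥0∞ := if x = ⊤ then ⊤ else ENNReal.ofReal (Real.exp x.toReal)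

/-- The loop-erased λ-LWW weight w̄_{λ,z}(η) of a self-avoiding walk η. -/
def wbar {d : ℕ} (lam : List (Pt d) → ℝ≥0) (z : ℝ≥0) (η : Walk d) : ℝ≥0∞ :=
  ∑' ω : Walk d, if LE ω.pts = η.pts then wt lam z ω else 0

/-- c_n^λ : the total λ-LWW mass of n-step walks started at the origin. -/
def cN {d : ℕ} (lam : List (Pt d) → ℝ≥0) (n : ℕ) : ℝ≥0∞ :=
  ∑' ω : Walk d, if ω.start = 0 ∧ ω.len = n then wt0 lam ω else 0

/-- The susceptibility χ_λ(z) = Σ_n c_n^λ z^n. -/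
def chi {d : ℕ} (lam : List (Pt d) → ℝ≥0) (z : ℝ) : ℝ≥0∞ :=
  ∑' n : ℕ, cN lam n * ENNReal.ofReal z ^ n

/-- The critical point z_c(λ): the radius of convergence of the susceptibility
(for a power series with nonnegative coefficients this is the supremum of the
set of nonnegative z at which the series converges). -/
def zc {d : ℕ} (lam : List (Pt d) → ℝ≥0) : ℝ :=
  sSup {z : ℝ | 0 ≤ z ∧ chi lam z < ⊤}


/-- A fixed vertex adjacent to the origin (the first coordinate vector). -/
def e0 (d : ℕ) : Pt d := fun j => if (j : ℕ) = 0 then 1 else 0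

/-- `α₀(λ,z) = exp(μ_{λ,z}({0};∅))`, as a real number. -/
def alpha0R {d : ℕ} (lam : List (Pt d) → ℝ≥0) (z : ℝ) : ℝ :=
  (eexp (mu lam z.toNNReal {0} ∅)).toReal

/-- `α(λ,z) = exp(μ_{λ,z}({0};{e}))` for `e` a vertex adjacent to `0` (by symmetry,
independent of the choice of `e`), as a real number. -/
def alphaR {d : ℕ} (lam : List (Pt d) → ℝ≥0) (z : ℝ) : ℝ :=
  (eexp (mu lam z.toNNReal {0} {e0 d})).toReal

/-- The Fourier transform `Ĝ_{λ,z}(k) = Σ_x e^{ik·x} G_{λ,z}(0,x)`, which is real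
valued by symmetry: `Ĝ_{λ,z}(k) = Σ_x cos(k·x) G_{λ,z}(0,x)`. -/
def Ghat {d : ℕ} (lam : List (Pt d) → ℝ≥0) (z : ℝ) (k : Fin d → ℝ) : ℝ :=
  ∑' x : Pt d, Real.cos (∑ i, k i * (x i : ℝ)) * (G lam z.toNNReal 0 x).toReal

/-- `D̂(k) = (1/d)·Σ_{j=1}^d cos(k_j)`. -/
def DhatD (d : ℕ) (k : Fin d → ℝ) : ℝ := (1 / (d : ℝ)) * ∑ j, Real.cos (k j)

/-- The random walk two-point function `Ĉ_p(k) = (1 − p·|Ω|·D̂(k))⁻¹`, `|Ω| = 2d`. -/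
def Chat (d : ℕ) (p : ℝ) (k : Fin d → ℝ) : ℝ := (1 - p * (2 * d) * DhatD d k)⁻¹

/-- `p(z)`, defined by `(1 − p(z)·|Ω|)⁻¹ = χ_λ(z)/α₀(λ,z)`, i.e.
`p(z) = (1 − α₀(λ,z)/χ_λ(z))/(2d)`. -/
def pOf {d : ℕ} (lam : List (Pt d) → ℝ≥0) (z : ℝ) : ℝ :=
  (1 - alpha0R lam z / (chi lam z).toReal) / (2 * d)

/-- `Δ_k Â(ℓ) = Â(ℓ+k) + Â(ℓ−k) − 2Â(ℓ)` applied to `Ĝ_{λ,z}`. -/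
def DeltaGhat {d : ℕ} (lam : List (Pt d) → ℝ≥0) (z : ℝ) (k l : Fin d → ℝ) : ℝ :=
  Ghat lam z (l + k) + Ghat lam z (l - k) - 2 * Ghat lam z l

/-- `U_p(k,ℓ) = 16·Ĉ_p(k)⁻¹·[Ĉ_p(ℓ−k)Ĉ_p(ℓ) + Ĉ_p(ℓ+k)Ĉ_p(ℓ) + Ĉ_p(ℓ−k)Ĉ_p(ℓ+k)]`. -/
def Ufun (d : ℕ) (p : ℝ) (k l : Fin d → ℝ) : ℝ :=
  16 * (Chat d p k)⁻¹ *
    (Chat d p (l - k) * Chat d p l + Chat d p (l + k) * Chat d p l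
      + Chat d p (l - k) * Chat d p (l + k))

/-- The torus `[−π,π]^d`. -/
def box (d : ℕ) : Set (Fin d → ℝ) := {k | ∀ i, |k i| ≤ Real.pi}

/-- `f₁(z) = z·α(λ,z)·|Ω|`. -/
def f1 {d : ℕ} (lam : List (Pt d) → ℝ≥0) (z : ℝ) : ℝ := z * alphaR lam z * (2 * d)

/-- `f₂(z) = sup_{k ∈ [−π,π]^d} |Ĝ_{λ,z}(k)| / Ĉ_{p(z)}(k)`. -/
def f2 {d : ℕ} (lam : List (Pt d) → ℝ≥0) (z : ℝ) : ℝ :=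
  sSup {r : ℝ | ∃ k ∈ box d, r = |Ghat lam z k| / Chat d (pOf lam z) k}

/-- `f₃(z) = sup_{k,ℓ ∈ [−π,π]^d} Δ_k Ĝ_{λ,z}(ℓ) / U_{p(z)}(k,ℓ)`. -/
def f3 {d : ℕ} (lam : List (Pt d) → ℝ≥0) (z : ℝ) : ℝ :=
  sSup {r : ℝ | ∃ k ∈ box d, ∃ l ∈ box d,
    r = DeltaGhat lam z k l / Ufun d (pOf lam z) k l}

/-- `f = max(f₁, f₂, f₃)`. -/
def fBoot {d : ℕ} (lam : List (Pt d) → ℝ≥0) (z : ℝ) : ℝ :=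
  max (f1 lam z) (max (f2 lam z) (f3 lam z))

section ListCombinatorics

variable {α : Type*} [DecidableEq α]

/-- One step of chronological loop erasure, acting on the current self-avoiding stack and the
multiset of loops erased so far. -/
def eraseStep (s : List α × Multiset (List α)) (x : α) : List α × Multiset (List α) :=
  if x ∈ s.1 then
    (s.1.takeWhile (fun y => y ≠ x) ++ [x], (s.1.dropWhile (fun y => y ≠ x) ++ [x]) ::ₘ s.2)
  else (s.1 ++ [x], s.2)

theorem le1Aux_append (pre s l : List α) (h : (pre ++ s).Nodup) :
    le1Aux pre (s ++ l) = le1Aux (pre ++ s) l := by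
  induction s generalizing pre with
  | nil => simp
  | cons x s ih =>
    have hx : x ∉ pre := by
      intro hx
      rw [List.nodup_append] at h
      exact h.2.2 x hx x (by simp) rfl
    have := ih (pre ++ [x]) (by simpa using h)
    simpa [le1Aux, hx] using this

theorem foldl_eraseStep_add (l : List α) (s : List α) (L L' : Multiset (List α)) :
    l.foldl eraseStep (s, L + L') =
      ((l.foldl eraseStep (s, L)).1, (l.foldl eraseStep (s, L)).2 + L') := by
  induction l generalizing s L with
  | nil => simp
  | cons x l ih =>
    by_cases hx : x ∈ s
    · simp only [List.foldl_cons, eraseStep, hx, if_true]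
      rw [← Multiset.cons_add, ih]
    · simp only [List.foldl_cons, eraseStep, hx, if_false]
      rw [ih]

theorem eraseStep_nodup {s : List α} (hs : s.Nodup) (x : α) (L : Multiset (List α)) :
    (eraseStep (s, L) x).1.Nodup := by
  unfold eraseStep
  split_ifs with h
  · simp only
    rw [List.nodup_append]
    refine ⟨hs.sublist (List.takeWhile_sublist _), by simp, ?_⟩
    intro a ha b hb
    have := List.mem_takeWhile_imp ha
    simp at hb this
    rw [hb]; exact this
  · simp only
    rw [List.nodup_append]
    refine ⟨hs, by simp, ?_⟩
    intro a ha b hb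
    simp at hb
    rw [hb]; rintro rfl; exact h ha

theorem leAux_eq_foldl (l s : List α) (hs : s.Nodup) (n : ℕ) (hn : l.length ≤ n) :
    leAux n (s ++ l) = l.foldl eraseStep (s, 0) := by
  induction l generalizing s n with
  | nil =>
    have h1 : le1Aux ([] : List α) s = (s, none) := by
      have := le1Aux_append [] s [] (by simpa using hs)
      simpa [le1Aux] using this
    cases n with
    | zero => simp [leAux]
    | succ n => simp [leAux, h1]
  | cons x l ih =>
    by_cases hx : x ∈ s
    · obtain ⟨m, rfl⟩ : ∃ m, n = m + 1 := ⟨n - 1, by simp at hn; omega⟩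
      have h1 : le1Aux ([] : List α) (s ++ x :: l) =
          (s.takeWhile (fun y => y ≠ x) ++ x :: l, some (s.dropWhile (fun y => y ≠ x) ++ [x])) := by
        have := le1Aux_append [] s (x :: l) (by simpa using hs)
        rw [this]
        simp [le1Aux, hx]
      have hnd := eraseStep_nodup hs x 0
      simp only [eraseStep, hx, if_true] at hnd
      have h2 := ih _ hnd m (by simpa using hn)
      have h3 := foldl_eraseStep_add l (s.takeWhile (fun y => y ≠ x) ++ [x]) 0
        {s.dropWhile (fun y => y ≠ x) ++ [x]}
      simp only [List.append_assoc, List.singleton_append, zero_add] at h2 h3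
      have h4 : (eraseStep (s, 0) x) = (s.takeWhile (fun y => y ≠ x) ++ [x],
          {s.dropWhile (fun y => y ≠ x) ++ [x]}) := by
        simp [eraseStep, hx]
      rw [List.foldl_cons, h4, h3]
      simp only [leAux, h1, h2]
      rw [add_comm, Multiset.singleton_add]
    · have hnd := eraseStep_nodup hs x 0
      simp only [eraseStep, hx, if_false] at hnd
      have h2 := ih _ hnd n (by simp at hn; omega)
      simp only [List.append_assoc, List.singleton_append] at h2
      rw [h2, List.foldl_cons]
      simp [eraseStep, hx]

theorem leAux_length (l : List α) : leAux l.length l = l.foldl eraseStep ([], 0) := by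
  simpa using leAux_eq_foldl l [] (by simp) l.length le_rfl

theorem LE_nil : LE ([] : List α) = [] := rfl

theorem erasedLoops_nil : erasedLoops ([] : List α) = 0 := rfl

theorem LE_concat (l : List α) (x : α) :
    LE (l ++ [x]) = if x ∈ LE l then (LE l).takeWhile (fun y => y ≠ x) ++ [x] else LE l ++ [x] := by
  unfold LE
  rw [leAux_length, leAux_length, List.foldl_append]
  simp only [List.foldl_cons, List.foldl_nil, eraseStep]
  split_ifs <;> rfl

theorem erasedLoops_concat (l : List α) (x : α) :
    erasedLoops (l ++ [x]) = if x ∈ LE l then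
      ((LE l).dropWhile (fun y => y ≠ x) ++ [x]) ::ₘ erasedLoops l else erasedLoops l := by
  unfold LE erasedLoops
  rw [leAux_length, leAux_length, List.foldl_append]
  simp only [List.foldl_cons, List.foldl_nil, eraseStep]
  split_ifs <;> rfl

theorem LE_nodup (l : List α) : (LE l).Nodup := by
  induction l using List.reverseRecOn with
  | nil => simp [LE_nil]
  | append_singleton l x ih =>
    have := eraseStep_nodup ih x 0
    rw [LE_concat]
    unfold eraseStep at this
    split_ifs with h <;> simpa [h] using this

theorem LE_eq_nil_iff (l : List α) : LE l = [] ↔ l = [] := by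
  induction l using List.reverseRecOn with
  | nil => simp [LE_nil]
  | append_singleton l x ih =>
    rw [LE_concat]
    split_ifs <;> simp

theorem LE_getLast? (l : List α) : (LE l).getLast? = l.getLast? := by
  induction l using List.reverseRecOn with
  | nil => simp [LE_nil]
  | append_singleton l x ih =>
    rw [LE_concat]
    split_ifs <;> simp

theorem LE_subset (l : List α) : LE l ⊆ l := by
  induction l using List.reverseRecOn with
  | nil => simp [LE_nil]
  | append_singleton l x ih =>
    rw [LE_concat]
    intro y hy
    split_ifs at hy with h
    · rw [List.mem_append] at hy ⊢
      rcases hy with hy | hy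
      · exact Or.inl (ih ((List.takeWhile_sublist _).subset hy))
      · exact Or.inr hy
    · rw [List.mem_append] at hy ⊢
      rcases hy with hy | hy
      · exact Or.inl (ih hy)
      · exact Or.inr hy

theorem LE_head? (l : List α) : (LE l).head? = l.head? := by
  induction l using List.reverseRecOn with
  | nil => simp [LE_nil]
  | append_singleton l x ih =>
    rw [LE_concat]
    rcases hL : LE l with _ | ⟨a, t⟩
    · have : l = [] := (LE_eq_nil_iff l).1 hL
      simp [this]
    · rw [hL] at ih
      have hl : l ≠ [] := by rintro rfl; simp [LE_nil] at hL
      rw [List.head?_append_of_ne_nil _ hl, ← ih]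
      split_ifs with h
      · by_cases hax : a = x
        · subst hax; simp
        · simp [hax]
      · simp

theorem isChain_LE {R : α → α → Prop} {l : List α} (h : l.IsChain R) : (LE l).IsChain R := by
  induction l using List.reverseRecOn with
  | nil => simp [LE_nil]
  | append_singleton l x ih =>
    rw [List.isChain_append] at h
    have ih := ih h.1
    rw [LE_concat]
    split_ifs with hx
    · have hp : (LE l).takeWhile (fun y => y ≠ x) ++ [x] <+: LE l := by
        have h1 := List.takeWhile_append_dropWhile (p := fun y => decide (y ≠ x)) (l := LE l)
        rcases h2 : (LE l).dropWhile (fun y => y ≠ x) with _ | ⟨a, t⟩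
        · rw [h2, List.append_nil] at h1
          rw [← h1] at hx
          have := List.mem_takeWhile_imp hx
          simp at this
        · have h3 := List.head_dropWhile_not (fun y => decide (y ≠ x)) (l := LE l)
            (by rw [h2]; simp)
          simp only [h2] at h3
          replace h3 : a = x := by simpa using of_decide_eq_false h3
          subst h3
          refine ⟨t, ?_⟩
          rw [h2] at h1
          simpa using h1
      obtain ⟨t, ht⟩ := hp
      rw [← ht] at ih
      exact (List.isChain_append.1 ih).1
    · rw [List.isChain_append]
      refine ⟨ih, by simp, ?_⟩
      rw [LE_getLast?]
      exact h.2.2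

theorem LE_append_of_disjoint (p q : List α) (h : List.Disjoint q (LE p)) :
    LE (p ++ q) = LE p ++ LE q ∧ erasedLoops (p ++ q) = erasedLoops p + erasedLoops q := by
  induction q using List.reverseRecOn with
  | nil => simp [LE_nil, erasedLoops_nil]
  | append_singleton q x ih =>
    have hx : x ∉ LE p := fun hx => h (by simp) hx
    obtain ⟨h1, h2⟩ := ih (fun y hy hy' => h (by simp [hy]) hy')
    rw [← List.append_assoc, LE_concat, erasedLoops_concat, LE_concat, erasedLoops_concat, h1, h2]
    have hp : ∀ y ∈ LE p, (fun y => decide (y ≠ x)) y = true := by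
      intro y hy; simp; rintro rfl; exact hx hy
    by_cases hq : x ∈ LE q
    · simp only [List.mem_append, hx, hq, or_true, if_true]
      rw [List.takeWhile_append_of_pos hp, List.dropWhile_append_of_pos hp]
      simp
    · simp [hx, hq]

theorem exists_split (l : List α) (m : ℕ) (hm : m ≤ (LE l).length) :
    ∃ p q, l = p ++ q ∧ List.Disjoint q (LE p) ∧ (LE p).length = m := by
  induction l using List.reverseRecOn with
  | nil => exact ⟨[], [], by simp, by simp, by simp [LE_nil] at hm ⊢; omega⟩
  | append_singleton l x ih =>
    by_cases hfull : m = (LE (l ++ [x])).length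
    · exact ⟨l ++ [x], [], by simp, by simp, hfull.symm⟩
    have hlt : m < (LE (l ++ [x])).length := lt_of_le_of_ne hm hfull
    rw [LE_concat] at hlt
    have key : m ≤ ((LE l).takeWhile (fun y => y ≠ x)).length := by
      split_ifs at hlt with h
      · simp at hlt ⊢; omega
      · have : (LE l).takeWhile (fun y => y ≠ x) = LE l := by
          rw [List.takeWhile_eq_self_iff]
          intro y hy; simp; rintro rfl; exact h hy
        rw [this]
        simp at hlt; omega
    obtain ⟨p, q, rfl, hd, hl⟩ := ih (key.trans (List.takeWhile_sublist _).length_le)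
    refine ⟨p, q ++ [x], by simp, ?_, hl⟩
    have hpre : LE p <+: (LE (p ++ q)).takeWhile (fun y => y ≠ x) := by
      refine List.prefix_of_prefix_length_le (l₃ := LE (p ++ q)) ?_ (List.takeWhile_prefix _)
        (by rw [hl]; exact key)
      rw [(LE_append_of_disjoint p q hd).1]
      exact List.prefix_append _ _
    intro y hy hy'
    rw [List.mem_append] at hy
    rcases hy with hy | hy
    · exact hd hy hy'
    · have := List.mem_takeWhile_imp (hpre.subset hy')
      simp at this hy
      exact this hy

theorem split_unique {p q p' q' : List α} (he : p ++ q = p' ++ q') (hd : List.Disjoint q (LE p))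
    (hd' : List.Disjoint q' (LE p')) (hl : (LE p).length = (LE p').length) : p = p' ∧ q = q' := by
  have aux : ∀ {p q p' q' : List α}, p ++ q = p' ++ q' → List.Disjoint q (LE p) →
      (LE p).length = (LE p').length → p.length ≤ p'.length → p = p' := by
    intro p q p' q' he hd hl hlen
    obtain ⟨r, rfl⟩ : p <+: p' :=
      List.prefix_of_prefix_length_le (List.prefix_append p q) (he ▸ List.prefix_append p' q') hlen
    rw [List.append_assoc, List.append_cancel_left_eq] at he
    subst he
    have hr : List.Disjoint r (LE p) := fun y hy hy' => hd (by simp [hy]) hy'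
    rw [(LE_append_of_disjoint p r hr).1, List.length_append] at hl
    have : LE r = [] := by rw [← List.length_eq_zero_iff]; omega
    rw [LE_eq_nil_iff] at this
    simp [this]
  have hpp : p = p' := by
    rcases le_total p.length p'.length with h | h
    · exact aux he hd hl h
    · exact (aux he.symm hd' hl.symm h).symm
  subst hpp
  exact ⟨rfl, List.append_cancel_left he⟩

theorem LE_eq_singleton_iff (l : List α) (x : α) :
    LE l = [x] ↔ l.head? = some x ∧ l.getLast? = some x := by
  rw [← LE_head?, ← LE_getLast?]
  have hnd := LE_nodup l
  constructor
  · intro h; simp [h]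
  · rintro ⟨h1, h2⟩
    rcases h : LE l with _ | ⟨a, t⟩
    · simp [h] at h1
    · rw [h] at h1 h2 hnd
      simp at h1
      subst h1
      rcases t with _ | ⟨b, t⟩
      · rfl
      · have : (a :: b :: t).getLast (by simp) = a := by
          rw [List.getLast?_eq_getLast_of_ne_nil (by simp)] at h2
          simpa using h2
        rw [List.getLast_cons (by simp)] at this
        have hm := List.getLast_mem (l := b :: t) (by simp)
        rw [this] at hm
        simp at hnd hm
        tauto

theorem length_LE_eq_one_iff (l : List α) : (LE l).length = 1 ↔ ∃ x, LE l = [x] :=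
  List.length_eq_one_iff

/-- Every visited point `u` of a list is visited by the closed block attached to some point `y` of
the loop erasure. -/
theorem exists_block (l : List α) (u : α) (hu : u ∈ l) :
    ∃ a b c y, l = a ++ b ++ c ∧ LE b = [y] ∧ u ∈ b ∧ List.Disjoint b (LE a) ∧
      List.Disjoint c (LE (a ++ b)) := by
  have hex : ∃ m, ∃ p c, l = p ++ c ∧ List.Disjoint c (LE p) ∧ (LE p).length = m ∧ u ∈ p :=
    ⟨_, l, [], by simp, by simp, rfl, hu⟩
  obtain ⟨p, c, rfl, hd, hl, hup⟩ := Nat.find_spec hex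
  set m := Nat.find hex with hm
  have hm1 : m ≠ 0 := by
    intro h0
    rw [h0, List.length_eq_zero_iff, LE_eq_nil_iff] at hl
    simp [hl] at hup
  obtain ⟨a, b, rfl, hab, hla⟩ := exists_split p (m - 1) (by omega)
  obtain ⟨hLE, -⟩ := LE_append_of_disjoint a b hab
  have hb : (LE b).length = 1 := by
    rw [hLE, List.length_append] at hl; omega
  obtain ⟨y, hy⟩ := (length_LE_eq_one_iff b).1 hb
  refine ⟨a, b, c, y, rfl, hy, ?_, hab, hd⟩
  by_contra hub
  have hua : u ∈ a := by
    rw [List.mem_append] at hup; tauto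
  have : m ≤ m - 1 := by
    rw [hm]
    refine Nat.find_min' hex ⟨a, b ++ c, by simp, ?_, by rw [hla, hm], hua⟩
    intro w hw hw'
    rw [List.mem_append] at hw
    rcases hw with hw | hw
    · exact hab hw hw'
    · exact hd hw (by rw [hLE]; simp [hw'])
  omega

theorem LE_map {β : Type*} [DecidableEq β] (f : α → β) (hf : Function.Injective f) (l : List α) :
    LE (l.map f) = (LE l).map f ∧
      erasedLoops (l.map f) = (erasedLoops l).map (List.map f) := by
  induction l using List.reverseRecOn with
  | nil => simp [LE_nil, erasedLoops_nil]
  | append_singleton l x ih =>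
    have hm : f x ∈ (LE l).map f ↔ x ∈ LE l := List.mem_map_of_injective hf
    have hfun : (fun y => decide (y ≠ f x)) ∘ f = fun y => decide (y ≠ x) := by
      funext y; simp [hf.eq_iff]
    rw [List.map_append, List.map_singleton, LE_concat, LE_concat, erasedLoops_concat,
      erasedLoops_concat, ih.1, ih.2]
    simp only [hm]
    split_ifs with h
    · rw [List.takeWhile_map, List.dropWhile_map, hfun]
      simp
    · simp

end ListCombinatorics

section Sums

/-- The indicator of a proposition, with values in `ℝ≥0∞`. -/
def ind (p : Prop) : ℝ≥0∞ := if p then 1 else 0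

theorem ind_true {p : Prop} (h : p) : ind p = 1 := if_pos h

theorem ind_false {p : Prop} (h : ¬p) : ind p = 0 := if_neg h

theorem ind_le_one (p : Prop) : ind p ≤ 1 := by
  unfold ind; split_ifs <;> simp

theorem ind_mono {p q : Prop} (h : p → q) : ind p ≤ ind q := by
  by_cases hp : p
  · rw [ind_true hp, ind_true (h hp)]
  · rw [ind_false hp]; exact zero_le

theorem ind_and (p q : Prop) : ind (p ∧ q) = ind p * ind q := by
  unfold ind; split_ifs <;> simp_all

theorem ind_congr {p q : Prop} (h : p ↔ q) : ind p = ind q := by rw [propext h]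

theorem ind_ne_zero {p : Prop} (h : ind p ≠ 0) : p := by
  by_contra hp; exact h (ind_false hp)

theorem ind_add_ind_not (p : Prop) : ind p + ind (¬p) = 1 := by
  unfold ind; split_ifs <;> simp_all

theorem ite_eq_ind_mul (p : Prop) [Decidable p] (a : ℝ≥0∞) : (if p then a else 0) = ind p * a := by
  unfold ind; split_ifs <;> simp_all

theorem tsum_ind_eq_mul {β : Type*} (b : β) (f : β → ℝ≥0∞) : ∑' x, ind (b = x) * f x = f b := by
  rw [tsum_eq_single b, ind_true rfl, one_mul]
  intro x hx
  rw [ind_false (Ne.symm hx), zero_mul]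

theorem tsum_ind_some_eq_mul {β : Type*} (b : β) (f : β → ℝ≥0∞) :
    ∑' x, ind (some b = some x) * f x = f b := by
  simpa using tsum_ind_eq_mul b f

theorem tsum_le_tsum_of_cover {α β : Type*} {H : α → ℝ≥0∞} {F : β → ℝ≥0∞} (φ : α → β)
    (h : ∀ b, F b ≠ 0 → ∃ a, φ a = b ∧ F b ≤ H a) : ∑' b, F b ≤ ∑' a, H a := by
  calc ∑' b, F b ≤ ∑' b, ∑' a, ind (φ a = b) * H a := by
        refine ENNReal.tsum_le_tsum fun b => ?_
        by_cases hb : F b = 0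
        · simp [hb]
        · obtain ⟨a, ha, hle⟩ := h b hb
          refine hle.trans (le_trans ?_ (ENNReal.le_tsum a))
          rw [ind_true ha, one_mul]
    _ = ∑' a, ∑' b, ind (φ a = b) * H a := ENNReal.tsum_comm
    _ = ∑' a, H a := by
        refine tsum_congr fun a => ?_
        exact tsum_ind_eq_mul (φ a) (fun _ => H a)

theorem tsum_le_tsum_of_injOn {α β : Type*} {H : α → ℝ≥0∞} {F : β → ℝ≥0∞} (φ : α → β)
    (hinj : ∀ a a', H a ≠ 0 → H a' ≠ 0 → φ a = φ a' → a = a') (h : ∀ a, H a ≤ F (φ a)) :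
    ∑' a, H a ≤ ∑' b, F b := by
  calc ∑' a, H a = ∑' a : Function.support H, H a := (tsum_subtype_support H).symm
    _ ≤ ∑' a : Function.support H, F (φ a) := ENNReal.tsum_le_tsum fun a => h a
    _ ≤ ∑' b, F b := by
        have : Function.Injective (fun a : Function.support H => φ a) :=
          fun a a' haa => Subtype.ext (hinj a a' a.2 a'.2 haa)
        exact ENNReal.tsum_comp_le_tsum_of_injective this F

theorem tsum_eq_tsum_of_bij {α β : Type*} {H : α → ℝ≥0∞} {F : β → ℝ≥0∞} (φ : α → β)
    (hinj : ∀ a a', H a ≠ 0 → H a' ≠ 0 → φ a = φ a' → a = a')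
    (h : ∀ a, H a ≠ 0 → H a = F (φ a)) (hs : ∀ b, F b ≠ 0 → ∃ a, φ a = b ∧ F b = H a) :
    ∑' a, H a = ∑' b, F b := by
  refine le_antisymm (tsum_le_tsum_of_injOn φ hinj fun a => ?_) (tsum_le_tsum_of_cover φ ?_)
  · by_cases ha : H a = 0
    · simp [ha]
    · exact (h a ha).le
  · intro b hb
    obtain ⟨a, ha, he⟩ := hs b hb
    exact ⟨a, ha, he.le⟩

end Sums

section Weights

variable {d : ℕ} (lam : List (Pt d) → ℝ≥0) (z : ℝ≥0)

/-- The product of the activities of the erased loops. -/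
def loopWt (l : List (Pt d)) : ℝ≥0∞ := ((erasedLoops l).map (fun η => (lam η : ℝ≥0∞))).prod

/-- The weight of a list of vertices, seen as a walk. -/
def lwt (l : List (Pt d)) : ℝ≥0∞ := ind (l.IsChain Adj) * (z : ℝ≥0∞) ^ (l.length - 1) * loopWt lam l

/-- The weight of a list of vertices, seen as a continuation of a walk that ends at `v`. -/
def cwt (v : Pt d) (q : List (Pt d)) : ℝ≥0∞ :=
  ind ((v :: q).IsChain Adj) * (z : ℝ≥0∞) ^ q.length * loopWt lam q

theorem loopWt_append {p q : List (Pt d)} (h : List.Disjoint q (LE p)) :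
    loopWt lam (p ++ q) = loopWt lam p * loopWt lam q := by
  unfold loopWt
  rw [(LE_append_of_disjoint p q h).2, Multiset.map_add, Multiset.prod_add]

theorem loopWt_singleton (x : Pt d) : loopWt lam [x] = 1 := by
  have := erasedLoops_concat ([] : List (Pt d)) x
  simp [LE_nil, erasedLoops_nil] at this
  simp [loopWt, this]

theorem LE_singleton (x : Pt d) : LE [x] = [x] := by
  rw [LE_eq_singleton_iff]; simp

theorem isChain_append_iff {p q : List (Pt d)} {v : Pt d} (hv : p.getLast? = some v) :
    (p ++ q).IsChain Adj ↔ p.IsChain Adj ∧ (v :: q).IsChain Adj := by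
  rw [List.isChain_append, List.isChain_cons, hv]
  simp only [Option.mem_some_iff, forall_eq']
  tauto

theorem lwt_append {p q : List (Pt d)} {v : Pt d} (hv : p.getLast? = some v)
    (h : List.Disjoint q (LE p)) : lwt lam z (p ++ q) = lwt lam z p * cwt lam z v q := by
  have hp : p ≠ [] := by rintro rfl; simp at hv
  have hlen : (p ++ q).length - 1 = (p.length - 1) + q.length := by
    have := List.length_pos_iff.2 hp
    simp; omega
  unfold lwt cwt
  rw [loopWt_append lam h, ind_congr (isChain_append_iff hv), ind_and, hlen, pow_add]
  ring

theorem cwt_eq_lwt_cons {v : Pt d} {q : List (Pt d)} (h : v ∉ q) :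
    cwt lam z v q = lwt lam z (v :: q) := by
  have hd : List.Disjoint q (LE [v]) := by
    rw [LE_singleton]; intro x hx hx'; simp at hx'; exact h (hx' ▸ hx)
  have := loopWt_append lam hd
  rw [loopWt_singleton, one_mul] at this
  unfold cwt lwt
  rw [← List.singleton_append, this]
  simp

theorem cwt_eq_mul_lwt {v y : Pt d} {b : List (Pt d)} (h : b.head? = some y) :
    cwt lam z v b = ind (Adj v y) * z * lwt lam z b := by
  have hb : b ≠ [] := by rintro rfl; simp at h
  have hlen : b.length = (b.length - 1) + 1 := by
    have := List.length_pos_iff.2 hb; omega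
  have hc : (v :: b).IsChain Adj ↔ Adj v y ∧ b.IsChain Adj := by
    rw [List.isChain_cons, h]; simp
  unfold cwt lwt
  rw [ind_congr hc, ind_and]
  nth_rewrite 1 [hlen]
  rw [pow_succ]; ring

theorem lwt_singleton (x : Pt d) : lwt lam z [x] = 1 := by
  simp [lwt, loopWt_singleton, ind_true]

theorem cwt_singleton (v y : Pt d) : cwt lam z v [y] = ind (Adj v y) * z := by
  rw [cwt_eq_mul_lwt lam z (y := y) (by simp), lwt_singleton, mul_one]

/-- A sum over walks is a sum over lists of vertices. -/
theorem tsum_walk (F : List (Pt d) → ℝ≥0∞) :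
    ∑' ω : Walk d, F ω.pts = ∑' l : List (Pt d), ind (l ≠ []) * ind (l.IsChain Adj) * F l := by
  have hinj : Function.Injective (fun ω : Walk d => ω.pts) := by
    rintro ⟨p, h1, h2⟩ ⟨q, h3, h4⟩ h
    simp only at h
    subst h; rfl
  refine tsum_eq_tsum_of_bij (fun ω : Walk d => ω.pts) (fun a a' _ _ h => hinj h) ?_ ?_
  · intro ω _
    rw [ind_true ω.ne, ind_true (show ω.pts.IsChain Adj from ω.chain), one_mul, one_mul]
  · intro l hl
    have h1 : l ≠ [] := ind_ne_zero (left_ne_zero_of_mul (left_ne_zero_of_mul hl))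
    have h2 : l.IsChain Adj := ind_ne_zero (right_ne_zero_of_mul (left_ne_zero_of_mul hl))
    exact ⟨⟨l, h1, h2⟩, rfl, by rw [ind_true h1, ind_true h2, one_mul, one_mul]⟩

theorem wt_eq (ω : Walk d) : wt lam z ω = (z : ℝ≥0∞) ^ (ω.pts.length - 1) * loopWt lam ω.pts := rfl

theorem headI_eq_iff {l : List (Pt d)} (h : l ≠ []) (x : Pt d) :
    l.headI = x ↔ l.head? = some x := by
  cases l with
  | nil => exact absurd rfl h
  | cons a t => simp

theorem getLastD_eq_iff {l : List (Pt d)} (h : l ≠ []) (x : Pt d) :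
    l.getLastD default = x ↔ l.getLast? = some x := by
  rw [List.getLastD_eq_getLast?, List.getLast?_eq_getLast_of_ne_nil h]; simp

theorem G_eq (x y : Pt d) : G lam z x y =
    ∑' l : List (Pt d), ind (l.head? = some x) * ind (l.getLast? = some y) * lwt lam z l := by
  have : G lam z x y = ∑' ω : Walk d, (fun l : List (Pt d) => ind (l.headI = x ∧
      l.getLastD default = y) * ((z : ℝ≥0∞) ^ (l.length - 1) * loopWt lam l)) ω.pts := by
    unfold G
    refine tsum_congr fun ω => ?_
    rw [ite_eq_ind_mul]; rfl
  rw [this, tsum_walk (fun l : List (Pt d) => ind (l.headI = x ∧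
      l.getLastD default = y) * ((z : ℝ≥0∞) ^ (l.length - 1) * loopWt lam l))]
  refine tsum_congr fun l => ?_
  by_cases hl : l = []
  · subst hl; simp [ind_false]
  · rw [ind_true hl, ind_and, ind_congr (headI_eq_iff hl x), ind_congr (getLastD_eq_iff hl y)]
    unfold lwt; ring

end Weights

section Lace

variable {d : ℕ} (lam : List (Pt d) → ℝ≥0) (z : ℝ≥0)

/-- The `n`-th lace weight of a continuation `q` of a walk that ends at `v`. -/
def lace : ℕ → Pt d → List (Pt d) → Pt d → ℝ≥0∞
  | 0, v, q, x => cwt lam z v q * ind (v ∉ q) * ind (LE q = [x])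
  | n + 1, v, q, x => cwt lam z v q * ind (v ∉ q) * ∑' v' : Pt d, ind (q.getLast? = some v') *
      ∑' q' : List (Pt d), ind (v ∈ q') * ind (List.Disjoint (LE q) q') * lace n v' q' x

/-- The `n`-th lace kernel. -/
def laceKer (n : ℕ) (v x : Pt d) : ℝ≥0∞ := ∑' q : List (Pt d), lace lam z n v q x

/-- The weight of the walks from `0` to `v` whose loop erasure avoids `q`. -/
def avoidWt (v : Pt d) (q : List (Pt d)) : ℝ≥0∞ :=
  ∑' p : List (Pt d), ind (p.head? = some 0) * ind (p.getLast? = some v) * lwt lam z p *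
    ind (List.Disjoint q (LE p))

/-- The `n`-th remainder of the expansion. -/
def laceRem (n : ℕ) (x : Pt d) : ℝ≥0∞ :=
  ∑' v : Pt d, ∑' q : List (Pt d), avoidWt lam z v q * lace lam z n v q x

theorem lace_eq_zero_of_mem (n : ℕ) {v : Pt d} {q : List (Pt d)} (h : v ∈ q) (x : Pt d) :
    lace lam z n v q x = 0 := by
  cases n <;> simp [lace, ind_false (show ¬ (v ∉ q) from not_not.2 h)]

theorem getLast?_mem_LE {p : List (Pt d)} {v : Pt d} (h : p.getLast? = some v) : v ∈ LE p := by
  rw [← LE_getLast?] at h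
  exact List.mem_of_getLast? h

theorem G_zero_eq (x : Pt d) :
    G lam z 0 x = ind (x = 0) * G lam z 0 0 + laceRem lam z 0 x := by
  by_cases hx : x = 0
  · have hz : laceRem lam z 0 x = 0 := by
      unfold laceRem avoidWt lace
      simp only [ENNReal.tsum_eq_zero, mul_eq_zero]
      intro v q
      by_contra hcon
      push Not at hcon
      obtain ⟨⟨p, hp⟩, ⟨-, -⟩, hq⟩ := hcon
      have hLE := ind_ne_zero hq
      obtain ⟨⟨⟨a, b⟩, -⟩, hdis⟩ := hp
      have hd := ind_ne_zero hdis
      have h0 : (LE p).head? = some 0 := by rw [LE_head?]; exact ind_ne_zero a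
      have h0' : (0 : Pt d) ∈ LE p := List.mem_of_head? h0
      have : x ∈ q := LE_subset q (by rw [hLE]; simp)
      exact hd (hx ▸ this) h0'
    rw [hz, hx, ind_true rfl, one_mul, add_zero]
  rw [ind_false hx, zero_mul, zero_add, G_eq]
  symm
  have h2 : laceRem lam z 0 x = ∑' t : Pt d × List (Pt d) × List (Pt d),
      ind (t.2.2.head? = some 0) * ind (t.2.2.getLast? = some t.1) * lwt lam z t.2.2 *
        ind (List.Disjoint t.2.1 (LE t.2.2)) *
        (cwt lam z t.1 t.2.1 * ind (t.1 ∉ t.2.1) * ind (LE t.2.1 = [x])) := by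
    unfold laceRem avoidWt lace
    rw [ENNReal.tsum_prod']
    refine tsum_congr fun v => ?_
    rw [ENNReal.tsum_prod']
    refine tsum_congr fun q => ?_
    exact ENNReal.tsum_mul_right.symm
  rw [h2]
  have key : ∀ t : Pt d × List (Pt d) × List (Pt d),
      ind (t.2.2.head? = some 0) * ind (t.2.2.getLast? = some t.1) * lwt lam z t.2.2 *
        ind (List.Disjoint t.2.1 (LE t.2.2)) *
        (cwt lam z t.1 t.2.1 * ind (t.1 ∉ t.2.1) * ind (LE t.2.1 = [x])) ≠ 0 →
      t.2.2.head? = some 0 ∧ t.2.2.getLast? = some t.1 ∧ List.Disjoint t.2.1 (LE t.2.2) ∧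
        t.1 ∉ t.2.1 ∧ LE t.2.1 = [x] := by
    intro t ht
    simp only [mul_ne_zero_iff] at ht
    obtain ⟨⟨⟨⟨a, b⟩, -⟩, c⟩, ⟨-, e⟩, f⟩ := ht
    exact ⟨ind_ne_zero a, ind_ne_zero b, ind_ne_zero c, ind_ne_zero e, ind_ne_zero f⟩
  refine tsum_eq_tsum_of_bij (fun t : Pt d × List (Pt d) × List (Pt d) => t.2.2 ++ t.2.1) ?_ ?_ ?_
  · rintro ⟨v, q, p⟩ ⟨v', q', p'⟩ h h' he
    obtain ⟨-, a2, a3, -, a5⟩ := key _ h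
    obtain ⟨-, b2, b3, -, b5⟩ := key _ h'
    simp only at *
    have hl : (LE p).length = (LE p').length := by
      have h3 := congrArg List.length (LE_append_of_disjoint p q a3).1
      have h4 := congrArg List.length (LE_append_of_disjoint p' q' b3).1
      rw [List.length_append, a5] at h3
      rw [List.length_append, b5, ← he] at h4
      simp at h3 h4; omega
    obtain ⟨rfl, rfl⟩ := split_unique he a3 b3 hl
    rw [a2] at b2; simp at b2; rw [b2]
  · rintro ⟨v, q, p⟩ h
    obtain ⟨a1, a2, a3, a4, a5⟩ := key _ h
    simp only at *
    have hp : p ≠ [] := by rintro rfl; simp at a1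
    have hq := (LE_eq_singleton_iff _ _).1 a5
    have h1 : (p ++ q).head? = some 0 := by rw [List.head?_append, a1]; rfl
    have h2 : (p ++ q).getLast? = some x := by rw [List.getLast?_append, hq.2]; rfl
    rw [ind_true a1, ind_true a2, ind_true a3, ind_true a4, ind_true a5, ind_true h1, ind_true h2,
      lwt_append lam z a2 a3]
    ring
  · intro l hl
    simp only [mul_ne_zero_iff] at hl
    obtain ⟨⟨a, b⟩, -⟩ := hl
    have a := ind_ne_zero a
    have b := ind_ne_zero b
    have hl0 : LE l ≠ [] := by rw [Ne, LE_eq_nil_iff]; rintro rfl; simp at a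
    have hlen : 2 ≤ (LE l).length := by
      have h0 := List.length_pos_iff.2 hl0
      by_contra hc
      have h1 : (LE l).length = 1 := by omega
      obtain ⟨y, hy⟩ := (length_LE_eq_one_iff l).1 h1
      obtain ⟨c1, c2⟩ := (LE_eq_singleton_iff _ _).1 hy
      rw [a] at c1; rw [b] at c2; simp at c1 c2
      exact hx (c2.trans c1.symm)
    obtain ⟨p, q, rfl, hd, hm⟩ := exists_split l ((LE l).length - 1) (by omega)
    have hLE := (LE_append_of_disjoint p q hd).1
    have hlq : (LE q).length = 1 := by
      rw [hLE, List.length_append] at hm hlen; omega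
    have hp : p ≠ [] := by
      rintro rfl; simp [LE_nil] at hm; rw [hLE, List.length_append] at hlen; simp [LE_nil] at hlen
      omega
    obtain ⟨y, hy⟩ := (length_LE_eq_one_iff q).1 hlq
    have hq := (LE_eq_singleton_iff _ _).1 hy
    rw [List.getLast?_append, hq.2] at b
    simp at b
    subst b
    have h0 : p.head? = some 0 := by
      obtain ⟨w, t, rfl⟩ := List.exists_cons_of_ne_nil hp
      simpa using a
    obtain ⟨v, hv⟩ : ∃ v, p.getLast? = some v := ⟨_, List.getLast?_eq_some_getLast hp⟩
    have hvq : v ∉ q := fun h => hd h (getLast?_mem_LE hv)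
    refine ⟨(v, q, p), rfl, ?_⟩
    have h2 : (p ++ q).getLast? = some y := by rw [List.getLast?_append, hq.2]; rfl
    simp only
    rw [ind_true a, ind_true h2, ind_true h0, ind_true hv, ind_true hd, ind_true hvq,
      ind_true hy, lwt_append lam z hv hd]
    ring

theorem exists_last_mem {α : Type*} (L q : List α) (h : ∃ w ∈ L, w ∈ q) :
    ∃ s v t, L = s ++ v :: t ∧ v ∈ q ∧ List.Disjoint t q := by
  induction L using List.reverseRecOn with
  | nil => simp at h
  | append_singleton L x ih =>
    by_cases hx : x ∈ q
    · exact ⟨L, x, [], rfl, hx, by simp⟩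
    · obtain ⟨w, hw, hwq⟩ := h
      have hwL : w ∈ L := by
        rcases List.mem_append.1 hw with h | h
        · exact h
        · simp at h; exact absurd (h ▸ hwq) hx
      obtain ⟨s, v, t, rfl, hv, ht⟩ := ih ⟨w, hwL, hwq⟩
      refine ⟨s, v, t ++ [x], by simp, hv, ?_⟩
      intro y hy hyq
      rcases List.mem_append.1 hy with h | h
      · exact ht h hyq
      · simp at h; exact hx (h ▸ hyq)

theorem exists_split_last_mem {p q : List (Pt d)} {v : Pt d} (hv : p.getLast? = some v)
    (hvq : v ∉ q) (hd : ¬ List.Disjoint q (LE p)) :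
    ∃ p' q' v', p = p' ++ q' ∧ List.Disjoint q' (LE p') ∧ p'.getLast? = some v' ∧ v' ∈ q ∧
      List.Disjoint (LE q') q ∧ q'.getLast? = some v := by
  have hex : ∃ w ∈ LE p, w ∈ q := by
    by_contra hcon
    push Not at hcon
    exact hd fun y hy hy' => hcon y hy' hy
  obtain ⟨s, v', t, hs, hv', ht⟩ := exists_last_mem (LE p) q hex
  obtain ⟨p', q', rfl, hd', hm⟩ := exists_split p (s.length + 1) (by rw [hs]; simp)
  have hLE := (LE_append_of_disjoint p' q' hd').1
  have he : LE p' ++ LE q' = (s ++ [v']) ++ t := by rw [← hLE, hs]; simp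
  obtain ⟨h1, h2⟩ := List.append_inj he (by simp [hm])
  have hp' : p'.getLast? = some v' := by rw [← LE_getLast?, h1]; simp
  refine ⟨p', q', v', rfl, hd', hp', hv', h2 ▸ ht, ?_⟩
  rw [List.getLast?_append] at hv
  cases hq : q'.getLast? with
  | none =>
    rw [hq, hp'] at hv
    simp at hv
    exact absurd (hv ▸ hv') hvq
  | some w => rw [hq] at hv; simpa using hv

theorem split_last_mem_unique {p q p' q' r : List (Pt d)} {v v' : Pt d} (he : p ++ q = p' ++ q')
    (hd : List.Disjoint q (LE p)) (hd' : List.Disjoint q' (LE p')) (hv : p.getLast? = some v)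
    (hv' : p'.getLast? = some v') (hr : v ∈ r) (hr' : v' ∈ r) (hq : List.Disjoint (LE q) r)
    (hq' : List.Disjoint (LE q') r) : p = p' ∧ q = q' := by
  have h1 := (LE_append_of_disjoint p q hd).1
  have h2 := (LE_append_of_disjoint p' q' hd').1
  rw [he, h2] at h1
  have aux : ∀ {a b a' b' : List (Pt d)} {w : Pt d}, a ++ b = a' ++ b' → a.getLast? = some w →
      w ∈ r → List.Disjoint b' r → a.length ≤ a'.length := by
    intro a b a' b' w h hw hwr hb
    by_contra hlt
    push Not at hlt
    rcases List.append_eq_append_iff.1 h with ⟨c, hc, -⟩ | ⟨c, hc, hc'⟩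
    · rw [hc] at hlt; simp at hlt
    · have hne : c ≠ [] := by rintro rfl; rw [hc] at hlt; simp at hlt
      have : c.getLast? = some w := by
        rw [hc, List.getLast?_append] at hw
        rw [List.getLast?_eq_some_getLast hne] at hw ⊢
        simpa using hw
      exact hb (hc' ▸ List.mem_append_left _ (List.mem_of_getLast? this)) hwr
  refine split_unique he hd hd' (le_antisymm ?_ ?_)
  · exact aux h1.symm (by rw [LE_getLast?, hv]) hr hq'
  · exact aux h1 (by rw [LE_getLast?, hv']) hr' hq

theorem G_eq_avoidWt_add {v : Pt d} {q : List (Pt d)} (hvq : v ∉ q) :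
    G lam z 0 v = avoidWt lam z v q + ∑' v' : Pt d, ∑' q' : List (Pt d), avoidWt lam z v' q' *
      (cwt lam z v' q' * ind (v' ∉ q') * ind (q'.getLast? = some v) *
        (ind (v' ∈ q) * ind (List.Disjoint (LE q') q))) := by
  have h1 : G lam z 0 v = avoidWt lam z v q + ∑' p : List (Pt d), ind (p.head? = some 0) *
      ind (p.getLast? = some v) * lwt lam z p * ind (¬ List.Disjoint q (LE p)) := by
    rw [G_eq, avoidWt, ← ENNReal.tsum_add]
    refine tsum_congr fun p => ?_
    rw [← mul_add, ind_add_ind_not, mul_one]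
  rw [h1]
  congr 1
  symm
  have h2 : (∑' v' : Pt d, ∑' q' : List (Pt d), avoidWt lam z v' q' *
      (cwt lam z v' q' * ind (v' ∉ q') * ind (q'.getLast? = some v) *
        (ind (v' ∈ q) * ind (List.Disjoint (LE q') q)))) =
      ∑' t : Pt d × List (Pt d) × List (Pt d),
      ind (t.2.2.head? = some 0) * ind (t.2.2.getLast? = some t.1) * lwt lam z t.2.2 *
        ind (List.Disjoint t.2.1 (LE t.2.2)) *
      (cwt lam z t.1 t.2.1 * ind (t.1 ∉ t.2.1) * ind (t.2.1.getLast? = some v) *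
        (ind (t.1 ∈ q) * ind (List.Disjoint (LE t.2.1) q))) := by
    rw [ENNReal.tsum_prod']
    refine tsum_congr fun v => ?_
    rw [ENNReal.tsum_prod']
    refine tsum_congr fun q => ?_
    exact ENNReal.tsum_mul_right.symm
  rw [h2]
  have key : ∀ t : Pt d × List (Pt d) × List (Pt d),
      ind (t.2.2.head? = some 0) * ind (t.2.2.getLast? = some t.1) * lwt lam z t.2.2 *
        ind (List.Disjoint t.2.1 (LE t.2.2)) *
      (cwt lam z t.1 t.2.1 * ind (t.1 ∉ t.2.1) * ind (t.2.1.getLast? = some v) *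
        (ind (t.1 ∈ q) * ind (List.Disjoint (LE t.2.1) q))) ≠ 0 →
      t.2.2.head? = some 0 ∧ t.2.2.getLast? = some t.1 ∧ List.Disjoint t.2.1 (LE t.2.2) ∧
        t.1 ∉ t.2.1 ∧ t.2.1.getLast? = some v ∧ t.1 ∈ q ∧ List.Disjoint (LE t.2.1) q := by
    intro t ht
    simp only [mul_ne_zero_iff] at ht
    obtain ⟨⟨⟨⟨a, b⟩, -⟩, c⟩, ⟨⟨-, e⟩, f⟩, g, h⟩ := ht
    exact ⟨ind_ne_zero a, ind_ne_zero b, ind_ne_zero c, ind_ne_zero e, ind_ne_zero f,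
      ind_ne_zero g, ind_ne_zero h⟩
  refine tsum_eq_tsum_of_bij (fun t : Pt d × List (Pt d) × List (Pt d) => t.2.2 ++ t.2.1) ?_ ?_ ?_
  · rintro ⟨w, r, p⟩ ⟨w', r', p'⟩ h h' he
    obtain ⟨-, a2, a3, -, -, a6, a7⟩ := key _ h
    obtain ⟨-, b2, b3, -, -, b6, b7⟩ := key _ h'
    simp only at *
    obtain ⟨rfl, rfl⟩ := split_last_mem_unique he a3 b3 a2 b2 a6 b6 a7 b7
    rw [a2] at b2; simp at b2; rw [b2]
  · rintro ⟨w, r, p⟩ h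
    obtain ⟨a1, a2, a3, a4, a5, a6, a7⟩ := key _ h
    simp only at *
    have h1 : (p ++ r).head? = some 0 := by rw [List.head?_append, a1]; rfl
    have h2 : (p ++ r).getLast? = some v := by rw [List.getLast?_append, a5]; rfl
    have h3 : ¬ List.Disjoint q (LE (p ++ r)) := by
      intro hd
      refine hd a6 ?_
      rw [(LE_append_of_disjoint p r a3).1]
      exact List.mem_append_left _ (getLast?_mem_LE a2)
    rw [ind_true a1, ind_true a2, ind_true a3, ind_true a4, ind_true a5, ind_true a6, ind_true a7,
      ind_true h1, ind_true h2, ind_true h3, lwt_append lam z a2 a3]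
    ring
  · intro l hl
    simp only [mul_ne_zero_iff] at hl
    obtain ⟨⟨⟨a, b⟩, -⟩, c⟩ := hl
    have a := ind_ne_zero a
    have b := ind_ne_zero b
    have c := ind_ne_zero c
    obtain ⟨p, r, w, rfl, a3, a2, a6, a7, a5⟩ := exists_split_last_mem b hvq c
    have hp : p ≠ [] := by rintro rfl; simp at a2
    have a1 : p.head? = some 0 := by
      obtain ⟨w, t, rfl⟩ := List.exists_cons_of_ne_nil hp
      simpa using a
    have a4 : w ∉ r := fun h => a3 h (getLast?_mem_LE a2)
    refine ⟨(w, r, p), rfl, ?_⟩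
    simp only
    rw [ind_true a1, ind_true a2, ind_true a3, ind_true a4, ind_true a5, ind_true a6, ind_true a7,
      ind_true a, ind_true b, ind_true c, lwt_append lam z a2 a3]
    ring

theorem laceRem_add_laceRem_succ (n : ℕ) (x : Pt d) :
    laceRem lam z n x + laceRem lam z (n + 1) x =
      ∑' v : Pt d, G lam z 0 v * laceKer lam z n v x := by
  have h1 : ∀ v : Pt d, G lam z 0 v * laceKer lam z n v x =
      (∑' q, avoidWt lam z v q * lace lam z n v q x) + ∑' q, (∑' v' : Pt d, ∑' q' : List (Pt d),
        avoidWt lam z v' q' * (cwt lam z v' q' * ind (v' ∉ q') * ind (q'.getLast? = some v) *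
        (ind (v' ∈ q) * ind (List.Disjoint (LE q') q)))) * lace lam z n v q x := by
    intro v
    rw [laceKer, ← ENNReal.tsum_mul_left, ← ENNReal.tsum_add]
    refine tsum_congr fun q => ?_
    by_cases hvq : v ∈ q
    · simp [lace_eq_zero_of_mem lam z n hvq]
    · rw [G_eq_avoidWt_add lam z hvq, add_mul]
  simp_rw [h1]
  rw [ENNReal.tsum_add]
  congr 1
  unfold laceRem
  simp_rw [← ENNReal.tsum_mul_right]
  have e1 : ∀ v : Pt d, (∑' q : List (Pt d), ∑' v' : Pt d, ∑' q' : List (Pt d),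
        avoidWt lam z v' q' * (cwt lam z v' q' * ind (v' ∉ q') * ind (q'.getLast? = some v) *
        (ind (v' ∈ q) * ind (List.Disjoint (LE q') q))) * lace lam z n v q x) =
      ∑' v' : Pt d, ∑' q' : List (Pt d), ∑' q : List (Pt d),
        avoidWt lam z v' q' * (cwt lam z v' q' * ind (v' ∉ q') * ind (q'.getLast? = some v) *
        (ind (v' ∈ q) * ind (List.Disjoint (LE q') q))) * lace lam z n v q x := by
    intro v
    rw [ENNReal.tsum_comm]
    refine tsum_congr fun v' => ?_
    rw [ENNReal.tsum_comm]
  simp_rw [e1]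
  symm
  rw [ENNReal.tsum_comm]
  refine tsum_congr fun v' => ?_
  rw [ENNReal.tsum_comm]
  refine tsum_congr fun q' => ?_
  rw [lace]
  simp_rw [← ENNReal.tsum_mul_left]
  refine tsum_congr fun v => ?_
  refine tsum_congr fun q => ?_
  ring

end Lace

section Symmetry

variable {d : ℕ}

theorem not_adj_self (x : Pt d) : ¬ Adj x x := by
  simp [Adj, dist1]

theorem isSAPList_of_mem_erasedLoops {l η : List (Pt d)} (hl : l.IsChain Adj)
    (h : η ∈ erasedLoops l) : IsSAPList η := by
  induction l using List.reverseRecOn with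
  | nil => simp [erasedLoops_nil] at h
  | append_singleton l x ih =>
    rw [List.isChain_append] at hl
    obtain ⟨hl1, -, hl2⟩ := hl
    rw [erasedLoops_concat] at h
    split_ifs at h with hx
    · rcases Multiset.mem_cons.1 h with rfl | h
      · have hch := isChain_LE hl1
        have hnd := LE_nodup l
        have hlast := LE_getLast? l
        obtain ⟨s, t, hst, hs⟩ := List.eq_append_cons_of_mem hx
        have hdw : (LE l).dropWhile (fun y => y ≠ x) = x :: t := by
          rw [hst, List.dropWhile_append_of_pos]
          · simp
          · intro a ha
            have : a ≠ x := by rintro rfl; exact hs ha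
            simpa using this
        rw [hdw]
        rw [hst] at hch hnd hlast
        rw [List.getLast?_append] at hlast
        obtain ⟨y, hy⟩ : ∃ y, (x :: t).getLast? = some y := ⟨_, List.getLast?_cons⟩
        rw [hy] at hlast
        have hadj : Adj y x := by
          refine hl2 y ?_ x (by simp)
          rw [← hlast]; simp
        refine ⟨?_, ?_, ?_, ?_⟩
        · change List.IsChain Adj _
          rw [List.isChain_append]
          refine ⟨(List.isChain_append.1 hch).2.1, by simp, ?_⟩
          intro a ha b hb
          rw [hy] at ha
          simp at ha hb
          subst ha; subst hb; exact hadj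
        · cases t with
          | nil =>
            simp at hy
            exact absurd (hy ▸ hadj) (not_adj_self _)
          | cons a t => simp
        · rw [getLastD_eq_iff (by simp), List.getLast?_concat]; rfl
        · rw [List.dropLast_concat]
          exact (List.nodup_append.1 hnd).2.1
      · exact ih hl1 h
    · exact ih hl1 h

theorem adj_map {R : Pt d ≃ Pt d} (hR : IsLatticeIso R) (x y : Pt d) :
    Adj (R x) (R y) ↔ Adj x y := by
  unfold Adj; rw [hR]

variable {lam : List (Pt d) → ℝ≥0} (hsym : SymmAssumption lam) (z : ℝ≥0) {R : Pt d ≃ Pt d}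
  (hR : IsLatticeIso R)

theorem isChain_map_iff (hR : IsLatticeIso R) (l : List (Pt d)) :
    (l.map R).IsChain Adj ↔ l.IsChain Adj := by
  rw [List.isChain_map]
  have : (fun a b => Adj (R a) (R b)) = (Adj : Pt d → Pt d → Prop) := by
    funext a b; exact propext (adj_map hR a b)
  rw [this]

include hsym hR in
theorem loopWt_map {l : List (Pt d)} (hl : l.IsChain Adj) :
    loopWt lam (l.map R) = loopWt lam l := by
  unfold loopWt
  rw [(LE_map R R.injective l).2, Multiset.map_map]
  congr 1
  refine Multiset.map_congr rfl fun η hη => ?_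
  simp only [Function.comp]
  rw [hsym.1 R hR η (isSAPList_of_mem_erasedLoops hl hη)]

include hsym hR in
theorem lwt_map (l : List (Pt d)) : lwt lam z (l.map R) = lwt lam z l := by
  unfold lwt
  rw [ind_congr (isChain_map_iff hR l), List.length_map]
  by_cases hl : l.IsChain Adj
  · rw [loopWt_map hsym hR hl]
  · simp [ind_false hl]

include hsym hR in
theorem cwt_map (v : Pt d) (q : List (Pt d)) : cwt lam z (R v) (q.map R) = cwt lam z v q := by
  unfold cwt
  rw [← List.map_cons, ind_congr (isChain_map_iff hR _), List.length_map]
  by_cases hl : (v :: q).IsChain Adj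
  · rw [loopWt_map hsym hR (l := q) hl.tail]
  · simp [ind_false hl]

theorem tsum_map_equiv (R : Pt d ≃ Pt d) (f : List (Pt d) → ℝ≥0∞) :
    ∑' l : List (Pt d), f (l.map R) = ∑' l, f l :=
  (Equiv.listEquivOfEquiv R).tsum_eq f

include hsym hR in
theorem G_map (x y : Pt d) : G lam z (R x) (R y) = G lam z x y := by
  rw [G_eq, G_eq, ← tsum_map_equiv R]
  refine tsum_congr fun l => ?_
  have h1 : (l.map R).head? = some (R x) ↔ l.head? = some x := by
    rw [List.head?_map]; simp
  have h2 : (l.map R).getLast? = some (R y) ↔ l.getLast? = some y := by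
    rw [List.getLast?_map]; simp
  rw [ind_congr h1, ind_congr h2, lwt_map hsym z hR]

include hsym hR in
theorem lace_map (n : ℕ) (v : Pt d) (q : List (Pt d)) (x : Pt d) :
    lace lam z n (R v) (q.map R) (R x) = lace lam z n v q x := by
  have hmem : ∀ (v : Pt d) (q : List (Pt d)), R v ∈ q.map R ↔ v ∈ q := by
    intro v q; simp
  have hLE : ∀ q : List (Pt d), LE (q.map R) = (LE q).map R :=
    fun q => (LE_map R R.injective q).1
  induction n generalizing v q with
  | zero =>
    have h2 : LE (q.map R) = [R x] ↔ LE q = [x] := by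
      rw [hLE, List.map_eq_singleton_iff]
      constructor
      · rintro ⟨a, h, h'⟩; rw [h, R.injective h']
      · intro h; exact ⟨x, h, rfl⟩
    simp only [lace]
    rw [cwt_map hsym z hR, ind_congr (not_congr (hmem v q)), ind_congr h2]
  | succ n ih =>
    simp only [lace]
    rw [cwt_map hsym z hR, ind_congr (not_congr (hmem v q))]
    congr 1
    rw [← R.tsum_eq]
    refine tsum_congr fun v' => ?_
    have h2 : (q.map R).getLast? = some (R v') ↔ q.getLast? = some v' := by
      rw [List.getLast?_map]; simp
    rw [ind_congr h2]
    congr 1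
    rw [← tsum_map_equiv R]
    refine tsum_congr fun q' => ?_
    have h3 : List.Disjoint (LE (q.map R)) (q'.map R) ↔ List.Disjoint (LE q) q' := by
      rw [hLE]
      constructor
      · intro h a ha ha'
        exact h (List.mem_map_of_mem ha) (List.mem_map_of_mem ha')
      · intro h a ha ha'
        obtain ⟨b, hb, rfl⟩ := List.mem_map.1 ha
        exact h hb ((hmem b q').1 ha')
    rw [ind_congr (hmem v q'), ind_congr h3, ih]

include hsym hR in
theorem laceKer_map (n : ℕ) (v x : Pt d) :
    laceKer lam z n (R v) (R x) = laceKer lam z n v x := by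
  unfold laceKer
  rw [← tsum_map_equiv R]
  exact tsum_congr fun q => lace_map hsym z hR n v q x

/-- The weight of the closed walks at `y` that visit `u`. -/
def hitWt (lam : List (Pt d) → ℝ≥0) (z : ℝ≥0) (y u : Pt d) : ℝ≥0∞ :=
  ∑' b : List (Pt d), ind (LE b = [y]) * ind (u ∈ b) * lwt lam z b

include hsym hR in
theorem hitWt_map (y u : Pt d) : hitWt lam z (R y) (R u) = hitWt lam z y u := by
  unfold hitWt
  rw [← tsum_map_equiv R]
  refine tsum_congr fun b => ?_
  have h2 : LE (b.map R) = [R y] ↔ LE b = [y] := by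
    rw [(LE_map R R.injective b).1, List.map_eq_singleton_iff]
    constructor
    · rintro ⟨a, h, h'⟩; rw [h, R.injective h']
    · intro h; exact ⟨y, h, rfl⟩
  have h1 : R u ∈ b.map R ↔ u ∈ b := by simp
  rw [ind_congr h1, ind_congr h2, lwt_map hsym z hR]

theorem isLatticeIso_addRight (a : Pt d) : IsLatticeIso (Equiv.addRight a) := by
  intro x y; simp [dist1]

theorem isLatticeIso_neg : IsLatticeIso (Equiv.neg (Pt d)) := by
  intro x y
  simp only [dist1, Equiv.neg_apply, Pi.neg_apply]
  refine Finset.sum_congr rfl fun i _ => ?_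
  rw [← Int.natAbs_neg]; congr 1; ring

/-- The two-point function from the origin. -/
def gf (lam : List (Pt d) → ℝ≥0) (z : ℝ≥0) (x : Pt d) : ℝ≥0∞ := G lam z 0 x

/-- The lace kernels from the origin. -/
def Jf (lam : List (Pt d) → ℝ≥0) (z : ℝ≥0) (n : ℕ) (x : Pt d) : ℝ≥0∞ := laceKer lam z n 0 x

/-- The weight of the closed walks at the origin that visit a given point. -/
def hf (lam : List (Pt d) → ℝ≥0) (z : ℝ≥0) (u : Pt d) : ℝ≥0∞ := hitWt lam z 0 u

include hsym in
theorem G_eq_gf (x y : Pt d) : G lam z x y = gf lam z (y - x) := by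
  have := G_map hsym z (isLatticeIso_addRight x) 0 (y - x)
  simpa [gf, Jf, hf] using this

include hsym in
theorem laceKer_eq_Jf (n : ℕ) (x y : Pt d) : laceKer lam z n x y = Jf lam z n (y - x) := by
  have := laceKer_map hsym z (isLatticeIso_addRight x) n 0 (y - x)
  simpa [gf, Jf, hf] using this

include hsym in
theorem hitWt_eq_hf (x y : Pt d) : hitWt lam z x y = hf lam z (y - x) := by
  have := hitWt_map hsym z (isLatticeIso_addRight x) 0 (y - x)
  simpa [gf, Jf, hf] using this

include hsym in
theorem gf_neg (x : Pt d) : gf lam z (-x) = gf lam z x := by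
  simpa [gf] using G_map hsym z isLatticeIso_neg 0 x

include hsym in
theorem Jf_neg (n : ℕ) (x : Pt d) : Jf lam z n (-x) = Jf lam z n x := by
  simpa [Jf] using laceKer_map hsym z isLatticeIso_neg n 0 x

include hsym in
theorem hf_neg (x : Pt d) : hf lam z (-x) = hf lam z x := by
  simpa [hf] using hitWt_map hsym z isLatticeIso_neg 0 x

include hsym in
theorem laceRem_add_laceRem_succ' (n : ℕ) (x : Pt d) :
    laceRem lam z n x + laceRem lam z (n + 1) x =
      ∑' v : Pt d, gf lam z v * Jf lam z n (x - v) := by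
  rw [laceRem_add_laceRem_succ]
  exact tsum_congr fun v => by rw [laceKer_eq_Jf hsym]; rfl

end Symmetry

section Bounds

variable {d : ℕ}

/-- The weight of a single step. -/
def nb (d : ℕ) (z : ℝ≥0) (x : Pt d) : ℝ≥0∞ := ind (Adj 0 x) * z

theorem adj_iff_sub (x y : Pt d) : Adj x y ↔ Adj 0 (y - x) := by
  have := adj_map (isLatticeIso_addRight x) 0 (y - x)
  simpa using this

theorem nb_neg (z : ℝ≥0) (x : Pt d) : nb d z (-x) = nb d z x := by
  unfold nb
  congr 1
  refine ind_congr ?_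
  have := adj_map (isLatticeIso_neg (d := d)) 0 x
  simpa using this

theorem nb_sub (z : ℝ≥0) (x y : Pt d) : nb d z (y - x) = ind (Adj x y) * z := by
  unfold nb
  rw [ind_congr (adj_iff_sub x y)]

variable (lam : List (Pt d) → ℝ≥0) (z : ℝ≥0)

/-- The two-point function followed by a step. -/
def Ef (s : Pt d) : ℝ≥0∞ := ∑' v : Pt d, gf lam z v * nb d z (s - v)

/-- The weight of the continuations that avoid `v`, end at `v'` and visit `u`. -/
def Qf (v v' u : Pt d) : ℝ≥0∞ :=
  ∑' q : List (Pt d), cwt lam z v q * ind (v ∉ q) * ind (q.getLast? = some v') * ind (u ∈ q)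

/-- The weight of the laces that visit `u`. -/
def Rf (n : ℕ) (v u x : Pt d) : ℝ≥0∞ := ∑' q : List (Pt d), lace lam z n v q x * ind (u ∈ q)

theorem tsum_closed (y : Pt d) :
    ∑' b : List (Pt d), ind (LE b = [y]) * lwt lam z b = G lam z y y := by
  rw [G_eq]
  refine tsum_congr fun b => ?_
  rw [ind_congr (LE_eq_singleton_iff b y), ind_and]

theorem lace_zero_eq (v x : Pt d) (q : List (Pt d)) :
    lace lam z 0 v q x = nb d z (x - v) * (ind (v ∉ q) * (ind (LE q = [x]) * lwt lam z q)) := by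
  simp only [lace]
  by_cases h : LE q = [x]
  · rw [cwt_eq_mul_lwt lam z ((LE_eq_singleton_iff _ _).1 h).1, nb_sub]
    ring
  · simp [ind_false h]

theorem laceKer_zero_le (v x : Pt d) : laceKer lam z 0 v x ≤ nb d z (x - v) * G lam z x x := by
  unfold laceKer
  simp_rw [lace_zero_eq]
  rw [ENNReal.tsum_mul_left, ← tsum_closed]
  refine mul_le_mul' le_rfl (ENNReal.tsum_le_tsum fun q => ?_)
  exact mul_le_of_le_one_left' (ind_le_one _)

theorem le_laceKer_zero (v x : Pt d) : nb d z (x - v) ≤ laceKer lam z 0 v x := by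
  by_cases h : Adj v x
  · refine le_trans ?_ (ENNReal.le_tsum [x])
    have hv : v ∉ [x] := by
      simp only [List.mem_singleton]
      rintro rfl; exact not_adj_self _ h
    rw [lace_zero_eq, ind_true hv, LE_singleton, ind_true rfl, lwt_singleton]
    simp
  · rw [nb_sub, ind_false h, zero_mul]; exact zero_le

theorem Rf_zero_le (v u x : Pt d) : Rf lam z 0 v u x ≤ nb d z (x - v) * hitWt lam z x u := by
  unfold Rf hitWt
  simp_rw [lace_zero_eq]
  rw [← ENNReal.tsum_mul_left]
  refine ENNReal.tsum_le_tsum fun q => ?_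
  calc _ = nb d z (x - v) * (ind (v ∉ q) * (ind (LE q = [x]) * ind (u ∈ q) * lwt lam z q)) := by
        ring
    _ ≤ _ := by
      exact mul_le_mul' le_rfl (mul_le_of_le_one_left' (ind_le_one _))

theorem Rf_succ_le (n : ℕ) (v u x : Pt d) :
    Rf lam z (n + 1) v u x ≤ ∑' v' : Pt d, Qf lam z v v' u * Rf lam z n v' v x := by
  unfold Rf Qf
  simp only [lace]
  simp_rw [← ENNReal.tsum_mul_left, ← ENNReal.tsum_mul_right]
  rw [ENNReal.tsum_comm]
  refine ENNReal.tsum_le_tsum fun v' => ?_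
  rw [ENNReal.tsum_comm]
  refine ENNReal.tsum_le_tsum fun q' => ?_
  refine ENNReal.tsum_le_tsum fun q => ?_
  calc _ = cwt lam z v q * ind (v ∉ q) * ind (q.getLast? = some v') * ind (u ∈ q) *
      (ind (List.Disjoint (LE q) q') * (lace lam z n v' q' x * ind (v ∈ q'))) := by ring
    _ ≤ _ := by
      exact mul_le_mul' le_rfl (mul_le_of_le_one_left' (ind_le_one _))

theorem tsum_cwt_le (v v' : Pt d) :
    ∑' q : List (Pt d), cwt lam z v q * ind (v ∉ q) * ind (q.getLast? = some v') ≤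
      ind (v' ≠ v) * G lam z v v' := by
  rw [G_eq, ← ENNReal.tsum_mul_left]
  refine tsum_le_tsum_of_injOn (fun q => v :: q) (fun a b _ _ h => by simpa using h) fun q => ?_
  by_cases h : v ∉ q
  · by_cases h' : q.getLast? = some v'
    · have hne : v' ≠ v := by rintro rfl; exact h (List.mem_of_getLast? h')
      have h1 : (v :: q).getLast? = some v' := by rw [List.getLast?_cons, h']; rfl
      rw [ind_true h, ind_true h', ind_true hne, ind_true h1, cwt_eq_lwt_cons lam z h]
      simp [ind_true]
    · rw [ind_false h']; simp
  · rw [ind_false h]; simp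

theorem laceKer_succ_le (n : ℕ) (v x : Pt d) :
    laceKer lam z (n + 1) v x ≤
      ∑' v' : Pt d, ind (v' ≠ v) * G lam z v v' * Rf lam z n v' v x := by
  calc laceKer lam z (n + 1) v x ≤ ∑' v' : Pt d, (∑' q : List (Pt d), cwt lam z v q *
        ind (v ∉ q) * ind (q.getLast? = some v')) * Rf lam z n v' v x := by
        unfold laceKer Rf
        simp only [lace]
        simp_rw [← ENNReal.tsum_mul_left, ← ENNReal.tsum_mul_right]
        rw [ENNReal.tsum_comm]
        refine ENNReal.tsum_le_tsum fun v' => ?_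
        rw [ENNReal.tsum_comm]
        refine ENNReal.tsum_le_tsum fun q' => ?_
        refine ENNReal.tsum_le_tsum fun q => ?_
        calc _ = cwt lam z v q * ind (v ∉ q) * ind (q.getLast? = some v') *
            (ind (List.Disjoint (LE q) q') * (lace lam z n v' q' x * ind (v ∈ q'))) := by ring
          _ ≤ _ := by
            exact mul_le_mul' le_rfl (mul_le_of_le_one_left' (ind_le_one _))
    _ ≤ _ := by
        exact ENNReal.tsum_le_tsum fun v' => mul_le_mul' (tsum_cwt_le lam z v v') le_rfl

theorem tsum_mul_tsum_mul_tsum {α β γ : Type*} (f : α → ℝ≥0∞) (g : β → ℝ≥0∞) (h : γ → ℝ≥0∞) :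
    (∑' a, f a) * (∑' b, g b) * (∑' c, h c) = ∑' t : α × β × γ, f t.1 * g t.2.1 * h t.2.2 := by
  rw [ENNReal.tsum_prod', mul_assoc, ← ENNReal.tsum_mul_right]
  refine tsum_congr fun a => ?_
  rw [ENNReal.tsum_prod', ← ENNReal.tsum_mul_right, ← ENNReal.tsum_mul_left]
  refine tsum_congr fun b => ?_
  rw [← mul_assoc, ← ENNReal.tsum_mul_left]

theorem Qf_le (v v' u : Pt d) : Qf lam z v v' u ≤
    ∑' y : Pt d, ind (y ≠ v) * (G lam z v y * hitWt lam z y u * G lam z y v') := by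
  have e : ∀ y : Pt d, ind (y ≠ v) * (G lam z v y * hitWt lam z y u * G lam z y v') =
      ∑' t : List (Pt d) × List (Pt d) × List (Pt d), ind (y ≠ v) *
        ((ind (t.1.head? = some v) * ind (t.1.getLast? = some y) * lwt lam z t.1) *
        (ind (LE t.2.1 = [y]) * ind (u ∈ t.2.1) * lwt lam z t.2.1) *
        (ind (t.2.2.head? = some y) * ind (t.2.2.getLast? = some v') * lwt lam z t.2.2)) := by
    intro y
    rw [G_eq, G_eq, hitWt, tsum_mul_tsum_mul_tsum, ENNReal.tsum_mul_left]
  simp_rw [e]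
  rw [← ENNReal.tsum_prod (f := fun (y : Pt d) (t : List (Pt d) × List (Pt d) × List (Pt d)) =>
    ind (y ≠ v) *
        ((ind (t.1.head? = some v) * ind (t.1.getLast? = some y) * lwt lam z t.1) *
        (ind (LE t.2.1 = [y]) * ind (u ∈ t.2.1) * lwt lam z t.2.1) *
        (ind (t.2.2.head? = some y) * ind (t.2.2.getLast? = some v') * lwt lam z t.2.2)))]
  refine tsum_le_tsum_of_cover
    (fun t : Pt d × List (Pt d) × List (Pt d) × List (Pt d) =>
      t.2.1.tail.dropLast ++ t.2.2.1 ++ t.2.2.2.tail) ?_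
  intro q hq
  simp only [mul_ne_zero_iff] at hq
  obtain ⟨⟨⟨-, h1⟩, h2⟩, h3⟩ := hq
  have h1 := ind_ne_zero h1
  have h2 := ind_ne_zero h2
  have h3 := ind_ne_zero h3
  obtain ⟨a, b, c, y, rfl, hb, hub, hba, hc⟩ := exists_block q u h3
  have hbb := (LE_eq_singleton_iff _ _).1 hb
  have hyb : y ∈ b := List.mem_of_head? hbb.1
  have hyv : y ≠ v := by rintro rfl; exact h1 (by simp [hyb])
  refine ⟨(y, (v :: a) ++ [y], b, y :: c), by simp, ?_⟩
  have hva : v ∉ a := fun h => h1 (by simp [h])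
  have hvb : v ∉ b := fun h => h1 (by simp [h])
  have hvc : v ∉ c := fun h => h1 (by simp [h])
  have hLEv : LE (v :: a) = v :: LE a := by
    have := (LE_append_of_disjoint [v] a (by
      rw [LE_singleton]; intro w hw hw'; simp at hw'; exact hva (hw' ▸ hw))).1
    rw [LE_singleton] at this
    simpa using this
  have hdb : List.Disjoint b (LE (v :: a)) := by
    rw [hLEv]; intro w hw hw'
    rcases List.mem_cons.1 hw' with rfl | h
    · exact hvb hw
    · exact hba hw h
  have hLEab := (LE_append_of_disjoint a b hba).1
  have hLEvab := (LE_append_of_disjoint (v :: a) b hdb).1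
  have hdc : List.Disjoint c (LE (v :: a ++ b)) := by
    rw [hLEvab, hLEv, List.cons_append, ← hLEab]; intro w hw hw'
    rcases List.mem_cons.1 hw' with rfl | h
    · exact hvc hw
    · exact hc hw h
  have hyc : y ∉ c := by
    intro h
    refine hc h ?_
    rw [hLEab, hb]; simp
  have hdy : List.Disjoint [y] (LE (v :: a)) := by
    intro w hw; simp at hw; subst hw; exact hdb hyb
  obtain ⟨w, hw⟩ : ∃ w, (v :: a).getLast? = some w := ⟨_, List.getLast?_cons⟩
  have hyab : (v :: a ++ b).getLast? = some y := by rw [List.getLast?_append, hbb.2]; rfl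
  have hyc' : (y :: c).getLast? = some v' := by
    rw [List.append_assoc, List.getLast?_append, List.getLast?_append, hbb.2] at h2
    rw [List.getLast?_cons]
    cases hcc : c.getLast? with
    | none => rw [hcc] at h2; simpa using h2
    | some r => rw [hcc] at h2; simpa using h2
  have hW : cwt lam z v (a ++ b ++ c) = lwt lam z (v :: a ++ [y]) * lwt lam z b *
      lwt lam z (y :: c) := by
    rw [cwt_eq_lwt_cons lam z h1]
    have : v :: (a ++ b ++ c) = (v :: a ++ b) ++ c := by simp
    rw [this, lwt_append lam z hyab hdc, lwt_append lam z hw hdb,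
      cwt_eq_mul_lwt lam z hbb.1, lwt_append lam z hw hdy, cwt_singleton,
      cwt_eq_lwt_cons lam z hyc]
    ring
  rw [hW, ind_true h1, ind_true h2, ind_true h3, ind_true hyv, ind_true hb, ind_true hub]
  have i1 : (v :: a ++ [y]).head? = some v := by simp
  have i2 : (v :: a ++ [y]).getLast? = some y := by
    rw [List.getLast?_concat]
  have i3 : (y :: c).head? = some y := by simp
  simp only
  rw [ind_true i1, ind_true i2, ind_true i3, ind_true hyc']
  simp

variable {lam} in
theorem exists_closed_decomp {M : ℝ≥0} (hM : ∀ l, IsSAPList l → lam l ≤ M) {b : List (Pt d)}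
    {y : Pt d} (hb : LE b = [y]) (hb' : b ≠ [y]) (hW : lwt lam z b ≠ 0) :
    ∃ l r v, b = l ++ r ++ [y] ∧ LE l = [y] ∧ y ∉ r ∧ r.getLast? = some v ∧
      lwt lam z b ≤ M * (lwt lam z l * cwt lam z y r * nb d z (y - v)) := by
  have hbb := (LE_eq_singleton_iff _ _).1 hb
  have hbne : b ≠ [] := by rintro rfl; simp at hbb
  obtain ⟨b0, y', rfl⟩ : ∃ b0 y', b = b0 ++ [y'] :=
    ⟨_, _, (List.dropLast_append_getLast hbne).symm⟩
  have hyy : y' = y := by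
    have := hbb.2
    rw [List.getLast?_concat] at this; simpa using this
  subst hyy
  have hb0 : b0 ≠ [] := by rintro rfl; simp at hb'
  have hhead : b0.head? = some y' := by
    obtain ⟨w, t, rfl⟩ := List.exists_cons_of_ne_nil hb0
    simpa using hbb.1
  have hLE0 : LE b0 ≠ [] := by rw [Ne, LE_eq_nil_iff]; exact hb0
  have hpos := List.length_pos_iff.2 hLE0
  obtain ⟨l, r, rfl, hd, hl⟩ := exists_split b0 1 hpos
  obtain ⟨x, hx⟩ := (length_LE_eq_one_iff l).1 hl
  have hlne : l ≠ [] := by rintro rfl; simp [LE_nil] at hl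
  have hxy : x = y' := by
    have := ((LE_eq_singleton_iff _ _).1 hx).1
    rw [List.head?_append, this] at hhead
    simpa using hhead
  subst hxy
  have hxr : x ∉ r := fun h => hd h (by rw [hx]; simp)
  have hll := (LE_eq_singleton_iff _ _).1 hx
  have hLE := LE_append_of_disjoint l r hd
  rw [hx] at hLE
  have hch : (l ++ r ++ [x]).IsChain Adj :=
    ind_ne_zero (left_ne_zero_of_mul (left_ne_zero_of_mul hW))
  have hxm : x ∈ LE (l ++ r) := by rw [hLE.1]; simp
  have hrne : r ≠ [] := by
    rintro rfl
    rw [List.append_nil, isChain_append_iff hll.2] at hch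
    have := hch.2
    simp at this
    exact not_adj_self _ this
  obtain ⟨v, hv⟩ : ∃ v, r.getLast? = some v := ⟨_, List.getLast?_eq_some_getLast hrne⟩
  have hlast : (l ++ r).getLast? = some v := by rw [List.getLast?_append, hv]; rfl
  refine ⟨l, r, v, rfl, hx, hxr, hv, ?_⟩
  have herase := erasedLoops_concat (l ++ r) x
  rw [if_pos hxm] at herase
  have hdw : (LE (l ++ r)).dropWhile (fun y => y ≠ x) = LE (l ++ r) := by
    rw [hLE.1]; simp
  rw [hdw] at herase
  have hsap : IsSAPList (LE (l ++ r) ++ [x]) :=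
    isSAPList_of_mem_erasedLoops hch (by rw [herase]; exact Multiset.mem_cons_self _ _)
  have hlw : loopWt lam (l ++ r ++ [x]) = lam (LE (l ++ r) ++ [x]) * loopWt lam (l ++ r) := by
    unfold loopWt; rw [herase, Multiset.map_cons, Multiset.prod_cons]
  have hwl : lwt lam z (l ++ r ++ [x]) = lam (LE (l ++ r) ++ [x]) * (lwt lam z (l ++ r) *
      nb d z (x - v)) := by
    unfold lwt
    rw [hlw, ind_congr (isChain_append_iff (q := [x]) hlast), ind_and, nb_sub]
    have h1 : (l ++ r ++ [x]).length - 1 = ((l ++ r).length - 1) + 1 := by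
      have := List.length_pos_iff.2 hb0
      rw [List.length_append]; simp at this ⊢; omega
    have h2 : [v, x].IsChain Adj ↔ Adj v x := by simp
    rw [h1, pow_succ, ind_congr h2]
    ring
  rw [hwl, lwt_append lam z hll.2 hd]
  gcongr
  exact hM _ hsap

end Bounds

section Convolution

variable {d : ℕ}

theorem tsum_add_right' (v : Pt d) (f : Pt d → ℝ≥0∞) : ∑' x, f (x + v) = ∑' x, f x :=
  (Equiv.addRight v).tsum_eq f

theorem tsum_sub_right' (v : Pt d) (f : Pt d → ℝ≥0∞) : ∑' x, f (x - v) = ∑' x, f x :=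
  (Equiv.subRight v).tsum_eq f

theorem tsum_sub_left' (v : Pt d) (f : Pt d → ℝ≥0∞) : ∑' x, f (v - x) = ∑' x, f x :=
  (Equiv.subLeft v).tsum_eq f

theorem tsum_neg' (f : Pt d → ℝ≥0∞) : ∑' x, f (-x) = ∑' x, f x :=
  (Equiv.neg (Pt d)).tsum_eq f

end Convolution

section Bounds

variable {d : ℕ} {lam : List (Pt d) → ℝ≥0} (hsym : SymmAssumption lam) (z : ℝ≥0)

theorem hf_zero : hf lam z 0 = gf lam z 0 := by
  unfold hf hitWt gf
  rw [← tsum_closed]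
  refine tsum_congr fun b => ?_
  by_cases h : LE b = [0]
  · have : (0 : Pt d) ∈ b := LE_subset b (by rw [h]; simp)
    rw [ind_true this, mul_one]
  · simp [ind_false h]

include hsym in
theorem Jf_zero_le (x : Pt d) : Jf lam z 0 x ≤ nb d z x * gf lam z 0 := by
  have := laceKer_zero_le lam z 0 x
  rwa [sub_zero, G_eq_gf hsym, sub_self] at this

theorem le_Jf_zero (x : Pt d) : nb d z x ≤ Jf lam z 0 x := by
  simpa [Jf] using le_laceKer_zero lam z 0 x

include hsym in
theorem gf_le (x : Pt d) : gf lam z x ≤ ind (x = 0) * gf lam z 0 + gf lam z 0 * Ef lam z x := by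
  have h1 : gf lam z x = ind (x = 0) * gf lam z 0 + laceRem lam z 0 x := G_zero_eq lam z x
  rw [h1]
  gcongr
  calc laceRem lam z 0 x ≤ ∑' v : Pt d, gf lam z v * Jf lam z 0 (x - v) := by
        rw [← laceRem_add_laceRem_succ' hsym]; exact le_self_add
    _ ≤ ∑' v : Pt d, gf lam z 0 * (gf lam z v * nb d z (x - v)) := by
        refine ENNReal.tsum_le_tsum fun v => ?_
        calc _ ≤ gf lam z v * (nb d z (x - v) * gf lam z 0) := by
              gcongr; exact Jf_zero_le hsym z _
          _ = _ := by ring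
    _ = _ := by rw [ENNReal.tsum_mul_left]; rfl

include hsym in
theorem Qf_zero_le (v u : Pt d) : Qf lam z 0 v u ≤
    ∑' y : Pt d, ind (y ≠ 0) * (gf lam z y * hf lam z (u - y) * gf lam z (v - y)) := by
  refine (Qf_le lam z 0 v u).trans (le_of_eq (tsum_congr fun y => ?_))
  rw [G_eq_gf hsym, G_eq_gf hsym, hitWt_eq_hf hsym, sub_zero]

include hsym in
theorem tsum_gf_sub_mul_nb (y : Pt d) :
    ∑' v : Pt d, gf lam z (v - y) * nb d z v = Ef lam z y := by
  unfold Ef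
  rw [← tsum_sub_left' y]
  refine tsum_congr fun v => ?_
  have : y - v - y = -v := by abel
  rw [this, gf_neg hsym]

section Closed

variable {M : ℝ≥0} (hM : ∀ l, IsSAPList l → lam l ≤ M)

include hsym hM in
theorem tsum_closed_ne_le : ∑' b : List (Pt d), ind (LE b = [0]) * ind (b ≠ [0]) * lwt lam z b ≤
    M * (gf lam z 0 * Ef lam z 0) := by
  have e : M * (gf lam z 0 * Ef lam z 0) ≥ ∑' t : List (Pt d) × Pt d × List (Pt d),
      M * ((ind (LE t.1 = [0]) * lwt lam z t.1) * (nb d z t.2.1 *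
        (cwt lam z 0 t.2.2 * ind (0 ∉ t.2.2) * ind (t.2.2.getLast? = some t.2.1)))) := by
    rw [ENNReal.tsum_mul_left, ENNReal.tsum_prod']
    simp_rw [ENNReal.tsum_mul_left, ENNReal.tsum_prod']
    rw [ENNReal.tsum_mul_right, tsum_closed]
    have h1 : Ef lam z 0 = ∑' v, nb d z v * gf lam z v := by
      rw [← tsum_gf_sub_mul_nb hsym]
      exact tsum_congr fun v => by rw [sub_zero, mul_comm]
    rw [h1]
    change M * (gf lam z 0 * _) ≤ M * (gf lam z 0 * _)
    gcongr with v
    rw [ENNReal.tsum_mul_left]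
    gcongr
    exact (tsum_cwt_le lam z 0 v).trans (mul_le_of_le_one_left' (ind_le_one _))
  refine le_trans ?_ e
  refine tsum_le_tsum_of_cover
    (fun t : List (Pt d) × Pt d × List (Pt d) => t.1 ++ t.2.2 ++ [0]) ?_
  intro b hb
  simp only [mul_ne_zero_iff] at hb
  obtain ⟨⟨h1, h2⟩, h3⟩ := hb
  have h1 := ind_ne_zero h1
  have h2 := ind_ne_zero h2
  obtain ⟨l, r, v, rfl, hl, hr, hv, hle⟩ := exists_closed_decomp z hM h1 h2 h3
  refine ⟨(l, v, r), rfl, ?_⟩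
  rw [ind_true h1, ind_true h2, one_mul, one_mul]
  simp only
  rw [ind_true hl, ind_true hr, ind_true hv]
  refine hle.trans (le_of_eq ?_)
  rw [zero_sub, nb_neg]
  ring

include hsym hM in
theorem gf_zero_le : gf lam z 0 ≤ 1 + M * (gf lam z 0 * Ef lam z 0) := by
  calc gf lam z 0 = ∑' b : List (Pt d), ind (LE b = [0]) * lwt lam z b := (tsum_closed lam z 0).symm
    _ ≤ ∑' b : List (Pt d), (ind ([0] = b) * lwt lam z b +
        ind (LE b = [0]) * ind (b ≠ [0]) * lwt lam z b) := by
        refine ENNReal.tsum_le_tsum fun b => ?_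
        by_cases h : b = [0]
        · rw [ind_true h.symm]
          refine le_trans ?_ le_self_add
          gcongr; exact ind_le_one _
        · rw [ind_true (show b ≠ [0] from h), mul_one]; exact le_add_self
    _ ≤ _ := by
        rw [ENNReal.tsum_add, tsum_ind_eq_mul, lwt_singleton]
        gcongr
        exact tsum_closed_ne_le hsym z hM

theorem one_le_gf_zero : 1 ≤ gf lam z 0 := by
  calc (1 : ℝ≥0∞) = ind (LE [(0 : Pt d)] = [0]) * lwt lam z [0] := by
        rw [LE_singleton, ind_true rfl, lwt_singleton, one_mul]
    _ ≤ ∑' b : List (Pt d), ind (LE b = [0]) * lwt lam z b :=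
        ENNReal.le_tsum (f := fun b : List (Pt d) => ind (LE b = [0]) * lwt lam z b) [0]
    _ = gf lam z 0 := tsum_closed lam z 0

include hsym hM in
theorem hf_le {u : Pt d} (hu : u ≠ 0) : hf lam z u ≤ M * (hf lam z u * Ef lam z 0) +
    M * (gf lam z 0 * ∑' t : Pt d, ind (t ≠ 0) * (gf lam z t * hf lam z (u - t) * Ef lam z t)) := by
  have e1 : M * (hf lam z u * Ef lam z 0) ≥ ∑' t : List (Pt d) × Pt d × List (Pt d),
      M * ((ind (LE t.1 = [0]) * ind (u ∈ t.1) * lwt lam z t.1) * (nb d z t.2.1 *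
        (cwt lam z 0 t.2.2 * ind (0 ∉ t.2.2) * ind (t.2.2.getLast? = some t.2.1)))) := by
    rw [ENNReal.tsum_mul_left, ENNReal.tsum_prod']
    simp_rw [ENNReal.tsum_mul_left, ENNReal.tsum_prod']
    rw [ENNReal.tsum_mul_right]
    have h1 : Ef lam z 0 = ∑' v, nb d z v * gf lam z v := by
      rw [← tsum_gf_sub_mul_nb hsym]
      exact tsum_congr fun v => by rw [sub_zero, mul_comm]
    rw [h1]
    change M * (hf lam z u * _) ≤ M * (hf lam z u * _)
    gcongr with v
    rw [ENNReal.tsum_mul_left]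
    gcongr
    exact (tsum_cwt_le lam z 0 v).trans (mul_le_of_le_one_left' (ind_le_one _))
  have e2 : M * (gf lam z 0 *
      ∑' t : Pt d, ind (t ≠ 0) * (gf lam z t * hf lam z (u - t) * Ef lam z t)) ≥
      ∑' t : List (Pt d) × Pt d × List (Pt d),
      M * ((ind (LE t.1 = [0]) * lwt lam z t.1) * (nb d z t.2.1 *
        (cwt lam z 0 t.2.2 * ind (0 ∉ t.2.2) * ind (t.2.2.getLast? = some t.2.1) *
          ind (u ∈ t.2.2)))) := by
    rw [ENNReal.tsum_mul_left, ENNReal.tsum_prod']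
    simp_rw [ENNReal.tsum_mul_left, ENNReal.tsum_prod']
    rw [ENNReal.tsum_mul_right, tsum_closed]
    change M * (gf lam z 0 * _) ≤ M * (gf lam z 0 * _)
    refine mul_le_mul' le_rfl (mul_le_mul' le_rfl ?_)
    simp_rw [ENNReal.tsum_mul_left]
    calc ∑' v : Pt d, nb d z v * Qf lam z 0 v u ≤ ∑' v : Pt d, nb d z v *
          ∑' y : Pt d, ind (y ≠ 0) * (gf lam z y * hf lam z (u - y) * gf lam z (v - y)) :=
          ENNReal.tsum_le_tsum fun v => mul_le_mul' le_rfl (Qf_zero_le hsym z v u)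
      _ = ∑' y : Pt d, ∑' v : Pt d, ind (y ≠ 0) * (gf lam z y * hf lam z (u - y)) *
          (gf lam z (v - y) * nb d z v) := by
          rw [ENNReal.tsum_comm]
          refine tsum_congr fun v => ?_
          rw [← ENNReal.tsum_mul_left]
          refine tsum_congr fun y => ?_
          ring
      _ = _ := by
          refine tsum_congr fun y => ?_
          rw [ENNReal.tsum_mul_left, tsum_gf_sub_mul_nb hsym]
          ring
  refine le_trans ?_ (add_le_add e1 e2)
  rw [← ENNReal.tsum_add]
  refine tsum_le_tsum_of_cover
    (fun t : List (Pt d) × Pt d × List (Pt d) => t.1 ++ t.2.2 ++ [0]) ?_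
  intro b hb
  simp only [mul_ne_zero_iff] at hb
  obtain ⟨⟨h1, h2⟩, h3⟩ := hb
  have h1 := ind_ne_zero h1
  have h2 := ind_ne_zero h2
  have hb0 : b ≠ [0] := by rintro rfl; simp at h2; exact hu h2
  obtain ⟨l, r, v, rfl, hl, hr, hv, hle⟩ := exists_closed_decomp z hM h1 hb0 h3
  refine ⟨(l, v, r), rfl, ?_⟩
  have hmem : 1 ≤ ind (u ∈ l) + ind (u ∈ r) := by
    have : u ∈ l ∨ u ∈ r := by
      simp only [List.mem_append, List.mem_singleton] at h2
      tauto
    rcases this with h | h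
    · rw [ind_true h]; exact le_self_add
    · rw [ind_true h]; exact le_add_self
  rw [ind_true h1, ind_true h2, one_mul, one_mul]
  simp only
  rw [ind_true hl, ind_true hr, ind_true hv]
  calc lwt lam z (l ++ r ++ [0]) ≤ M * (lwt lam z l * cwt lam z 0 r * nb d z (0 - v)) * 1 := by
        rw [mul_one]; exact hle
    _ ≤ M * (lwt lam z l * cwt lam z 0 r * nb d z (0 - v)) * (ind (u ∈ l) + ind (u ∈ r)) := by
        gcongr
    _ = _ := by
        rw [zero_sub, nb_neg]
        ring

end Closed

/-- Majorants of the weights of the laces that visit a given point. -/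
def rho (lam : List (Pt d) → ℝ≥0) (z : ℝ≥0) : ℕ → Pt d → Pt d → ℝ≥0∞
  | 0, u, x => nb d z x * hf lam z (u - x)
  | n + 1, u, x => ∑' v : Pt d, ∑' y : Pt d, ind (y ≠ 0) * (gf lam z y * hf lam z (u - y) *
      gf lam z (v - y)) * rho lam z n (-v) (x - v)

include hsym in
theorem Rf_le_rho (n : ℕ) (v u x : Pt d) : Rf lam z n v u x ≤ rho lam z n (u - v) (x - v) := by
  induction n generalizing v u x with
  | zero =>
    refine (Rf_zero_le lam z v u x).trans (le_of_eq ?_)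
    rw [hitWt_eq_hf hsym, rho, sub_sub_sub_cancel_right]
  | succ n ih =>
    calc _ ≤ ∑' v' : Pt d, Qf lam z v v' u * Rf lam z n v' v x := Rf_succ_le lam z n v u x
      _ ≤ ∑' v' : Pt d, (∑' y : Pt d, ind (y ≠ v) * (G lam z v y * hitWt lam z y u *
          G lam z y v')) * rho lam z n (v - v') (x - v') :=
          ENNReal.tsum_le_tsum fun v' => mul_le_mul' (Qf_le lam z v v' u) (ih v' v x)
      _ = _ := by
          rw [rho, ← tsum_add_right' v]
          refine tsum_congr fun v' => ?_
          rw [← ENNReal.tsum_mul_right, ← tsum_add_right' v]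
          refine tsum_congr fun y => ?_
          have h1 : y + v ≠ v ↔ y ≠ 0 := by simp
          rw [ind_congr h1, G_eq_gf hsym, G_eq_gf hsym, hitWt_eq_hf hsym]
          have h2 : y + v - v = y := by abel
          have h3 : u - (y + v) = u - v - y := by abel
          have h4 : v' + v - (y + v) = v' - y := by abel
          have h5 : v - (v' + v) = -v' := by abel
          have h6 : x - (v' + v) = x - v - v' := by abel
          rw [h2, h3, h4, h5, h6]

include hsym in
theorem Jf_succ_le (n : ℕ) (x : Pt d) : Jf lam z (n + 1) x ≤
    ∑' v : Pt d, ind (v ≠ 0) * gf lam z v * rho lam z n (-v) (x - v) := by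
  refine (laceKer_succ_le lam z n 0 x).trans (ENNReal.tsum_le_tsum fun v => ?_)
  refine mul_le_mul' le_rfl ?_
  simpa using Rf_le_rho hsym z n v 0 x

include hsym in
theorem Jf_one_le (x : Pt d) : Jf lam z 1 x ≤ Ef lam z x * hf lam z x := by
  refine (laceKer_succ_le lam z 0 0 x).trans ?_
  unfold Ef
  rw [← ENNReal.tsum_mul_right]
  refine ENNReal.tsum_le_tsum fun v => ?_
  calc _ ≤ 1 * gf lam z v * (nb d z (x - v) * hf lam z x) := by
        gcongr
        · exact ind_le_one _
        · exact le_rfl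
        · have := Rf_zero_le lam z v 0 x
          rwa [hitWt_eq_hf hsym, zero_sub, hf_neg hsym] at this
    _ = _ := by ring

/-- Weighted sums of a majorant in its second variable. -/
def rhoSum (lam : List (Pt d) → ℝ≥0) (z : ℝ≥0) (n : ℕ) (w : Pt d → ℝ≥0∞) (u : Pt d) : ℝ≥0∞ :=
  ∑' x : Pt d, rho lam z n u x * w x

theorem tsum_rhoSum_zero (w : Pt d → ℝ≥0∞) :
    ∑' u, rhoSum lam z 0 w u = (∑' x, nb d z x * w x) * ∑' u, hf lam z u := by
  unfold rhoSum rho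
  rw [ENNReal.tsum_comm, ← ENNReal.tsum_mul_right]
  refine tsum_congr fun x => ?_
  have : ∀ u, nb d z x * hf lam z (u - x) * w x = nb d z x * w x * hf lam z (u - x) :=
    fun u => by ring
  simp_rw [this]
  rw [ENNReal.tsum_mul_left, tsum_sub_right']

theorem tsum_rhoSum_succ (n : ℕ) (w : Pt d → ℝ≥0∞) :
    ∑' u, rhoSum lam z (n + 1) w u = (∑' u, hf lam z u) * ∑' v : Pt d,
      (∑' y, ind (y ≠ 0) * (gf lam z y * gf lam z (v - y))) *
        rhoSum lam z n (fun x => w (x + v)) (-v) := by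
  unfold rhoSum
  have e : ∀ u x : Pt d, rho lam z (n + 1) u x * w x = ∑' v : Pt d, ∑' y : Pt d,
      hf lam z (u - y) * (ind (y ≠ 0) * (gf lam z y * gf lam z (v - y)) *
        (rho lam z n (-v) (x - v) * w x)) := by
    intro u x
    rw [rho, ← ENNReal.tsum_mul_right]
    refine tsum_congr fun v => ?_
    rw [← ENNReal.tsum_mul_right]
    refine tsum_congr fun y => ?_
    ring
  simp_rw [e]
  calc _ = ∑' x : Pt d, ∑' v : Pt d, ∑' y : Pt d, ∑' u : Pt d,
      hf lam z (u - y) * (ind (y ≠ 0) * (gf lam z y * gf lam z (v - y)) *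
        (rho lam z n (-v) (x - v) * w x)) := by
        rw [ENNReal.tsum_comm]
        refine tsum_congr fun x => ?_
        rw [ENNReal.tsum_comm]
        refine tsum_congr fun v => ?_
        rw [ENNReal.tsum_comm]
    _ = ∑' v : Pt d, ∑' x : Pt d, ∑' y : Pt d, (∑' u : Pt d, hf lam z u) *
      (ind (y ≠ 0) * (gf lam z y * gf lam z (v - y)) *
        (rho lam z n (-v) (x - v) * w x)) := by
        rw [ENNReal.tsum_comm]
        refine tsum_congr fun v => ?_
        refine tsum_congr fun x => ?_
        refine tsum_congr fun y => ?_
        rw [ENNReal.tsum_mul_right, tsum_sub_right']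
    _ = _ := by
        rw [← ENNReal.tsum_mul_left]
        refine tsum_congr fun v => ?_
        simp_rw [ENNReal.tsum_mul_left, ENNReal.tsum_mul_right, ENNReal.tsum_mul_left]
        congr 2
        rw [← tsum_sub_right' v (fun x => rho lam z n (-v) x * w (x + v))]
        refine tsum_congr fun x => ?_
        rw [sub_add_cancel]

include hsym in
theorem tsum_Jf_succ_le (n : ℕ) (w : Pt d → ℝ≥0∞) : ∑' x, Jf lam z (n + 1) x * w x ≤
    ∑' v : Pt d, ind (v ≠ 0) * gf lam z v * rhoSum lam z n (fun x => w (x + v)) (-v) := by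
  unfold rhoSum
  calc _ ≤ ∑' x : Pt d, ∑' v : Pt d, ind (v ≠ 0) * gf lam z v *
      (rho lam z n (-v) (x - v) * w x) := by
        refine ENNReal.tsum_le_tsum fun x => ?_
        refine (mul_le_mul' (Jf_succ_le hsym z n x) le_rfl).trans (le_of_eq ?_)
        rw [← ENNReal.tsum_mul_right]
        refine tsum_congr fun v => ?_
        ring
    _ = _ := by
        rw [ENNReal.tsum_comm]
        refine tsum_congr fun v => ?_
        rw [ENNReal.tsum_mul_left]
        congr 1
        rw [← tsum_sub_right' v (fun x => rho lam z n (-v) x * w (x + v))]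
        refine tsum_congr fun x => ?_
        rw [sub_add_cancel]

end Bounds

theorem le_two_mul_of_le_mul_add {x a b : ℝ≥0∞} (hx : x ≠ ⊤) (ha : 2 * a ≤ 1)
    (h : x ≤ a * x + b) : x ≤ 2 * b := by
  have : x + x ≤ x + 2 * b := by
    calc x + x = 2 * x := by ring
      _ ≤ 2 * (a * x + b) := by gcongr
      _ = (2 * a) * x + 2 * b := by ring
      _ ≤ 1 * x + 2 * b := by gcongr
      _ = _ := by ring
  exact (ENNReal.add_le_add_iff_left hx).1 this

theorem tsum_two_inv_pow : ∑' n : ℕ, (2⁻¹ : ℝ≥0∞) ^ n = 2 := by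
  rw [ENNReal.tsum_geometric, ENNReal.one_sub_inv_two, inv_inv]

section Norms

variable {d : ℕ} {lam : List (Pt d) → ℝ≥0} (hsym : SymmAssumption lam) (z : ℝ≥0)

/-- Weights such as `1 - cos (k · x)`. -/
structure IsWeight (c : Pt d → ℝ≥0∞) : Prop where
  zero : c 0 = 0
  neg : ∀ x, c (-x) = c x
  add_le : ∀ x y, c (x + y) ≤ 2 * c x + 2 * c y
  le_two : ∀ x, c x ≤ 2

include hsym in
theorem tsum_ind_mul_gf_mul_Ef (w : Pt d → ℝ≥0∞) {B : ℝ≥0∞}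
    (hB : ∀ s, ∑' y : Pt d, w y * (gf lam z y * gf lam z (s - y)) ≤ B) :
    ∑' t : Pt d, w t * (gf lam z t * Ef lam z t) ≤ (∑' x, nb d z x) * B := by
  calc _ = ∑' v : Pt d, nb d z v * ∑' t : Pt d, w t * (gf lam z t * gf lam z (v - t)) := by
        simp_rw [← tsum_gf_sub_mul_nb hsym, ← ENNReal.tsum_mul_left]
        rw [ENNReal.tsum_comm]
        refine tsum_congr fun v => tsum_congr fun t => ?_
        ring
    _ ≤ ∑' v : Pt d, nb d z v * B := ENNReal.tsum_le_tsum fun v => mul_le_mul' le_rfl (hB v)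
    _ = _ := ENNReal.tsum_mul_right

variable {B : ℝ≥0∞}
  (hB : ∀ s, ∑' y : Pt d, ind (y ≠ 0) * (gf lam z y * gf lam z (s - y)) ≤ B)

include hB in
theorem tsum_rhoSum_one_succ_le (n : ℕ) : ∑' u, rhoSum lam z (n + 1) 1 u ≤
    (∑' u, hf lam z u) * B * ∑' u, rhoSum lam z n 1 u := by
  rw [tsum_rhoSum_succ, mul_assoc]
  refine mul_le_mul' le_rfl ?_
  rw [← tsum_neg' (rhoSum lam z n 1), ← ENNReal.tsum_mul_left]
  exact ENNReal.tsum_le_tsum fun v => mul_le_mul' (hB v) le_rfl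

theorem rhoSum_shift_le {c : Pt d → ℝ≥0∞} (hc : IsWeight c) (n : ℕ) (v : Pt d) :
    rhoSum lam z n (fun x => c (x + v)) (-v) ≤
      2 * rhoSum lam z n c (-v) + 2 * c v * rhoSum lam z n 1 (-v) := by
  unfold rhoSum
  rw [← ENNReal.tsum_mul_left, ← ENNReal.tsum_mul_left, ← ENNReal.tsum_add]
  refine ENNReal.tsum_le_tsum fun x => ?_
  calc _ ≤ rho lam z n (-v) x * (2 * c x + 2 * c v) := mul_le_mul' le_rfl (hc.add_le _ _)
    _ = _ := by simp only [Pi.one_apply]; ring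

variable {c : Pt d → ℝ≥0∞} (hc : IsWeight c) {Bc : ℝ≥0∞}
  (hBc : ∀ s, ∑' y : Pt d, c y * (gf lam z y * gf lam z (s - y)) ≤ Bc)

include hc hBc in
theorem mul_tsum_gf_mul_gf_le (v : Pt d) :
    c v * (∑' y : Pt d, ind (y ≠ 0) * (gf lam z y * gf lam z (v - y))) ≤ 4 * Bc := by
  rw [← ENNReal.tsum_mul_left]
  calc _ ≤ ∑' y : Pt d, (2 * (c y * (gf lam z y * gf lam z (v - y))) +
        2 * (c (v - y) * (gf lam z (v - y) * gf lam z (v - (v - y))))) := by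
        refine ENNReal.tsum_le_tsum fun y => ?_
        have h1 : c v ≤ 2 * c y + 2 * c (v - y) := by
          have := hc.add_le y (v - y)
          rwa [add_sub_cancel] at this
        calc _ ≤ (2 * c y + 2 * c (v - y)) * (1 * (gf lam z y * gf lam z (v - y))) := by
              gcongr; exact ind_le_one _
          _ = _ := by rw [sub_sub_cancel]; ring
    _ = 2 * (∑' y : Pt d, c y * (gf lam z y * gf lam z (v - y))) +
        2 * (∑' y : Pt d, c y * (gf lam z y * gf lam z (v - y))) := by
        rw [ENNReal.tsum_add, ENNReal.tsum_mul_left, ENNReal.tsum_mul_left,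
          tsum_sub_left' v (fun y => c y * (gf lam z y * gf lam z (v - y)))]
    _ ≤ 2 * Bc + 2 * Bc := by gcongr <;> exact hBc v
    _ = _ := by ring

include hB hc hBc in
theorem tsum_rhoSum_weight_succ_le (n : ℕ) : ∑' u, rhoSum lam z (n + 1) c u ≤
    (∑' u, hf lam z u) * (2 * B * ∑' u, rhoSum lam z n c u +
      8 * Bc * ∑' u, rhoSum lam z n 1 u) := by
  rw [tsum_rhoSum_succ]
  refine mul_le_mul' le_rfl ?_
  rw [← tsum_neg' (rhoSum lam z n 1), ← tsum_neg' (rhoSum lam z n c),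
    ← ENNReal.tsum_mul_left, ← ENNReal.tsum_mul_left, ← ENNReal.tsum_add]
  refine ENNReal.tsum_le_tsum fun v => ?_
  set b := ∑' y : Pt d, ind (y ≠ 0) * (gf lam z y * gf lam z (v - y))
  calc _ ≤ b * (2 * rhoSum lam z n c (-v) + 2 * c v * rhoSum lam z n 1 (-v)) :=
        mul_le_mul' le_rfl (rhoSum_shift_le z hc n v)
    _ = 2 * b * rhoSum lam z n c (-v) + 2 * (c v * b) * rhoSum lam z n 1 (-v) := by ring
    _ ≤ 2 * B * rhoSum lam z n c (-v) + 2 * (4 * Bc) * rhoSum lam z n 1 (-v) := by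
        refine add_le_add (mul_le_mul' (mul_le_mul' le_rfl (hB v)) le_rfl)
          (mul_le_mul' (mul_le_mul' le_rfl ?_) le_rfl)
        exact mul_tsum_gf_mul_gf_le z hc hBc v
    _ = _ := by ring

include hsym in
theorem tsum_Jf_le {K : ℝ≥0∞} (hK : ∀ v, v ≠ 0 → gf lam z v ≤ K) (n : ℕ) :
    ∑' x, Jf lam z (n + 1) x ≤ K * ∑' u, rhoSum lam z n 1 u := by
  have := tsum_Jf_succ_le hsym z n 1
  simp only [Pi.one_apply, mul_one] at this
  refine this.trans ?_
  rw [← tsum_neg' (rhoSum lam z n 1), ← ENNReal.tsum_mul_left]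
  refine ENNReal.tsum_le_tsum fun v => mul_le_mul' ?_ le_rfl
  by_cases h : v = 0
  · rw [ind_false (by simp [h])]; simp
  · rw [ind_true h, one_mul]; exact hK v h

include hBc in
theorem weight_mul_gf_le (v : Pt d) : c v * gf lam z v ≤ Bc := by
  refine le_trans ?_ (hBc v)
  refine le_trans ?_ (ENNReal.le_tsum v)
  rw [sub_self]
  calc c v * gf lam z v = c v * (gf lam z v * 1) := by rw [mul_one]
    _ ≤ _ := by gcongr; exact one_le_gf_zero z

include hsym hc hBc in
theorem tsum_Jf_weight_le {K : ℝ≥0∞} (hK : ∀ v, v ≠ 0 → gf lam z v ≤ K) (n : ℕ) :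
    ∑' x, Jf lam z (n + 1) x * c x ≤ 2 * K * (∑' u, rhoSum lam z n c u) +
      2 * Bc * ∑' u, rhoSum lam z n 1 u := by
  refine (tsum_Jf_succ_le hsym z n c).trans ?_
  rw [← tsum_neg' (rhoSum lam z n 1), ← tsum_neg' (rhoSum lam z n c),
    ← ENNReal.tsum_mul_left, ← ENNReal.tsum_mul_left, ← ENNReal.tsum_add]
  refine ENNReal.tsum_le_tsum fun v => ?_
  have h1 : ind (v ≠ 0) * gf lam z v ≤ K := by
    by_cases h : v = 0
    · rw [ind_false (by simp [h])]; simp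
    · rw [ind_true h, one_mul]; exact hK v h
  calc _ ≤ ind (v ≠ 0) * gf lam z v *
        (2 * rhoSum lam z n c (-v) + 2 * c v * rhoSum lam z n 1 (-v)) :=
        mul_le_mul' le_rfl (rhoSum_shift_le z hc n v)
    _ = 2 * (ind (v ≠ 0) * gf lam z v) * rhoSum lam z n c (-v) +
        2 * (ind (v ≠ 0) * (c v * gf lam z v)) * rhoSum lam z n 1 (-v) := by ring
    _ ≤ 2 * K * rhoSum lam z n c (-v) + 2 * (1 * Bc) * rhoSum lam z n 1 (-v) := by
        gcongr
        · exact ind_le_one _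
        · exact weight_mul_gf_le z hBc v
    _ = _ := by rw [one_mul]

variable {M : ℝ≥0} (hM : ∀ l, IsSAPList l → lam l ≤ M)

include hsym hM in
theorem tsum_hf_mul_le (w : Pt d → ℝ≥0∞) (hw : w 0 = 0) :
    ∑' u, hf lam z u * w u ≤ M * Ef lam z 0 * (∑' u, hf lam z u * w u) +
      M * gf lam z 0 * ∑' t : Pt d, ind (t ≠ 0) * (gf lam z t * Ef lam z t) *
        ∑' u, hf lam z u * w (u + t) := by
  have h1 : ∀ t : Pt d, ∑' u, hf lam z u * w (u + t) = ∑' u, hf lam z (u - t) * w u := by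
    intro t
    rw [← tsum_sub_right' t]
    simp
  simp_rw [h1, ← ENNReal.tsum_mul_left]
  rw [ENNReal.tsum_comm, ← ENNReal.tsum_add]
  refine ENNReal.tsum_le_tsum fun u => ?_
  by_cases hu : u = 0
  · subst hu; simp [hw]
  · calc _ ≤ _ := mul_le_mul' (hf_le hsym z hM hu) (le_refl (w u))
      _ = _ := by
        rw [add_mul]
        simp_rw [← ENNReal.tsum_mul_left, ← ENNReal.tsum_mul_right]
        congr 1
        · ring
        · refine tsum_congr fun t => ?_
          ring

theorem tsum_hf_eq : ∑' u, hf lam z u = gf lam z 0 + ∑' u, hf lam z u * ind (u ≠ 0) := by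
  rw [← hf_zero z, ← tsum_ind_eq_mul (0 : Pt d) (hf lam z), ← ENNReal.tsum_add]
  refine tsum_congr fun u => ?_
  by_cases h : u = 0
  · subst h; simp [ind_true, ind_false]
  · rw [ind_true (show u ≠ 0 from h), ind_false (Ne.symm h)]; simp

end Norms

/-- Smallness assumptions on the two-point function. -/
structure Small {d : ℕ} (lam : List (Pt d) → ℝ≥0) (z : ℝ≥0) (L ε : ℝ≥0∞) : Prop where
  symm : SymmAssumption lam
  bdd : ∃ M : ℝ≥0, M ≤ L ∧ ∀ l, IsSAPList l → lam l ≤ M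
  one_le : 1 ≤ L
  small : 64 * L ^ 4 * ε ≤ 1
  nb_le : ∑' x, nb d z x ≤ 4
  gf_zero : gf lam z 0 ≤ L
  conv : ∀ s, ∑' y, Ef lam z y * gf lam z (s - y) ≤ ε
  finite : ∑' u, hf lam z u ≠ ⊤

namespace Small

variable {d : ℕ} {lam : List (Pt d) → ℝ≥0} {z : ℝ≥0} {L ε : ℝ≥0∞} (S : Small lam z L ε)

include S

theorem Ef_le (s : Pt d) : Ef lam z s ≤ ε := by
  refine le_trans ?_ (S.conv s)
  refine le_trans ?_ (ENNReal.le_tsum s)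
  rw [sub_self]
  exact le_mul_of_one_le_right' (one_le_gf_zero z)

theorem gf_le_of_ne (v : Pt d) (hv : v ≠ 0) : gf lam z v ≤ L * ε := by
  have := gf_le S.symm z v
  rw [ind_false hv, zero_mul, zero_add] at this
  exact this.trans (mul_le_mul' S.gf_zero (S.Ef_le v))

theorem tsum_gf_mul_gf_le (s : Pt d) :
    ∑' y : Pt d, ind (y ≠ 0) * (gf lam z y * gf lam z (s - y)) ≤ L * ε := by
  calc _ ≤ ∑' y : Pt d, L * (Ef lam z y * gf lam z (s - y)) := by
        refine ENNReal.tsum_le_tsum fun y => ?_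
        by_cases h : y = 0
        · rw [ind_false (by simp [h])]; simp
        · rw [ind_true h, one_mul, ← mul_assoc]
          refine mul_le_mul' ?_ le_rfl
          have := gf_le S.symm z y
          rw [ind_false h, zero_mul, zero_add] at this
          exact this.trans (mul_le_mul' S.gf_zero le_rfl)
    _ ≤ _ := by rw [ENNReal.tsum_mul_left]; exact mul_le_mul' le_rfl (S.conv s)

theorem gf_zero_le_one_add : gf lam z 0 ≤ 1 + L ^ 2 * ε := by
  obtain ⟨M, hML, hM⟩ := S.bdd
  refine (gf_zero_le S.symm z hM).trans ?_
  calc _ ≤ 1 + L * (L * ε) := by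
        gcongr
        · exact S.gf_zero
        · exact S.Ef_le 0
    _ = _ := by ring

theorem pow_le {m : ℕ} (hm : m ≤ 4) : 64 * L ^ m * ε ≤ 1 :=
  le_trans (by gcongr; exact S.one_le) S.small

theorem tsum_hf_ne_le : ∑' u, hf lam z u * ind (u ≠ 0) ≤ 8 * L ^ 4 * ε := by
  obtain ⟨M, hML, hM⟩ := S.bdd
  set X := ∑' u, hf lam z u * ind (u ≠ 0) with hX
  have hHX : ∑' u, hf lam z u = gf lam z 0 + X := tsum_hf_eq z
  have hfin : X ≠ ⊤ := ne_top_of_le_ne_top S.finite (by rw [hHX]; exact le_add_self)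
  have h1 := tsum_hf_mul_le S.symm z hM (fun u : Pt d => ind (u ≠ 0)) (ind_false (by simp))
  have h2 : X ≤ (5 * L ^ 3 * ε) * X + 4 * L ^ 4 * ε := by
    refine h1.trans ?_
    calc _ ≤ L * ε * X + L * L * ((∑' t : Pt d, ind (t ≠ 0) * (gf lam z t * Ef lam z t)) *
          ∑' u, hf lam z u) := by
          gcongr
          · exact S.Ef_le 0
          · exact S.gf_zero
          · rw [← ENNReal.tsum_mul_right]
            refine ENNReal.tsum_le_tsum fun t => mul_le_mul' le_rfl ?_
            exact ENNReal.tsum_le_tsum fun u => mul_le_of_le_one_right' (ind_le_one _)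
      _ ≤ L * ε * X + L * L * ((4 * (L * ε)) * (L + X)) := by
          rw [hHX]
          gcongr
          · exact (tsum_ind_mul_gf_mul_Ef S.symm z _ S.tsum_gf_mul_gf_le).trans
              (mul_le_mul' S.nb_le le_rfl)
          · exact S.gf_zero
      _ = L ^ 1 * ε * X + 4 * L ^ 3 * ε * X + 4 * L ^ 4 * ε := by ring
      _ ≤ L ^ 3 * ε * X + 4 * L ^ 3 * ε * X + 4 * L ^ 4 * ε := by
          gcongr
          · exact S.one_le
          · norm_num
      _ = _ := by ring
  refine (le_two_mul_of_le_mul_add hfin ?_ h2).trans (le_of_eq (by ring))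
  calc 2 * (5 * L ^ 3 * ε) = 10 * L ^ 3 * ε := by ring
    _ ≤ 64 * L ^ 3 * ε := by gcongr; norm_num
    _ ≤ 1 := S.pow_le (by norm_num)

theorem tsum_hf_le : ∑' u, hf lam z u ≤ 2 * L := by
  rw [tsum_hf_eq]
  calc _ ≤ L + 64 * L ^ 4 * ε := by
        gcongr
        · exact S.gf_zero
        · refine S.tsum_hf_ne_le.trans ?_
          gcongr; norm_num
    _ ≤ L + L := by gcongr; exact S.small.trans S.one_le
    _ = _ := by ring

theorem tsum_rhoSum_le (n : ℕ) : ∑' u, rhoSum lam z n 1 u ≤ 8 * L * 2⁻¹ ^ n := by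
  induction n with
  | zero =>
    rw [tsum_rhoSum_zero]
    simp only [Pi.one_apply, mul_one, pow_zero]
    calc _ ≤ 4 * (2 * L) := mul_le_mul' S.nb_le S.tsum_hf_le
      _ = _ := by ring
  | succ n ih =>
    refine (tsum_rhoSum_one_succ_le z S.tsum_gf_mul_gf_le n).trans ?_
    calc _ ≤ (2 * L) * (L * ε) * (8 * L * 2⁻¹ ^ n) := by
          gcongr; exact S.tsum_hf_le
      _ = 2 * L ^ 2 * ε * (8 * L * 2⁻¹ ^ n) := by ring
      _ ≤ 2⁻¹ * (8 * L * 2⁻¹ ^ n) := by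
          gcongr
          rw [ENNReal.le_inv_iff_mul_le]
          refine le_trans ?_ (S.pow_le (m := 2) (by norm_num))
          calc 2 * L ^ 2 * ε * 2 = 4 * L ^ 2 * ε := by ring
            _ ≤ _ := by gcongr; norm_num
      _ = _ := by ring

theorem tsum_tsum_Jf_le : ∑' n, ∑' x, Jf lam z (n + 1) x ≤ 16 * L ^ 2 * ε := by
  calc _ ≤ ∑' n : ℕ, (L * ε) * (8 * L * 2⁻¹ ^ n) := by
        refine ENNReal.tsum_le_tsum fun n => ?_
        exact (tsum_Jf_le S.symm z S.gf_le_of_ne n).trans (mul_le_mul' le_rfl (S.tsum_rhoSum_le n))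
    _ = _ := by
        rw [ENNReal.tsum_mul_left, ENNReal.tsum_mul_left, tsum_two_inv_pow]
        ring

variable {c : Pt d → ℝ≥0∞} (hc : IsWeight c) {Bc : ℝ≥0∞}
  (hBc : ∀ s, ∑' y : Pt d, c y * (gf lam z y * gf lam z (s - y)) ≤ Bc)

include hc hBc

theorem tsum_hf_weight_le : ∑' u, hf lam z u * c u ≤ 32 * L ^ 3 * Bc := by
  obtain ⟨M, hML, hM⟩ := S.bdd
  set X := ∑' u, hf lam z u * c u with hX
  have hfin : X ≠ ⊤ := by
    refine ne_top_of_le_ne_top (ENNReal.mul_ne_top S.finite (by norm_num : (2 : ℝ≥0∞) ≠ ⊤)) ?_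
    rw [← ENNReal.tsum_mul_right]
    exact ENNReal.tsum_le_tsum fun u => mul_le_mul' le_rfl (hc.le_two u)
  have h1 := tsum_hf_mul_le S.symm z hM c hc.zero
  have hb1 := (tsum_ind_mul_gf_mul_Ef S.symm z _ S.tsum_gf_mul_gf_le).trans
              (mul_le_mul' S.nb_le le_rfl)
  have hb2 := (tsum_ind_mul_gf_mul_Ef S.symm z _ hBc).trans (mul_le_mul' S.nb_le le_rfl)
  have h2 : X ≤ (9 * L ^ 3 * ε) * X + 16 * L ^ 3 * Bc := by
    refine h1.trans ?_
    calc _ ≤ L * ε * X + L * L * (2 * (∑' t : Pt d, ind (t ≠ 0) * (gf lam z t * Ef lam z t)) * X +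
          2 * (∑' t : Pt d, c t * (gf lam z t * Ef lam z t)) * ∑' u, hf lam z u) := by
          gcongr
          · exact S.Ef_le 0
          · exact S.gf_zero
          · have e : ∀ (a : Pt d → ℝ≥0∞) (Y : ℝ≥0∞), 2 * (∑' t, a t) * Y = ∑' t, 2 * a t * Y :=
              fun a Y => by rw [ENNReal.tsum_mul_right, ENNReal.tsum_mul_left]
            rw [e, e, ← ENNReal.tsum_add]
            refine ENNReal.tsum_le_tsum fun t => ?_
            calc _ ≤ ind (t ≠ 0) * (gf lam z t * Ef lam z t) *
                  (2 * X + 2 * c t * ∑' u, hf lam z u) := by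
                  refine mul_le_mul' le_rfl ?_
                  rw [hX, ← ENNReal.tsum_mul_left, ← ENNReal.tsum_mul_left, ← ENNReal.tsum_add]
                  refine ENNReal.tsum_le_tsum fun u => ?_
                  calc _ ≤ hf lam z u * (2 * c u + 2 * c t) := mul_le_mul' le_rfl (hc.add_le _ _)
                    _ = _ := by ring
              _ = 2 * (ind (t ≠ 0) * (gf lam z t * Ef lam z t)) * X + 2 *
                  ((ind (t ≠ 0) * c t) * (gf lam z t * Ef lam z t)) * ∑' u, hf lam z u := by ring
              _ ≤ _ := by
                  gcongr
                  exact mul_le_of_le_one_left' (ind_le_one _)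
      _ ≤ L * ε * X + L * L * (2 * (4 * (L * ε)) * X + 2 * (4 * Bc) * (2 * L)) := by
          gcongr
          exact S.tsum_hf_le
      _ = L ^ 1 * ε * X + 8 * L ^ 3 * ε * X + 16 * L ^ 3 * Bc := by ring
      _ ≤ L ^ 3 * ε * X + 8 * L ^ 3 * ε * X + 16 * L ^ 3 * Bc := by
          gcongr
          · exact S.one_le
          · norm_num
      _ = _ := by ring
  refine (le_two_mul_of_le_mul_add hfin ?_ h2).trans (le_of_eq (by ring))
  calc 2 * (9 * L ^ 3 * ε) = 18 * L ^ 3 * ε := by ring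
    _ ≤ 64 * L ^ 3 * ε := by gcongr; norm_num
    _ ≤ 1 := S.pow_le (by norm_num)

theorem tsum_rhoSum_weight_le (n : ℕ) : ∑' u, rhoSum lam z n c u ≤
    (2 * L * (∑' x, nb d z x * c x) + 512 * L ^ 2 * Bc) * 2⁻¹ ^ n := by
  induction n with
  | zero =>
    rw [tsum_rhoSum_zero, pow_zero, mul_one]
    refine le_trans (mul_le_mul' le_rfl S.tsum_hf_le) ?_
    rw [mul_comm]
    exact le_self_add
  | succ n ih =>
    refine (tsum_rhoSum_weight_succ_le z S.tsum_gf_mul_gf_le hc hBc n).trans ?_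
    set N := ∑' x, nb d z x * c x
    have h4 : (2⁻¹ : ℝ≥0∞) * 2 = 1 := ENNReal.inv_mul_cancel (by norm_num) (by norm_num)
    calc _ ≤ (2 * L) * (2 * (L * ε) * ((2 * L * N + 512 * L ^ 2 * Bc) * 2⁻¹ ^ n) +
          8 * Bc * (8 * L * 2⁻¹ ^ n)) := by
          gcongr
          · exact S.tsum_hf_le
          · exact S.tsum_rhoSum_le n
      _ = (4 * L ^ 2 * ε * (2 * L * N + 512 * L ^ 2 * Bc) + 128 * L ^ 2 * Bc) * 2⁻¹ ^ n := by ring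
      _ ≤ (2⁻¹ * 2⁻¹ * (2 * L * N + 512 * L ^ 2 * Bc) + 128 * L ^ 2 * Bc) * 2⁻¹ ^ n := by
          refine mul_le_mul' (add_le_add (mul_le_mul' ?_ le_rfl) le_rfl) le_rfl
          rw [← ENNReal.mul_inv (by norm_num) (by norm_num), ENNReal.le_inv_iff_mul_le]
          refine le_trans ?_ (S.pow_le (m := 2) (by norm_num))
          calc 4 * L ^ 2 * ε * (2 * 2) = 16 * L ^ 2 * ε := by ring
            _ ≤ _ := by gcongr; norm_num
      _ = ((2⁻¹ * 2) * 2⁻¹ * L * N + (2⁻¹ * 2) * ((2⁻¹ * 2) * 128 * L ^ 2 * Bc) +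
            128 * L ^ 2 * Bc) * 2⁻¹ ^ n := by ring
      _ = (2⁻¹ * L * N + 256 * L ^ 2 * Bc) * 2⁻¹ ^ n := by rw [h4]; ring
      _ ≤ (1 * L * N + 256 * L ^ 2 * Bc) * 2⁻¹ ^ n := by
          gcongr
          exact ENNReal.inv_le_one.2 (by norm_num)
      _ = ((2⁻¹ * 2) * L * N + (2⁻¹ * 2) * 256 * L ^ 2 * Bc) * 2⁻¹ ^ n := by rw [h4]; ring
      _ = _ := by ring

theorem tsum_tsum_Jf_weight_le : ∑' n, ∑' x, Jf lam z (n + 1) x * c x ≤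
    3000 * L ^ 3 * ε * ((∑' x, nb d z x * c x) + Bc) := by
  set N := ∑' x, nb d z x * c x with hN
  rw [tsum_eq_zero_add' ENNReal.summable]
  have h0 : ∑' x, Jf lam z (0 + 1) x * c x ≤ 32 * L ^ 3 * ε * Bc := by
    calc _ ≤ ∑' x, ε * (hf lam z x * c x) := by
          refine ENNReal.tsum_le_tsum fun x => ?_
          rw [← mul_assoc]
          exact mul_le_mul' ((Jf_one_le S.symm z x).trans (mul_le_mul' (S.Ef_le x) le_rfl)) le_rfl
      _ ≤ ε * (32 * L ^ 3 * Bc) := by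
          rw [ENNReal.tsum_mul_left]
          exact mul_le_mul' le_rfl (S.tsum_hf_weight_le hc hBc)
      _ = _ := by ring
  have h1 : ∀ n, ∑' x, Jf lam z (n + 1 + 1) x * c x ≤
      (2 * (L * ε) * (2 * L * N + 512 * L ^ 2 * Bc) + 2 * Bc * ((2 * L) * (L * ε) * (8 * L))) *
        2⁻¹ ^ n := by
    intro n
    refine (tsum_Jf_weight_le S.symm z hc hBc S.gf_le_of_ne (n + 1)).trans ?_
    rw [add_mul]
    refine add_le_add ?_ ?_
    · rw [mul_assoc (2 * (L * ε))]
      refine mul_le_mul' le_rfl ((S.tsum_rhoSum_weight_le hc hBc (n + 1)).trans ?_)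
      refine mul_le_mul' le_rfl ?_
      rw [pow_succ]
      exact mul_le_of_le_one_right' (ENNReal.inv_le_one.2 (by norm_num))
    · rw [mul_assoc (2 * Bc)]
      refine mul_le_mul' le_rfl ((tsum_rhoSum_one_succ_le z S.tsum_gf_mul_gf_le n).trans ?_)
      calc _ ≤ (2 * L) * (L * ε) * (8 * L * 2⁻¹ ^ n) := by
            gcongr
            · exact S.tsum_hf_le
            · exact S.tsum_rhoSum_le n
        _ = _ := by ring
  calc _ ≤ 32 * L ^ 3 * ε * Bc + ∑' n : ℕ, (2 * (L * ε) * (2 * L * N + 512 * L ^ 2 * Bc) +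
        2 * Bc * ((2 * L) * (L * ε) * (8 * L))) * 2⁻¹ ^ n := by
        gcongr with n
        exact h1 n
    _ = 8 * L ^ 2 * ε * N + 2144 * L ^ 3 * ε * Bc := by
        rw [ENNReal.tsum_mul_left, tsum_two_inv_pow]
        ring
    _ ≤ 3000 * L ^ 3 * ε * N + 3000 * L ^ 3 * ε * Bc := by
        gcongr
        · norm_num
        · exact S.one_le
        · norm_num
        · norm_num
    _ = _ := by ring

end Small

section Fourier

variable {d : ℕ}

/-- The pairing of a momentum with a lattice point. -/
def dot (k : Fin d → ℝ) (x : Pt d) : ℝ := ∑ i, k i * (x i : ℝ)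

theorem dot_add_left (k l : Fin d → ℝ) (x : Pt d) : dot (k + l) x = dot k x + dot l x := by
  simp [dot, add_mul, Finset.sum_add_distrib]

theorem dot_sub_left (k l : Fin d → ℝ) (x : Pt d) : dot (k - l) x = dot k x - dot l x := by
  simp [dot, sub_mul, Finset.sum_sub_distrib]

theorem dot_add_right (k : Fin d → ℝ) (x y : Pt d) : dot k (x + y) = dot k x + dot k y := by
  simp [dot, mul_add, Finset.sum_add_distrib]

theorem dot_sub_right (k : Fin d → ℝ) (x y : Pt d) : dot k (x - y) = dot k x - dot k y := by
  simp [dot, mul_sub, Finset.sum_sub_distrib]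

theorem dot_neg_right (k : Fin d → ℝ) (x : Pt d) : dot k (-x) = -dot k x := by
  simp [dot]

theorem dot_zero_left (x : Pt d) : dot 0 x = 0 := by simp [dot]

theorem dot_zero_right (k : Fin d → ℝ) : dot k (0 : Pt d) = 0 := by simp [dot]

/-- The cosine transform. -/
def ft (f : Pt d → ℝ≥0∞) (k : Fin d → ℝ) : ℝ := ∑' x : Pt d, Real.cos (dot k x) * (f x).toReal

/-- Convolution. -/
def conv (f g : Pt d → ℝ≥0∞) (s : Pt d) : ℝ≥0∞ := ∑' y : Pt d, f y * g (s - y)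

/-- Even functions of finite mass. -/
structure Nice (f : Pt d → ℝ≥0∞) : Prop where
  fin : ∑' x, f x ≠ ⊤
  neg : ∀ x, f (-x) = f x

theorem tsum_conv (f g : Pt d → ℝ≥0∞) : ∑' s, conv f g s = (∑' x, f x) * ∑' x, g x := by
  unfold conv
  rw [ENNReal.tsum_comm, ← ENNReal.tsum_mul_right]
  refine tsum_congr fun y => ?_
  rw [ENNReal.tsum_mul_left, tsum_sub_right']

theorem conv_comm (f g : Pt d → ℝ≥0∞) : conv f g = conv g f := by
  ext s
  unfold conv
  rw [← tsum_sub_left' s]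
  refine tsum_congr fun y => ?_
  rw [sub_sub_cancel, mul_comm]

theorem conv_mono {f f' g g' : Pt d → ℝ≥0∞} (hf : ∀ x, f x ≤ f' x) (hg : ∀ x, g x ≤ g' x)
    (s : Pt d) : conv f g s ≤ conv f' g' s :=
  ENNReal.tsum_le_tsum fun y => mul_le_mul' (hf y) (hg _)

theorem summable_mul_of_abs_le_one {ι : Type*} {φ f : ι → ℝ} (hf : Summable f) (h0 : ∀ x, 0 ≤ f x)
    (hφ : ∀ x, |φ x| ≤ 1) : Summable fun x => φ x * f x := by
  refine Summable.of_norm_bounded hf fun x => ?_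
  rw [Real.norm_eq_abs, abs_mul, abs_of_nonneg (h0 x)]
  exact mul_le_of_le_one_left (h0 x) (hφ x)

/-- The change of variables `(s, y) ↦ (y, s - y)`. -/
def convEquiv (d : ℕ) : Pt d × Pt d ≃ Pt d × Pt d where
  toFun p := (p.2, p.1 - p.2)
  invFun p := (p.1 + p.2, p.1)
  left_inv p := by ext <;> simp
  right_inv p := by ext <;> simp

namespace Nice

variable {f g : Pt d → ℝ≥0∞} (hf : Nice f) (hg : Nice g)

include hf

theorem ne_top (x : Pt d) : f x ≠ ⊤ := ne_top_of_le_ne_top hf.fin (ENNReal.le_tsum x)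

theorem summable : Summable fun x => (f x).toReal := ENNReal.summable_toReal hf.fin

theorem summable_cos (k : Fin d → ℝ) : Summable fun x => Real.cos (dot k x) * (f x).toReal :=
  summable_mul_of_abs_le_one hf.summable (fun _ => ENNReal.toReal_nonneg)
    fun _ => Real.abs_cos_le_one _

theorem summable_sin (k : Fin d → ℝ) : Summable fun x => Real.sin (dot k x) * (f x).toReal :=
  summable_mul_of_abs_le_one hf.summable (fun _ => ENNReal.toReal_nonneg)
    fun _ => Real.abs_sin_le_one _

theorem tsum_sin (k : Fin d → ℝ) : ∑' x, Real.sin (dot k x) * (f x).toReal = 0 := by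
  have h : ∑' x, Real.sin (dot k x) * (f x).toReal = -∑' x, Real.sin (dot k x) * (f x).toReal := by
    conv_lhs => rw [← (Equiv.neg (Pt d)).tsum_eq]
    rw [← tsum_neg]
    refine tsum_congr fun x => ?_
    simp only [Equiv.neg_apply]
    rw [dot_neg_right, Real.sin_neg, hf.neg]
    ring
  linarith

theorem ft_zero : ft f 0 = (∑' x, f x).toReal := by
  unfold ft
  simp only [dot_zero_left, Real.cos_zero, one_mul]
  rw [ENNReal.tsum_toReal_eq hf.ne_top]

theorem abs_ft_le (k : Fin d → ℝ) : |ft f k| ≤ (∑' x, f x).toReal := by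
  rw [ENNReal.tsum_toReal_eq hf.ne_top]
  unfold ft
  rw [← Real.norm_eq_abs]
  refine tsum_of_norm_bounded hf.summable.hasSum fun x => ?_
  rw [Real.norm_eq_abs, abs_mul, abs_of_nonneg (ENNReal.toReal_nonneg)]
  exact mul_le_of_le_one_left ENNReal.toReal_nonneg (Real.abs_cos_le_one _)

include hg

theorem add : Nice fun x => f x + g x where
  fin := by rw [ENNReal.tsum_add]; exact ENNReal.add_ne_top.2 ⟨hf.fin, hg.fin⟩
  neg x := by rw [hf.neg, hg.neg]

theorem ft_add (k : Fin d → ℝ) : ft (fun x => f x + g x) k = ft f k + ft g k := by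
  unfold ft
  rw [← (hf.summable_cos k).tsum_add (hg.summable_cos k)]
  refine tsum_congr fun x => ?_
  rw [ENNReal.toReal_add (hf.ne_top x) (hg.ne_top x)]
  ring

theorem conv : Nice (conv f g) where
  fin := by rw [tsum_conv]; exact ENNReal.mul_ne_top hf.fin hg.fin
  neg s := by
    unfold LWW.conv
    rw [← tsum_neg']
    refine tsum_congr fun y => ?_
    rw [hf.neg, ← hg.neg]
    congr 2
    abel

theorem ft_conv (k : Fin d → ℝ) : ft (LWW.conv f g) k = ft f k * ft g k := by
  have hs : Summable fun p : Pt d × Pt d => (f p.1).toReal * (g p.2).toReal :=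
    Summable.mul_of_nonneg (f := fun x => (f x).toReal) (g := fun x => (g x).toReal)
      hf.summable hg.summable (fun _ => ENNReal.toReal_nonneg) fun _ => ENNReal.toReal_nonneg
  have hΦ : Summable fun p : Pt d × Pt d =>
      Real.cos (dot k (p.1 + p.2)) * ((f p.1).toReal * (g p.2).toReal) :=
    summable_mul_of_abs_le_one hs
      (fun _ => mul_nonneg ENNReal.toReal_nonneg ENNReal.toReal_nonneg)
      fun _ => Real.abs_cos_le_one _
  have h1 : ft (LWW.conv f g) k = ∑' p : Pt d × Pt d,
      Real.cos (dot k (p.1 + p.2)) * ((f p.1).toReal * (g p.2).toReal) := by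
    have h3 : Summable fun p : Pt d × Pt d =>
        Real.cos (dot k p.1) * ((f p.2).toReal * (g (p.1 - p.2)).toReal) := by
      refine (((convEquiv d).summable_iff).2 hΦ).congr fun p => ?_
      simp [convEquiv]
    have h4 : ∑' p : Pt d × Pt d, Real.cos (dot k p.1) * ((f p.2).toReal * (g (p.1 - p.2)).toReal) =
        ∑' p : Pt d × Pt d, Real.cos (dot k (p.1 + p.2)) * ((f p.1).toReal * (g p.2).toReal) := by
      rw [← (convEquiv d).tsum_eq fun p : Pt d × Pt d =>
        Real.cos (dot k (p.1 + p.2)) * ((f p.1).toReal * (g p.2).toReal)]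
      refine tsum_congr fun p => ?_
      simp [convEquiv]
    rw [← h4, h3.tsum_prod]
    refine tsum_congr fun s => ?_
    unfold LWW.conv
    rw [ENNReal.tsum_toReal_eq fun y => ENNReal.mul_ne_top (hf.ne_top _) (hg.ne_top _),
      ← tsum_mul_left]
    refine tsum_congr fun y => ?_
    rw [ENNReal.toReal_mul]
  have hc : Summable fun p : Pt d × Pt d => (Real.cos (dot k p.1) * (f p.1).toReal) *
      (Real.cos (dot k p.2) * (g p.2).toReal) :=
    summable_mul_of_summable_norm (f := fun x => Real.cos (dot k x) * (f x).toReal)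
      (g := fun x => Real.cos (dot k x) * (g x).toReal)
      (hf.summable_cos k).norm (hg.summable_cos k).norm
  have hsn : Summable fun p : Pt d × Pt d => (Real.sin (dot k p.1) * (f p.1).toReal) *
      (Real.sin (dot k p.2) * (g p.2).toReal) :=
    summable_mul_of_summable_norm (f := fun x => Real.sin (dot k x) * (f x).toReal)
      (g := fun x => Real.sin (dot k x) * (g x).toReal)
      (hf.summable_sin k).norm (hg.summable_sin k).norm
  have h2 : ∀ p : Pt d × Pt d, Real.cos (dot k (p.1 + p.2)) * ((f p.1).toReal * (g p.2).toReal) =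
      (Real.cos (dot k p.1) * (f p.1).toReal) * (Real.cos (dot k p.2) * (g p.2).toReal) -
      (Real.sin (dot k p.1) * (f p.1).toReal) * (Real.sin (dot k p.2) * (g p.2).toReal) := by
    intro p
    rw [dot_add_right, Real.cos_add]
    ring
  rw [h1]
  simp_rw [h2]
  rw [hc.tsum_sub hsn, ← (hf.summable_cos k).tsum_mul_tsum (hg.summable_cos k) hc,
    ← (hf.summable_sin k).tsum_mul_tsum (hg.summable_sin k) hsn, hf.tsum_sin]
  unfold ft
  ring

end Nice

open MeasureTheory

/-- The uniform probability measure on a period. -/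
def unif : Measure ℝ :=
  (ENNReal.ofReal (2 * Real.pi))⁻¹ • volume.restrict (Set.Ioc (-Real.pi) Real.pi)

instance : IsProbabilityMeasure unif := ⟨by
  have h : (0 : ℝ) < 2 * Real.pi := by positivity
  rw [unif, Measure.smul_apply, Measure.restrict_apply_univ, Real.volume_Ioc, smul_eq_mul,
    show Real.pi - -Real.pi = 2 * Real.pi by ring]
  exact ENNReal.inv_mul_cancel (by simpa using h) ENNReal.ofReal_ne_top⟩

/-- The uniform probability measure on the torus. -/
def nu (d : ℕ) : Measure (Fin d → ℝ) := Measure.pi fun _ => unif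

instance : IsProbabilityMeasure (nu d) := by unfold nu; infer_instance

theorem integral_unif {E : Type*} [NormedAddCommGroup E] [NormedSpace ℝ E] (f : ℝ → E) :
    ∫ x, f x ∂unif = (2 * Real.pi)⁻¹ • ∫ x in (-Real.pi)..Real.pi, f x := by
  have h : (0 : ℝ) < 2 * Real.pi := by positivity
  rw [unif, integral_smul_measure, intervalIntegral.integral_of_le (by linarith),
    ENNReal.toReal_inv, ENNReal.toReal_ofReal h.le]

theorem integral_unif_exp (n : ℤ) :
    ∫ x : ℝ, Complex.exp ((x * n : ℝ) * Complex.I) ∂unif = if n = 0 then 1 else 0 := by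
  split_ifs with h
  · subst h; simp
  · rw [integral_unif]
    have hc : (n : ℂ) * Complex.I ≠ 0 := mul_ne_zero (by exact_mod_cast h) Complex.I_ne_zero
    have e : ∀ x : ℝ, Complex.exp ((x * n : ℝ) * Complex.I) =
        Complex.exp ((n : ℂ) * Complex.I * x) := by
      intro x; congr 1; push_cast; ring
    simp_rw [e]
    rw [integral_exp_mul_complex hc]
    have : Complex.exp ((n : ℂ) * Complex.I * (Real.pi : ℝ)) =
        Complex.exp ((n : ℂ) * Complex.I * (-Real.pi : ℝ)) := by
      rw [Complex.exp_eq_exp_iff_exists_int]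
      exact ⟨n, by push_cast; ring⟩
    rw [this]
    simp

theorem integral_cos_dot (y : Pt d) :
    ∫ l, Real.cos (dot l y) ∂nu d = if y = 0 then 1 else 0 := by
  have h1 : ∫ l : Fin d → ℝ, Complex.exp ((dot l y : ℝ) * Complex.I) ∂nu d =
      ∏ i, (if y i = 0 then 1 else 0) := by
    simp_rw [← integral_unif_exp]
    rw [nu, ← integral_fintype_prod_eq_prod]
    congr 1
    ext l
    rw [← Complex.exp_sum, ← Finset.sum_mul, dot]
    push_cast
    rfl
  have h_int : Integrable (fun l : Fin d → ℝ => Complex.exp ((dot l y : ℝ) * Complex.I))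
      (nu d) := by
    refine Integrable.of_bound (C := 1) ?_ (Filter.Eventually.of_forall fun l => ?_)
    · refine Continuous.aestronglyMeasurable ?_
      unfold dot; fun_prop
    · rw [Complex.norm_exp_ofReal_mul_I]
  have h2 : ∫ l, Real.cos (dot l y) ∂nu d =
      (∫ l : Fin d → ℝ, Complex.exp ((dot l y : ℝ) * Complex.I) ∂nu d).re := by
    have := integral_re h_int
    simp only [RCLike.re_to_complex] at this
    rw [← this]
    simp_rw [Complex.exp_ofReal_mul_I_re]
  rw [h2, h1]
  split_ifs with h
  · subst h; simp
  · obtain ⟨i, hi⟩ := Function.ne_iff.1 h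
    rw [Finset.prod_eq_zero (Finset.mem_univ i)]
    · simp
    · exact if_neg hi

theorem continuous_dot (y : Pt d) : Continuous fun l : Fin d → ℝ => dot l y := by
  unfold dot; fun_prop

theorem Nice.continuous_ft {f : Pt d → ℝ≥0∞} (hf : Nice f) : Continuous (ft f) := by
  refine continuous_tsum (u := fun x => (f x).toReal) (fun x => ?_) hf.summable fun x l => ?_
  · have := continuous_dot x
    fun_prop
  · rw [Real.norm_eq_abs, abs_mul, abs_of_nonneg ENNReal.toReal_nonneg]
    exact mul_le_of_le_one_left ENNReal.toReal_nonneg (Real.abs_cos_le_one _)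

theorem Nice.integral_ft_mul_cos {f : Pt d → ℝ≥0∞} (hf : Nice f) (x : Pt d) :
    ∫ l, ft f l * Real.cos (dot l x) ∂nu d = (f x).toReal := by
  have hcont : ∀ y : Pt d, Continuous fun l : Fin d → ℝ =>
      Real.cos (dot l y) * (f y).toReal * Real.cos (dot l x) := by
    intro y
    have := continuous_dot x
    have := continuous_dot y
    fun_prop
  have hbd : ∀ (y : Pt d) (l : Fin d → ℝ),
      ‖Real.cos (dot l y) * (f y).toReal * Real.cos (dot l x)‖ ≤ (f y).toReal := by
    intro y l
    rw [Real.norm_eq_abs, abs_mul, abs_mul, abs_of_nonneg (ENNReal.toReal_nonneg (a := f y))]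
    calc _ ≤ 1 * (f y).toReal * 1 := by
          gcongr
          · exact Real.abs_cos_le_one _
          · exact Real.abs_cos_le_one _
      _ = _ := by ring
  have h_int : ∀ y : Pt d, Integrable (fun l : Fin d → ℝ =>
      Real.cos (dot l y) * (f y).toReal * Real.cos (dot l x)) (nu d) := fun y =>
    Integrable.of_bound (hcont y).aestronglyMeasurable _ (Filter.Eventually.of_forall (hbd y))
  have hsum : Summable fun y : Pt d => ∫ l : Fin d → ℝ,
      ‖Real.cos (dot l y) * (f y).toReal * Real.cos (dot l x)‖ ∂nu d := by
    refine Summable.of_nonneg_of_le (fun y => integral_nonneg fun _ => norm_nonneg _)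
      (fun y => ?_) hf.summable
    calc _ ≤ ∫ _ : Fin d → ℝ, (f y).toReal ∂nu d :=
          integral_mono (h_int y).norm (integrable_const _) (hbd y)
      _ = _ := by simp
  have hcc : ∀ y : Pt d, ∫ l : Fin d → ℝ, Real.cos (dot l y) * Real.cos (dot l x) ∂nu d =
      ((if y = x then 1 else 0) + (if y = -x then 1 else 0)) / 2 := by
    intro y
    have e : ∀ l : Fin d → ℝ, Real.cos (dot l y) * Real.cos (dot l x) =
        (Real.cos (dot l (y - x)) + Real.cos (dot l (y + x))) / 2 := by
      intro l
      rw [dot_sub_right, dot_add_right, Real.cos_add, Real.cos_sub]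
      ring
    have hi : ∀ w : Pt d, Integrable (fun l : Fin d → ℝ => Real.cos (dot l w)) (nu d) := fun w =>
      Integrable.of_bound (C := 1) (by
        have := continuous_dot w
        exact Continuous.aestronglyMeasurable (by fun_prop))
        (Filter.Eventually.of_forall fun l => Real.abs_cos_le_one _)
    simp_rw [e]
    rw [integral_div, integral_add (hi _) (hi _), integral_cos_dot, integral_cos_dot]
    simp only [sub_eq_zero, add_eq_zero_iff_eq_neg]
  calc ∫ l, ft f l * Real.cos (dot l x) ∂nu d
      = ∫ l, ∑' y : Pt d, Real.cos (dot l y) * (f y).toReal * Real.cos (dot l x) ∂nu d := by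
        unfold ft
        simp_rw [tsum_mul_right]
    _ = ∑' y : Pt d, ∫ l, Real.cos (dot l y) * (f y).toReal * Real.cos (dot l x) ∂nu d :=
        (integral_tsum_of_summable_integral_norm h_int hsum).symm
    _ = ∑' y : Pt d, ((if y = x then (f x).toReal / 2 else 0) +
          (if y = -x then (f x).toReal / 2 else 0)) := by
        refine tsum_congr fun y => ?_
        have e : ∀ l : Fin d → ℝ, Real.cos (dot l y) * (f y).toReal * Real.cos (dot l x) =
            (f y).toReal * (Real.cos (dot l y) * Real.cos (dot l x)) := fun l => by ring
        simp_rw [e]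
        rw [integral_const_mul, hcc]
        have h1 : y = -x → (f y).toReal = (f x).toReal := by rintro rfl; rw [hf.neg]
        have h2 : y = x → (f y).toReal = (f x).toReal := by rintro rfl; rfl
        split_ifs with h3 h4 h4
        · rw [h2 h3]; ring
        · rw [h2 h3]; ring
        · rw [h1 h4]; ring
        · ring
    _ = _ := by
        rw [Summable.tsum_add (summable_of_ne_finset_zero (s := {x}) (by simp_all))
          (summable_of_ne_finset_zero (s := {-x}) (by simp_all)), tsum_ite_eq, tsum_ite_eq]
        ring

/-- A function is dominated by the mass of its transform. -/
theorem Nice.le_lintegral {f : Pt d → ℝ≥0∞} (hf : Nice f) (x : Pt d) :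
    f x ≤ ∫⁻ l, ENNReal.ofReal |ft f l| ∂nu d := by
  have h_int : Integrable (ft f) (nu d) :=
    Integrable.of_bound hf.continuous_ft.aestronglyMeasurable _
      (Filter.Eventually.of_forall hf.abs_ft_le)
  rw [← ofReal_integral_eq_lintegral_ofReal h_int.abs (Filter.Eventually.of_forall fun _ =>
    abs_nonneg _), ← ENNReal.ofReal_toReal (hf.ne_top x), ← hf.integral_ft_mul_cos x]
  refine ENNReal.ofReal_le_ofReal ?_
  refine (le_abs_self _).trans ((abs_integral_le_integral_abs).trans ?_)
  refine integral_mono_of_nonneg (Filter.Eventually.of_forall fun _ => abs_nonneg _) h_int.abs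
    (Filter.Eventually.of_forall fun l => ?_)
  simp only [abs_mul]
  exact mul_le_of_le_one_right (abs_nonneg _) (Real.abs_cos_le_one _)
end Fourier

section TorusIntegrals

open MeasureTheory

theorem intervalIntegrable_abs_rpow :
    IntervalIntegrable (fun x : ℝ => |x| ^ (-(1 / 2) : ℝ)) volume (-Real.pi) Real.pi := by
  have h1 : IntervalIntegrable (fun x : ℝ => |x| ^ (-(1 / 2) : ℝ)) volume 0 Real.pi := by
    refine IntervalIntegrable.congr (f := fun x : ℝ => x ^ (-(1 / 2) : ℝ)) ?_
      (intervalIntegral.intervalIntegrable_rpow' (by norm_num))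
    intro x hx
    rw [Set.uIoc_of_le Real.pi_pos.le] at hx
    simp only [abs_of_pos hx.1]
  refine IntervalIntegrable.trans (b := 0) ?_ h1
  have := (IntervalIntegrable.iff_comp_neg).1 h1
  simp only [neg_zero, abs_neg] at this
  exact this.symm

/-- The one-dimensional factor in the bound on the Green function. -/
def greenFactor (x : ℝ) : ℝ := (1 - Real.cos x) ^ (-(1 / 4) : ℝ)

theorem greenFactor_nonneg (x : ℝ) : 0 ≤ greenFactor x :=
  Real.rpow_nonneg (by linarith [Real.cos_le_one x]) _

theorem measurable_greenFactor : Measurable greenFactor := by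
  unfold greenFactor
  exact ((measurable_const.sub Real.measurable_cos).pow_const _)

theorem greenFactor_periodic : Function.Periodic greenFactor (2 * Real.pi) := by
  intro x
  unfold greenFactor
  rw [Real.cos_add_two_pi]

theorem greenFactor_le {x : ℝ} (hx : |x| ≤ Real.pi) :
    greenFactor x ≤ (2 / Real.pi ^ 2) ^ (-(1 / 4) : ℝ) * |x| ^ (-(1 / 2) : ℝ) := by
  unfold greenFactor
  rcases eq_or_ne x 0 with rfl | h0
  · simp [Real.zero_rpow]
  · have hx0 : 0 < |x| := abs_pos.2 h0
    have h : 2 / Real.pi ^ 2 * |x| ^ 2 ≤ 1 - Real.cos x := by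
      rw [sq_abs]
      linarith [Real.cos_le_one_sub_mul_cos_sq hx]
    have e : (2 / Real.pi ^ 2) ^ (-(1 / 4) : ℝ) * |x| ^ (-(1 / 2) : ℝ) =
        (2 / Real.pi ^ 2 * |x| ^ 2) ^ (-(1 / 4) : ℝ) := by
      rw [Real.mul_rpow (by positivity) (by positivity), ← Real.rpow_natCast |x|, ← Real.rpow_mul
        (abs_nonneg x)]
      norm_num
    rw [e]
    exact Real.rpow_le_rpow_of_nonpos (by positivity) h (by norm_num)

theorem intervalIntegrable_greenFactor (a b : ℝ) : IntervalIntegrable greenFactor volume a b := by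
  refine greenFactor_periodic.intervalIntegrable (t := -Real.pi) (by positivity) ?_ a b
  rw [show -Real.pi + 2 * Real.pi = Real.pi by ring]
  refine (intervalIntegrable_abs_rpow.const_mul ((2 / Real.pi ^ 2) ^ (-(1 / 4) : ℝ))).mono_fun'
    measurable_greenFactor.aestronglyMeasurable ?_
  refine (ae_restrict_iff' measurableSet_uIoc).2 (Filter.Eventually.of_forall fun x hx => ?_)
  rw [Set.uIoc_of_le (by linarith [Real.pi_pos])] at hx
  simp only [Real.norm_eq_abs, abs_of_nonneg (greenFactor_nonneg x)]
  exact greenFactor_le (abs_le.2 ⟨hx.1.le, hx.2⟩)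

theorem integrable_unif_of_intervalIntegrable {f : ℝ → ℝ}
    (hf : IntervalIntegrable f volume (-Real.pi) Real.pi) : Integrable f unif := by
  unfold unif
  refine Integrable.smul_measure ?_ ?_
  · rwa [intervalIntegrable_iff_integrableOn_Ioc_of_le (by linarith [Real.pi_pos])] at hf
  · simp [Real.pi_pos]

theorem integral_unif_add {f : ℝ → ℝ} (hf : Function.Periodic f (2 * Real.pi)) (a : ℝ) :
    ∫ x, f (x + a) ∂unif = ∫ x, f x ∂unif := by
  rw [integral_unif, integral_unif, intervalIntegral.integral_comp_add_right]
  congr 1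
  have := hf.intervalIntegral_add_eq (-Real.pi + a) (-Real.pi)
  rw [show -Real.pi + a + 2 * Real.pi = Real.pi + a by ring,
    show -Real.pi + 2 * Real.pi = Real.pi by ring] at this
  exact this

theorem integrable_greenFactor (a : ℝ) : Integrable (fun x => greenFactor (x + a)) unif := by
  refine integrable_unif_of_intervalIntegrable ?_
  simpa using (intervalIntegrable_greenFactor (-Real.pi + a) (Real.pi + a)).comp_add_right a

theorem unif_absolutelyContinuous : unif ≪ volume :=
  (Measure.smul_absolutelyContinuous).trans Measure.restrict_le_self.absolutelyContinuous

theorem ae_cos_add_ne_one (a : ℝ) : ∀ᵐ x ∂unif, Real.cos (x + a) ≠ 1 := by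
  refine unif_absolutelyContinuous.ae_le ?_
  have hc : ({x : ℝ | Real.cos (x + a) = 1}).Countable := by
    refine (Set.countable_range fun n : ℤ => (n : ℝ) * (2 * Real.pi) - a).mono fun x hx => ?_
    obtain ⟨n, hn⟩ := (Real.cos_eq_one_iff _).1 hx
    exact ⟨n, by simp only [hn]; ring⟩
  exact (measure_mono_null (by intro x; simp) (hc.measure_zero volume))

variable {d : ℕ}

theorem ae_nu_cos_add_ne_one (k : Fin d → ℝ) : ∀ᵐ l ∂nu d, ∀ j, Real.cos (l j + k j) ≠ 1 :=
  ae_all_iff.2 fun j => (Measure.quasiMeasurePreserving_eval (fun _ : Fin d => unif) j).ae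
    (ae_cos_add_ne_one (k j))

theorem DhatD_le_one (l : Fin d → ℝ) : DhatD d l ≤ 1 := by
  unfold DhatD
  have h : ∑ j, Real.cos (l j) ≤ ∑ _j : Fin d, (1 : ℝ) :=
    Finset.sum_le_sum fun j _ => Real.cos_le_one _
  simp only [Finset.sum_const, Finset.card_univ, Fintype.card_fin, nsmul_eq_mul, mul_one] at h
  rcases Nat.eq_zero_or_pos d with rfl | hd
  · simp
  · have hd' : (0 : ℝ) < d := by exact_mod_cast hd
    rw [one_div, inv_mul_le_iff₀ hd']
    linarith

theorem neg_one_le_DhatD (l : Fin d → ℝ) : -1 ≤ DhatD d l := by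
  unfold DhatD
  have h : ∑ _j : Fin d, (-1 : ℝ) ≤ ∑ j, Real.cos (l j) :=
    Finset.sum_le_sum fun j _ => Real.neg_one_le_cos _
  simp only [Finset.sum_const, Finset.card_univ, Fintype.card_fin, nsmul_eq_mul] at h
  rcases Nat.eq_zero_or_pos d with rfl | hd
  · simp
  · have hd' : (0 : ℝ) < d := by exact_mod_cast hd
    rw [one_div, ← div_eq_inv_mul, le_div_iff₀ hd']
    linarith

theorem continuous_DhatD : Continuous (DhatD d) := by
  unfold DhatD
  fun_prop

theorem one_sub_DhatD_eq (hd : 0 < d) (l : Fin d → ℝ) :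
    1 - DhatD d l = ∑ j, (1 / (d : ℝ)) * (1 - Real.cos (l j)) := by
  have hd' : (d : ℝ) ≠ 0 := by exact_mod_cast hd.ne'
  unfold DhatD
  rw [← Finset.mul_sum, Finset.sum_sub_distrib]
  simp only [Finset.sum_const, Finset.card_univ, Fintype.card_fin, nsmul_eq_mul, mul_one]
  field_simp

/-- The critical random walk two-point function in momentum space. -/
def Hh (d : ℕ) (l : Fin d → ℝ) : ℝ≥0∞ := (ENNReal.ofReal (1 - DhatD d l))⁻¹

theorem measurable_Hh : Measurable (Hh d) :=
  ((measurable_const.sub continuous_DhatD.measurable).ennreal_ofReal).inv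

theorem half_le_Hh (l : Fin d → ℝ) : 1 ≤ 2 * Hh d l := by
  unfold Hh
  rw [← div_eq_mul_inv, ENNReal.le_div_iff_mul_le (Or.inr (by simp)) (Or.inl (by simp)), one_mul]
  calc _ ≤ ENNReal.ofReal 2 := ENNReal.ofReal_le_ofReal (by linarith [neg_one_le_DhatD l])
    _ = _ := by simp

theorem Hh_pow_four_le (hd : 16 ≤ d) {l : Fin d → ℝ} (hl : ∀ j, Real.cos (l j) ≠ 1) :
    Hh d l ^ 4 ≤ ENNReal.ofReal (∏ j, (1 + 16 / (d : ℝ) * greenFactor (l j))) := by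
  have hd0 : (0 : ℝ) < d := by exact_mod_cast (by omega : 0 < d)
  have hpos : ∀ j, 0 < 1 - Real.cos (l j) := fun j =>
    sub_pos.2 (lt_of_le_of_ne (Real.cos_le_one _) (hl j))
  have hgm : ∏ j, (1 - Real.cos (l j)) ^ (1 / (d : ℝ)) ≤ 1 - DhatD d l := by
    rw [one_sub_DhatD_eq (by omega)]
    refine Real.geom_mean_le_arith_mean_weighted Finset.univ (fun _ => 1 / (d : ℝ))
      (fun j => 1 - Real.cos (l j)) (fun _ _ => by positivity) ?_ fun j _ => (hpos j).le
    simp [hd0.ne']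
  have hgpos : 0 < ∏ j, (1 - Real.cos (l j)) ^ (1 / (d : ℝ)) :=
    Finset.prod_pos fun j _ => Real.rpow_pos_of_pos (hpos j) _
  have hD := hgpos.trans_le hgm
  have e1 : Hh d l ^ 4 = ENNReal.ofReal (((1 - DhatD d l) ^ 4)⁻¹) := by
    unfold Hh
    rw [← ENNReal.ofReal_inv_of_pos hD, ← ENNReal.ofReal_pow (by positivity), inv_pow]
  rw [e1]
  refine ENNReal.ofReal_le_ofReal ?_
  calc ((1 - DhatD d l) ^ 4)⁻¹ ≤ ((∏ j, (1 - Real.cos (l j)) ^ (1 / (d : ℝ))) ^ 4)⁻¹ := by gcongr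
    _ = ∏ j, greenFactor (l j) ^ (16 / (d : ℝ)) := by
        rw [← Finset.prod_pow, ← Finset.prod_inv_distrib]
        refine Finset.prod_congr rfl fun j _ => ?_
        unfold greenFactor
        rw [← Real.rpow_natCast, ← Real.rpow_mul (hpos j).le, ← Real.rpow_neg (hpos j).le,
          ← Real.rpow_mul (hpos j).le]
        congr 1
        push_cast
        ring
    _ ≤ _ := by
        refine Finset.prod_le_prod (fun j _ => Real.rpow_nonneg (greenFactor_nonneg _) _)
          fun j _ => ?_
        have h16 : 16 / (d : ℝ) ≤ 1 := by
          rw [div_le_one hd0]; exact_mod_cast hd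
        have := rpow_one_add_le_one_add_mul_self (s := greenFactor (l j) - 1)
          (by linarith [greenFactor_nonneg (l j)]) (p := 16 / (d : ℝ)) (by positivity) h16
        rw [add_sub_cancel] at this
        refine this.trans ?_
        have : 0 ≤ 16 / (d : ℝ) := by positivity
        nlinarith

theorem lintegral_Hh_pow_four_le (hd : 16 ≤ d) (k : Fin d → ℝ) :
    ∫⁻ l, Hh d (l + k) ^ 4 ∂nu d ≤ ENNReal.ofReal (Real.exp (16 * ∫ x, greenFactor x ∂unif)) := by
  have hd0 : (0 : ℝ) < d := by exact_mod_cast (by omega : 0 < d)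
  have hi : ∀ j : Fin d, Integrable (fun x => 1 + 16 / (d : ℝ) * greenFactor (x + k j)) unif :=
    fun j => (integrable_const _).add ((integrable_greenFactor (k j)).const_mul _)
  have h_int : Integrable (fun l : Fin d → ℝ => ∏ j, (1 + 16 / (d : ℝ) * greenFactor (l j + k j)))
      (nu d) :=
    Integrable.fintype_prod (f := fun j x => 1 + 16 / (d : ℝ) * greenFactor (x + k j)) hi
  have h0 : ∀ x, 0 ≤ 1 + 16 / (d : ℝ) * greenFactor x := fun x => by
    have := greenFactor_nonneg x
    positivity
  calc ∫⁻ l, Hh d (l + k) ^ 4 ∂nu d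
      ≤ ∫⁻ l, ENNReal.ofReal (∏ j, (1 + 16 / (d : ℝ) * greenFactor (l j + k j))) ∂nu d := by
        refine lintegral_mono_ae ?_
        filter_upwards [ae_nu_cos_add_ne_one k] with l hl
        exact Hh_pow_four_le hd (l := l + k) hl
    _ = ENNReal.ofReal (∫ l, ∏ j, (1 + 16 / (d : ℝ) * greenFactor (l j + k j)) ∂nu d) := by
        rw [ofReal_integral_eq_lintegral_ofReal h_int
          (Filter.Eventually.of_forall fun l => Finset.prod_nonneg fun j _ => h0 _)]
    _ = ENNReal.ofReal ((1 + 16 / (d : ℝ) * ∫ x, greenFactor x ∂unif) ^ d) := by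
        congr 1
        rw [nu, integral_fintype_prod_eq_prod (f := fun j x => 1 + 16 / (d : ℝ) *
          greenFactor (x + k j))]
        have : ∀ j : Fin d, ∫ x, (1 + 16 / (d : ℝ) * greenFactor (x + k j)) ∂unif =
            1 + 16 / (d : ℝ) * ∫ x, greenFactor x ∂unif := by
          intro j
          rw [integral_add (integrable_const _) ((integrable_greenFactor (k j)).const_mul _),
            integral_const_mul, integral_unif_add greenFactor_periodic]
          simp
        simp [this]
    _ ≤ _ := by
        refine ENNReal.ofReal_le_ofReal ?_
        have hm : 0 ≤ ∫ x, greenFactor x ∂unif := integral_nonneg greenFactor_nonneg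
        calc _ ≤ (Real.exp (16 / (d : ℝ) * ∫ x, greenFactor x ∂unif)) ^ d := by
              gcongr
              linarith [Real.add_one_le_exp (16 / (d : ℝ) * ∫ x, greenFactor x ∂unif)]
          _ = _ := by
              rw [← Real.exp_nat_mul]
              congr 1
              field_simp

end TorusIntegrals

section TorusBounds

open MeasureTheory

variable {d : ℕ}

theorem integrable_exp_mul_cos (t : ℝ) : Integrable (fun x => Real.exp (t * Real.cos x)) unif :=
  integrable_unif_of_intervalIntegrable (Continuous.intervalIntegrable (by fun_prop) _ _)

theorem integral_exp_mul_cos_le (t : ℝ) :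
    ∫ x, Real.exp (t * Real.cos x) ∂unif ≤ Real.exp (t ^ 2 / 2) := by
  have h1 : ∫ x, Real.exp (t * Real.cos x) ∂unif = ∫ x, Real.exp (-t * Real.cos x) ∂unif := by
    rw [← integral_unif_add (f := fun x => Real.exp (t * Real.cos x)) (fun x => by
      simp only [Real.cos_add_two_pi]) Real.pi]
    refine integral_congr_ae (Filter.Eventually.of_forall fun x => ?_)
    simp only [Real.cos_add_pi]
    congr 1; ring
  have h2 : ∫ x, Real.exp (t * Real.cos x) ∂unif = ∫ x, Real.cosh (t * Real.cos x) ∂unif := by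
    have e : ∀ x, Real.cosh (t * Real.cos x) =
        (Real.exp (t * Real.cos x) + Real.exp (-t * Real.cos x)) / 2 := by
      intro x
      rw [Real.cosh_eq, neg_mul]
    simp_rw [e]
    rw [integral_div, integral_add (integrable_exp_mul_cos t) (integrable_exp_mul_cos (-t)), ← h1]
    ring
  rw [h2]
  calc ∫ x, Real.cosh (t * Real.cos x) ∂unif ≤ ∫ _x, Real.exp (t ^ 2 / 2) ∂unif := by
        refine integral_mono (integrable_unif_of_intervalIntegrable
          (Continuous.intervalIntegrable (by fun_prop) _ _)) (integrable_const _) fun x => ?_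
        refine (Real.cosh_le_exp_half_sq _).trans (Real.exp_le_exp.2 ?_)
        have : Real.cos x ^ 2 ≤ 1 := Real.cos_sq_le_one x
        rw [mul_pow]
        nlinarith [sq_nonneg t]
    _ = _ := by simp

theorem integral_exp_sum_cos_le (t : ℝ) :
    ∫ l : Fin d → ℝ, Real.exp (t * ∑ j, Real.cos (l j)) ∂nu d ≤ Real.exp (d * (t ^ 2 / 2)) := by
  have e : ∀ l : Fin d → ℝ, Real.exp (t * ∑ j, Real.cos (l j)) =
      ∏ j, Real.exp (t * Real.cos (l j)) := by
    intro l
    rw [Finset.mul_sum, Real.exp_sum]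
  simp_rw [e]
  rw [nu, integral_fintype_prod_eq_prod (f := fun (_ : Fin d) x => Real.exp (t * Real.cos x)),
    Finset.prod_const, Finset.card_univ, Fintype.card_fin, Real.exp_nat_mul]
  exact pow_le_pow_left₀ (integral_nonneg fun _ => (Real.exp_pos _).le)
    (integral_exp_mul_cos_le t) _

theorem integrable_exp_sum_cos (t : ℝ) :
    Integrable (fun l : Fin d → ℝ => Real.exp (t * ∑ j, Real.cos (l j))) (nu d) := by
  have e : ∀ l : Fin d → ℝ, Real.exp (t * ∑ j, Real.cos (l j)) =
      ∏ j, Real.exp (t * Real.cos (l j)) := by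
    intro l
    rw [Finset.mul_sum, Real.exp_sum]
  simp_rw [e]
  exact Integrable.fintype_prod fun _ => integrable_exp_mul_cos t

theorem pow_four_le_exp_add_exp (y : ℝ) : y ^ 4 ≤ 24 * (Real.exp y + Real.exp (-y)) := by
  have h := Real.pow_div_factorial_le_exp |y| (abs_nonneg y) 4
  have e : |y| ^ 4 = y ^ 4 := by
    rw [← abs_pow]
    exact abs_of_nonneg (by positivity)
  rw [e, div_le_iff₀ (by positivity)] at h
  have : Real.exp |y| ≤ Real.exp y + Real.exp (-y) := by
    rcases abs_cases y with ⟨h, -⟩ | ⟨h, -⟩ <;> rw [h] <;>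
      linarith [Real.exp_pos y, Real.exp_pos (-y)]
  have h24 : ((Nat.factorial 4 : ℕ) : ℝ) = 24 := by norm_num [Nat.factorial]
  rw [h24] at h
  linarith

theorem lintegral_DhatD_pow_four_le (hd : 0 < d) :
    ∫⁻ l, ENNReal.ofReal (DhatD d l ^ 4) ∂nu d ≤
      ENNReal.ofReal (48 * Real.exp (1 / 2)) / (d : ℝ≥0∞) ^ 2 := by
  have hd0 : (0 : ℝ) < d := by exact_mod_cast hd
  set t : ℝ := 1 / Real.sqrt d with ht
  have hs : Real.sqrt d ^ 2 = d := Real.sq_sqrt hd0.le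
  have hsp : 0 < Real.sqrt d := Real.sqrt_pos.2 hd0
  have ht2 : (d : ℝ) * (t ^ 2 / 2) = 1 / 2 := by
    rw [ht, div_pow, hs]
    field_simp
  have hpt : ∀ l, DhatD d l ^ 4 ≤ 24 / (d : ℝ) ^ 2 * (Real.exp (t * ∑ j, Real.cos (l j)) +
      Real.exp (-t * ∑ j, Real.cos (l j))) := by
    intro l
    have h := pow_four_le_exp_add_exp (t * ∑ j, Real.cos (l j))
    have e : DhatD d l ^ 4 = (t * ∑ j, Real.cos (l j)) ^ 4 / (d : ℝ) ^ 2 := by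
      unfold DhatD
      have : t ^ 4 = 1 / (d : ℝ) ^ 2 := by
        rw [ht, div_pow, show (4 : ℕ) = 2 * 2 from rfl, pow_mul (Real.sqrt d), hs]
        simp
      rw [mul_pow, mul_pow, this]
      field_simp
    rw [e, neg_mul]
    exact (div_le_div_of_nonneg_right h (by positivity : (0 : ℝ) ≤ (d : ℝ) ^ 2)).trans_eq (by ring)
  have hI : Integrable (fun l : Fin d → ℝ => 24 / (d : ℝ) ^ 2 *
      (Real.exp (t * ∑ j, Real.cos (l j)) + Real.exp (-t * ∑ j, Real.cos (l j)))) (nu d) :=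
    ((integrable_exp_sum_cos (d := d) t).add (integrable_exp_sum_cos (d := d) (-t))).const_mul
    (24 / (d : ℝ) ^ 2)
  calc _ ≤ ∫⁻ l, ENNReal.ofReal (24 / (d : ℝ) ^ 2 * (Real.exp (t * ∑ j, Real.cos (l j)) +
      Real.exp (-t * ∑ j, Real.cos (l j)))) ∂nu d :=
        lintegral_mono fun l => ENNReal.ofReal_le_ofReal (hpt l)
    _ = ENNReal.ofReal (∫ l, 24 / (d : ℝ) ^ 2 * (Real.exp (t * ∑ j, Real.cos (l j)) +
      Real.exp (-t * ∑ j, Real.cos (l j))) ∂nu d) := by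
        rw [ofReal_integral_eq_lintegral_ofReal hI
          (Filter.Eventually.of_forall fun l => by simp only [Pi.zero_apply]; positivity)]
    _ ≤ ENNReal.ofReal (48 * Real.exp (1 / 2) / (d : ℝ) ^ 2) := by
        refine ENNReal.ofReal_le_ofReal ?_
        rw [integral_const_mul, integral_add (integrable_exp_sum_cos t)
          (integrable_exp_sum_cos (-t))]
        have h1 := integral_exp_sum_cos_le (d := d) t
        have h2 := integral_exp_sum_cos_le (d := d) (-t)
        rw [neg_sq, ht2] at h2
        rw [ht2] at h1
        rw [show 48 * Real.exp (1 / 2) / (d : ℝ) ^ 2 =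
          24 / (d : ℝ) ^ 2 * (Real.exp (1 / 2) + Real.exp (1 / 2)) by ring]
        gcongr
    _ = _ := by
        rw [ENNReal.ofReal_div_of_pos (by positivity), ENNReal.ofReal_pow hd0.le,
          ENNReal.ofReal_natCast]

/-- A constant controlling all the torus integrals, uniformly in the dimension. -/
structure TorusConst (K : ℝ≥0∞) : Prop where
  one_le : 1 ≤ K
  ne_top : K ≠ ⊤
  Hh_four : ∀ d : ℕ, 16 ≤ d → ∀ k : Fin d → ℝ, ∫⁻ l, Hh d (l + k) ^ 4 ∂nu d ≤ K
  DhatD_four : ∀ d : ℕ, 16 ≤ d → ∫⁻ l, ENNReal.ofReal (DhatD d l ^ 4) ∂nu d ≤ K / (d : ℝ≥0∞) ^ 2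

theorem exists_torusConst : ∃ K, TorusConst K := by
  refine ⟨1 + ENNReal.ofReal (Real.exp (16 * ∫ x, greenFactor x ∂unif)) +
    ENNReal.ofReal (48 * Real.exp (1 / 2)), ?_, ?_, fun d hd k => ?_, fun d hd => ?_⟩
  · rw [add_assoc]; exact le_self_add
  · exact ENNReal.add_ne_top.2 ⟨ENNReal.add_ne_top.2 ⟨ENNReal.one_ne_top, ENNReal.ofReal_ne_top⟩,
      ENNReal.ofReal_ne_top⟩
  · refine (lintegral_Hh_pow_four_le hd k).trans ?_
    exact le_trans le_add_self le_self_add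
  · refine (lintegral_DhatD_pow_four_le (by omega)).trans ?_
    gcongr
    exact le_add_self

namespace TorusConst

variable {K : ℝ≥0∞} (hK : TorusConst K) (hd : 16 ≤ d)

include hK hd

theorem Hh_four' : ∫⁻ l, Hh d l ^ 4 ∂nu d ≤ K := by
  simpa using hK.Hh_four d hd 0

theorem Hh_one : ∫⁻ l, Hh d l ∂nu d ≤ 2 * K := by
  calc _ ≤ ∫⁻ l, (1 + Hh d l ^ 4) ∂nu d := by
        refine lintegral_mono fun l => ?_
        rcases le_total (Hh d l) 1 with h | h
        · exact h.trans le_self_add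
        · exact (le_self_pow₀ h (by norm_num)).trans le_add_self
    _ = 1 + ∫⁻ l, Hh d l ^ 4 ∂nu d := by
        rw [lintegral_add_left measurable_const]
        simp
    _ ≤ K + K := add_le_add hK.one_le (hK.Hh_four' hd)
    _ = _ := (two_mul K).symm

theorem DhatD_sq_Hh_sq :
    ∫⁻ l, ENNReal.ofReal (DhatD d l ^ 2) * Hh d l ^ 2 ∂nu d ≤ 2 * K / d := by
  have hd0 : (d : ℝ≥0∞) ≠ 0 := by
    have : d ≠ 0 := by omega
    exact_mod_cast this
  have hdt : (d : ℝ≥0∞) ≠ ⊤ := ENNReal.natCast_ne_top d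
  calc _ ≤ ∫⁻ l, ((d : ℝ≥0∞) * ENNReal.ofReal (DhatD d l ^ 4) +
        (d : ℝ≥0∞)⁻¹ * Hh d l ^ 4) ∂nu d := by
        refine lintegral_mono fun l => ?_
        have e : ENNReal.ofReal (DhatD d l ^ 4) = ENNReal.ofReal (DhatD d l ^ 2) ^ 2 := by
          rw [← ENNReal.ofReal_pow (sq_nonneg _), ← pow_mul]
        have e' : Hh d l ^ 4 = (Hh d l ^ 2) ^ 2 := by rw [← pow_mul]
        simp only [e, e']
        generalize ENNReal.ofReal (DhatD d l ^ 2) = a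
        generalize Hh d l ^ 2 = h
        rcases le_total (d * a) h with hc | hc
        · refine le_trans ?_ le_add_self
          have ha : a ≤ (d : ℝ≥0∞)⁻¹ * h := by
            rw [mul_comm, ← div_eq_mul_inv, ENNReal.le_div_iff_mul_le (Or.inl hd0) (Or.inl hdt),
              mul_comm]
            exact hc
          calc a * h ≤ (d : ℝ≥0∞)⁻¹ * h * h := by gcongr
            _ = _ := by ring
        · refine le_trans ?_ le_self_add
          calc a * h ≤ a * (d * a) := by gcongr
            _ = _ := by ring
    _ = d * (∫⁻ l, ENNReal.ofReal (DhatD d l ^ 4) ∂nu d) +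
        (d : ℝ≥0∞)⁻¹ * ∫⁻ l, Hh d l ^ 4 ∂nu d := by
        have m1 : Measurable fun l : Fin d → ℝ => ENNReal.ofReal (DhatD d l ^ 4) :=
          (continuous_DhatD.pow 4).measurable.ennreal_ofReal
        rw [lintegral_add_left (m1.const_mul _), lintegral_const_mul _ m1,
          lintegral_const_mul _ (measurable_Hh.pow_const 4)]
    _ ≤ d * (K / (d : ℝ≥0∞) ^ 2) + (d : ℝ≥0∞)⁻¹ * K :=
        add_le_add (mul_le_mul_right (hK.DhatD_four d hd) _)
          (mul_le_mul_right (hK.Hh_four' hd) _)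
    _ = _ := by
        rw [div_eq_mul_inv, div_eq_mul_inv, pow_two, ENNReal.mul_inv (Or.inl hd0) (Or.inl hdt)]
        calc (d : ℝ≥0∞) * (K * ((d : ℝ≥0∞)⁻¹ * (d : ℝ≥0∞)⁻¹)) + (d : ℝ≥0∞)⁻¹ * K
            = (d * (d : ℝ≥0∞)⁻¹) * (K * (d : ℝ≥0∞)⁻¹) + (d : ℝ≥0∞)⁻¹ * K := by ring
          _ = _ := by rw [ENNReal.mul_inv_cancel hd0 hdt]; ring

theorem DhatD_sq_Hh : ∫⁻ l, ENNReal.ofReal (DhatD d l ^ 2) * Hh d l ∂nu d ≤ 4 * K / d := by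
  calc _ ≤ ∫⁻ l, 2 * (ENNReal.ofReal (DhatD d l ^ 2) * Hh d l ^ 2) ∂nu d := by
        refine lintegral_mono fun l => ?_
        calc ENNReal.ofReal (DhatD d l ^ 2) * Hh d l
            = ENNReal.ofReal (DhatD d l ^ 2) * Hh d l * 1 := by ring
          _ ≤ ENNReal.ofReal (DhatD d l ^ 2) * Hh d l * (2 * Hh d l) := by
              gcongr
              exact half_le_Hh l
          _ = _ := by ring
    _ = 2 * ∫⁻ l, ENNReal.ofReal (DhatD d l ^ 2) * Hh d l ^ 2 ∂nu d :=
        lintegral_const_mul _ (((continuous_DhatD.pow 2).measurable.ennreal_ofReal).mul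
          (measurable_Hh.pow_const 2))
    _ ≤ 2 * (2 * K / d) := mul_le_mul_right (hK.DhatD_sq_Hh_sq hd) _
    _ = _ := by rw [div_eq_mul_inv, div_eq_mul_inv]; ring

theorem Hh_triple (k : Fin d → ℝ) :
    ∫⁻ l, Hh d l ^ 2 * Hh d (l + k) * Hh d (l - k) ∂nu d ≤ 3 * K := by
  have m1 : Measurable fun l : Fin d → ℝ => Hh d l ^ 4 := measurable_Hh.pow_const 4
  have m2 : Measurable fun l : Fin d → ℝ => Hh d (l + k) ^ 4 :=
    (measurable_Hh.comp (measurable_id.add_const k)).pow_const 4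
  calc _ ≤ ∫⁻ l, (Hh d l ^ 4 + Hh d (l + k) ^ 4 + Hh d (l - k) ^ 4) ∂nu d := by
        refine lintegral_mono fun l => ?_
        have key : ∀ a b c : ℝ≥0∞, a ^ 2 * b * c ≤ a ^ 4 + b ^ 4 + c ^ 4 := by
          intro a b c
          set m := max a (max b c) with hm
          have ha : a ≤ m := le_max_left _ _
          have hb : b ≤ m := (le_max_left _ _).trans (le_max_right _ _)
          have hc : c ≤ m := (le_max_right _ _).trans (le_max_right _ _)
          calc a ^ 2 * b * c ≤ m ^ 2 * m * m := by gcongr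
            _ = m ^ 4 := by ring
            _ ≤ _ := by
              rcases max_choice a (max b c) with h | h
              · rw [hm, h, add_assoc]; exact le_self_add
              · rcases max_choice b c with h' | h'
                · rw [hm, h, h']; exact le_trans le_add_self le_self_add
                · rw [hm, h, h']; exact le_add_self
        exact key _ _ _
    _ = (∫⁻ l, Hh d l ^ 4 ∂nu d) + (∫⁻ l, Hh d (l + k) ^ 4 ∂nu d) +
        ∫⁻ l, Hh d (l + -k) ^ 4 ∂nu d := by
        rw [lintegral_add_left (f := fun l : Fin d → ℝ => Hh d l ^ 4 + Hh d (l + k) ^ 4)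
          (m1.add m2), lintegral_add_left m1]
        simp only [sub_eq_add_neg]
    _ ≤ K + K + K := add_le_add (add_le_add (hK.Hh_four' hd) (hK.Hh_four d hd k))
        (hK.Hh_four d hd (-k))
    _ = _ := by ring

end TorusConst

end TorusBounds

section Neighbours

variable {d : ℕ}

/-- The signed unit vectors. -/
def unitVec (p : Fin d × Bool) : Pt d := fun j => if j = p.1 then (if p.2 then 1 else -1) else 0

theorem unitVec_injective : Function.Injective (unitVec (d := d)) := by
  rintro ⟨i, b⟩ ⟨j, c⟩ h
  have h1 := congrFun h i
  simp only [unitVec, if_true] at h1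
  by_cases hij : i = j
  · subst hij
    cases b <;> cases c <;> simp_all
  · rw [if_neg hij] at h1
    cases b <;> simp at h1

theorem adj_zero_iff (x : Pt d) : Adj 0 x ↔ x ∈ Set.range (unitVec (d := d)) := by
  have e : dist1 0 x = ∑ i, (x i).natAbs := by simp [dist1]
  unfold Adj
  rw [e]
  constructor
  · intro h
    obtain ⟨i, hi⟩ : ∃ i, x i ≠ 0 := by
      by_contra hc
      push Not at hc
      simp [hc] at h
    have h2 := Finset.add_sum_erase Finset.univ (fun i => (x i).natAbs) (Finset.mem_univ i)
    rw [h] at h2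
    have hi1 : (x i).natAbs = 1 := by
      have : 1 ≤ (x i).natAbs := Int.natAbs_pos.2 hi
      omega
    have h3 : ∑ j ∈ Finset.univ.erase i, (x j).natAbs = 0 := by
      simp only [hi1] at h2
      omega
    rw [Finset.sum_eq_zero_iff] at h3
    have h4 : ∀ j, j ≠ i → x j = 0 := fun j hj =>
      Int.natAbs_eq_zero.1 (h3 j (Finset.mem_erase.2 ⟨hj, Finset.mem_univ _⟩))
    rcases Int.natAbs_eq (x i) with h5 | h5
    · refine ⟨(i, true), ?_⟩
      ext j
      by_cases hj : j = i
      · subst hj; simp [unitVec]; omega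
      · simp [unitVec, hj, h4 j hj]
    · refine ⟨(i, false), ?_⟩
      ext j
      by_cases hj : j = i
      · subst hj; simp [unitVec]; omega
      · simp [unitVec, hj, h4 j hj]
  · rintro ⟨⟨i, b⟩, rfl⟩
    rw [Finset.sum_eq_single i]
    · cases b <;> simp [unitVec]
    · intro j _ hj
      simp [unitVec, hj]
    · simp

theorem nb_unitVec (z : ℝ≥0) (p : Fin d × Bool) : nb d z (unitVec p) = z := by
  rw [nb, ind_true ((adj_zero_iff _).2 ⟨p, rfl⟩), one_mul]

theorem nb_eq_zero {z : ℝ≥0} {x : Pt d} (h : x ∉ Set.range (unitVec (d := d))) : nb d z x = 0 := by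
  rw [nb, ind_false fun ha => h ((adj_zero_iff _).1 ha), zero_mul]

theorem nb_le (z : ℝ≥0) (x : Pt d) : nb d z x ≤ z := by
  unfold nb
  exact mul_le_of_le_one_left (zero_le) (ind_le_one _)

theorem tsum_nb (z : ℝ≥0) : ∑' x, nb d z x = 2 * d * z := by
  rw [← unitVec_injective.tsum_eq (f := nb d z)]
  · simp only [nb_unitVec, tsum_fintype, Finset.sum_const, Finset.card_univ, Fintype.card_prod,
      Fintype.card_fin, Fintype.card_bool, nsmul_eq_mul]
    push_cast
    ring
  · intro x hx
    by_contra h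
    exact hx (nb_eq_zero h)

theorem nice_nb (z : ℝ≥0) : Nice (nb d z) where
  fin := by rw [tsum_nb]; finiteness
  neg := nb_neg z

theorem dot_unitVec (k : Fin d → ℝ) (p : Fin d × Bool) :
    dot k (unitVec p) = if p.2 then k p.1 else -k p.1 := by
  unfold dot unitVec
  rw [Finset.sum_eq_single p.1]
  · rcases p with ⟨i, b⟩
    cases b <;> simp
  · intro j _ hj; simp [hj]
  · simp

theorem ft_nb (hd : 0 < d) (z : ℝ≥0) (k : Fin d → ℝ) : ft (nb d z) k = z * (2 * d) * DhatD d k := by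
  have hd' : (d : ℝ) ≠ 0 := by exact_mod_cast hd.ne'
  unfold ft
  rw [← unitVec_injective.tsum_eq (f := fun x => Real.cos (dot k x) * (nb d z x).toReal)]
  · simp only [nb_unitVec, tsum_fintype, dot_unitVec, Fintype.sum_prod_type, Fintype.sum_bool,
      if_true, Bool.false_eq_true, if_false, Real.cos_neg, ENNReal.coe_toReal, DhatD]
    simp only [← two_mul, ← Finset.mul_sum, ← Finset.sum_mul, ← mul_assoc]
    field_simp
  · intro x hx
    by_contra h
    exact hx (by simp only [nb_eq_zero h, ENNReal.toReal_zero, mul_zero])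

end Neighbours

section Finiteness

variable {d : ℕ} (lam : List (Pt d) → ℝ≥0) (z : ℝ≥0)

theorem tsum_ind_getLast {l : List (Pt d)} (h : l ≠ []) :
    ∑' x : Pt d, ind (l.getLast? = some x) = 1 := by
  obtain ⟨y, hy⟩ : ∃ y, l.getLast? = some y := ⟨_, List.getLast?_eq_some_getLast h⟩
  rw [hy]
  have := tsum_ind_some_eq_mul y fun _ => (1 : ℝ≥0∞)
  simpa using this

theorem tsum_gf : ∑' x, gf lam z x = ∑' l : List (Pt d), ind (l.head? = some 0) * lwt lam z l := by
  unfold gf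
  simp_rw [G_eq]
  rw [ENNReal.tsum_comm]
  refine tsum_congr fun l => ?_
  rcases eq_or_ne l [] with rfl | h
  · simp [ind_false]
  · calc _ = ∑' x : Pt d, (ind (l.head? = some 0) * lwt lam z l) * ind (l.getLast? = some x) :=
          tsum_congr fun x => by ring
      _ = _ := by rw [ENNReal.tsum_mul_left, tsum_ind_getLast h, mul_one]

theorem chi_eq : chi lam (z : ℝ) = ∑' x, gf lam z x := by
  rw [tsum_gf]
  have h1 : chi lam (z : ℝ) = ∑' ω : Walk d, ind (ω.pts.headI = 0) *
      ((z : ℝ≥0∞) ^ (ω.pts.length - 1) * loopWt lam ω.pts) := by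
    unfold chi cN
    simp_rw [← ENNReal.tsum_mul_right]
    rw [ENNReal.tsum_comm]
    refine tsum_congr fun ω => ?_
    rw [tsum_eq_single ω.len]
    · simp only [and_true, ite_eq_ind_mul, ENNReal.ofReal_coe_nnreal]
      unfold Walk.start Walk.len wt0 loopWt
      ring
    · intro n hn
      rw [if_neg fun h => hn h.2.symm, zero_mul]
  rw [h1, tsum_walk fun l : List (Pt d) => ind (l.headI = 0) *
      ((z : ℝ≥0∞) ^ (l.length - 1) * loopWt lam l)]
  refine tsum_congr fun l => ?_
  rcases eq_or_ne l [] with rfl | h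
  · simp [ind_false]
  · rw [ind_true h, ind_congr (headI_eq_iff h 0)]
    unfold lwt
    ring

variable {lam z}

theorem nice_gf (hsym : SymmAssumption lam) (h : chi lam (z : ℝ) ≠ ⊤) : Nice (gf lam z) where
  fin := by rwa [← chi_eq]
  neg := gf_neg hsym z

theorem ft_gf (z : ℝ) (k : Fin d → ℝ) : ft (gf lam z.toNNReal) k = Ghat lam z k := rfl

theorem mul_pow_le_mul_pow {z z' : ℝ≥0} (hz : 0 < z) (hz' : z < z') :
    ∃ C : ℝ≥0, ∀ n : ℕ, ((n : ℝ≥0) + 1) * z ^ n ≤ C * z' ^ n := by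
  set q : ℝ := z' / z - 1 with hq
  have hz0 : (0 : ℝ) < z := hz
  have hq0 : 0 < q := by
    rw [hq, sub_pos, one_lt_div hz0]
    exact hz'
  refine ⟨(1 + 1 / q).toNNReal, fun n => ?_⟩
  rw [← NNReal.coe_le_coe]
  push_cast
  rw [Real.coe_toNNReal _ (by positivity)]
  have h1 := one_add_mul_le_pow (a := q) (by linarith) n
  have h2 : (z' : ℝ) = (1 + q) * z := by rw [hq]; field_simp; ring
  rw [h2, mul_pow, ← mul_assoc]
  have hn : (0 : ℝ) ≤ n := Nat.cast_nonneg n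
  gcongr
  calc (n : ℝ) + 1 ≤ (1 + 1 / q) * (1 + n * q) := by
        have : (1 + 1 / q) * (1 + n * q) = (n + 1) + (n * q + 1 / q) := by field_simp; ring
        rw [this]
        have : 0 ≤ n * q + 1 / q := by positivity
        linarith
    _ ≤ _ := by gcongr

theorem tsum_ind_mem_le (l : List (Pt d)) : ∑' u : Pt d, ind (u ∈ l) ≤ l.length := by
  have : ∑' u : Pt d, ind (u ∈ l) = ∑ u ∈ l.toFinset, (1 : ℝ≥0∞) := by
    rw [tsum_eq_sum (s := l.toFinset)]
    · refine Finset.sum_congr rfl fun u hu => ind_true (List.mem_toFinset.1 hu)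
    · intro u hu
      exact ind_false fun h => hu (List.mem_toFinset.2 h)
  rw [this]
  simp only [Finset.sum_const, nsmul_eq_mul, mul_one]
  exact_mod_cast List.toFinset_card_le l

theorem tsum_hf_ne_top {z z' : ℝ≥0} (hz : 0 < z) (hz' : z < z') (h : chi lam (z' : ℝ) ≠ ⊤) :
    ∑' u, hf lam z u ≠ ⊤ := by
  obtain ⟨C, hC⟩ := mul_pow_le_mul_pow hz hz'
  have key : ∑' u, hf lam z u ≤ C * ∑' x, gf lam z' x := by
    rw [tsum_gf, ← ENNReal.tsum_mul_left]
    unfold hf hitWt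
    rw [ENNReal.tsum_comm]
    refine ENNReal.tsum_le_tsum fun l => ?_
    rcases eq_or_ne l [] with rfl | hl
    · simp [LE_nil, ind_false]
    calc _ = (ind (LE l = [0]) * lwt lam z l) * ∑' u : Pt d, ind (u ∈ l) := by
          rw [← ENNReal.tsum_mul_left]
          exact tsum_congr fun u => by ring
      _ ≤ (ind (l.head? = some 0) * lwt lam z l) * l.length := by
          gcongr
          · exact ind_mono fun h => ((LE_eq_singleton_iff l 0).1 h).1
          · exact tsum_ind_mem_le l
      _ = ind (l.head? = some 0) * (ind (l.IsChain Adj) * loopWt lam l *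
            (l.length * (z : ℝ≥0∞) ^ (l.length - 1))) := by unfold lwt; ring
      _ ≤ ind (l.head? = some 0) * (ind (l.IsChain Adj) * loopWt lam l *
            (C * (z' : ℝ≥0∞) ^ (l.length - 1))) := by
          gcongr ind (l.head? = some 0) * (ind (l.IsChain Adj) * loopWt lam l * ?_)
          have h1 : l.length - 1 + 1 = l.length := Nat.sub_add_cancel (List.length_pos_iff.2 hl)
          have h2 := hC (l.length - 1)
          have h3 : (l.length : ℝ≥0) = ((l.length - 1 : ℕ) : ℝ≥0) + 1 := by
            exact_mod_cast h1.symm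
          rw [← h3] at h2
          exact_mod_cast h2
      _ = _ := by unfold lwt; ring
  refine ne_top_of_le_ne_top ?_ key
  rw [← chi_eq]
  exact ENNReal.mul_ne_top ENNReal.coe_ne_top h

theorem exists_chi_ne_top {z : ℝ} (hz : 0 < z) (h : z < zc lam) :
    ∃ z', z < z' ∧ chi lam z' ≠ ⊤ := by
  have hne : {z : ℝ | 0 ≤ z ∧ chi lam z < ⊤}.Nonempty := by
    by_contra hc
    rw [Set.not_nonempty_iff_eq_empty] at hc
    rw [zc, hc, Real.sSup_empty] at h
    linarith
  obtain ⟨z', hz', hlt⟩ := exists_lt_of_lt_csSup hne h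
  exact ⟨z', hlt, hz'.2.ne⟩

theorem chi_mono {z z' : ℝ} (h : z ≤ z') : chi lam z ≤ chi lam z' :=
  ENNReal.tsum_le_tsum fun n => mul_le_mul_right
    (pow_le_pow_left' (ENNReal.ofReal_le_ofReal h) n) _

theorem mu_le (hsym : SymmAssumption lam) {M : ℝ≥0} (hM : ∀ l, IsSAPList l → lam l ≤ M)
    (z : ℝ≥0) (B : Set (Pt d)) :
    mu lam z {0} B ≤ M * (gf lam z 0 * Ef lam z 0) + ∑' u, hf lam z u * ind (u ≠ 0) := by
  have h1 : mu lam z {0} B ≤ ∑' l : List (Pt d), ∑' x : Pt d,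
      ind (LE l = [x]) * ind (l ≠ [x]) * ind (0 ∈ l) * lwt lam z l := by
    unfold mu
    calc _ ≤ ∑' ω : Walk d, ind (2 ≤ ω.pts.length ∧ ω.pts.getLastD default = ω.pts.headI) *
          ind (0 ∈ ω.pts) * ((z : ℝ≥0∞) ^ (ω.pts.length - 1) * loopWt lam ω.pts) := by
          refine ENNReal.tsum_le_tsum fun ω => ?_
          split_ifs with h
          · obtain ⟨⟨hl, hf⟩, ⟨x, hx, rfl⟩, -⟩ := h
            rw [ind_true, ind_true (show (0 : Pt d) ∈ ω.pts from hx), one_mul, one_mul]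
            · rw [wt_eq]
              refine ENNReal.div_le_of_le_mul ?_
              exact le_mul_of_one_le_right (zero_le) (by exact_mod_cast hl)
            · refine ⟨?_, hf⟩
              unfold Walk.len at hl
              omega
          · exact zero_le
      _ = _ := tsum_walk fun l : List (Pt d) => ind (2 ≤ l.length ∧ l.getLastD default = l.headI) *
          ind (0 ∈ l) * ((z : ℝ≥0∞) ^ (l.length - 1) * loopWt lam l)
      _ ≤ _ := by
          refine ENNReal.tsum_le_tsum fun l => ?_
          by_cases hc : l ≠ [] ∧ 2 ≤ l.length ∧ l.getLastD default = l.headI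
          · obtain ⟨hne, hlen, hlast⟩ := hc
            refine le_trans ?_ (ENNReal.le_tsum l.headI)
            have hLE : LE l = [l.headI] := (LE_eq_singleton_iff l _).2
              ⟨(headI_eq_iff hne _).1 rfl, (getLastD_eq_iff hne _).1 hlast⟩
            have hne' : l ≠ [l.headI] := by
              intro h
              rw [h] at hlen
              simp at hlen
            rw [ind_true hLE, ind_true hne', ind_true hne,
              ind_true (show 2 ≤ l.length ∧ l.getLastD default = l.headI from ⟨hlen, hlast⟩)]
            unfold lwt
            apply le_of_eq
            ring
          · by_cases hne : l ≠ []
            · rw [ind_false (show ¬ (2 ≤ l.length ∧ l.getLastD default = l.headI) from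
                fun h => hc ⟨hne, h⟩)]
              simp
            · rw [ind_false hne]
              simp
  refine h1.trans ?_
  rw [ENNReal.tsum_comm, ENNReal.tsum_eq_add_tsum_ite (0 : Pt d)]
  refine add_le_add ?_ ?_
  · refine le_trans (ENNReal.tsum_le_tsum fun l => ?_) (tsum_closed_ne_le hsym z hM)
    gcongr ?_ * lwt lam z l
    exact mul_le_of_le_one_right (zero_le) (ind_le_one _)
  · rw [← tsum_neg' fun u => hf lam z u * ind (u ≠ 0)]
    refine ENNReal.tsum_le_tsum fun x => ?_
    split_ifs with hx
    · exact zero_le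
    · rw [ind_true (neg_ne_zero.2 hx), mul_one]
      have := hitWt_eq_hf hsym z x 0
      rw [zero_sub] at this
      rw [← this]
      unfold hitWt
      refine ENNReal.tsum_le_tsum fun l => ?_
      gcongr
      exact mul_le_of_le_one_right (zero_le) (ind_le_one _)

end Finiteness

section Bootstrap

open MeasureTheory

variable {d : ℕ}

theorem exists_mem_box (k : Fin d → ℝ) :
    ∃ k' ∈ box d, (∀ f, ft f k' = ft f k) ∧ DhatD d k' = DhatD d k := by
  have h : ∀ j, ∃ n : ℤ, |k j - n * (2 * Real.pi)| ≤ Real.pi := by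
    intro j
    refine ⟨toIocDiv Real.two_pi_pos (-Real.pi) (k j), ?_⟩
    have h1 := sub_toIocDiv_zsmul_mem_Ioc Real.two_pi_pos (-Real.pi) (k j)
    rw [zsmul_eq_mul] at h1
    rw [abs_le]
    exact ⟨h1.1.le, by linarith [h1.2]⟩
  choose n hn using h
  refine ⟨fun j => k j - n j * (2 * Real.pi), hn, fun f => ?_, ?_⟩
  · unfold ft
    refine tsum_congr fun x => ?_
    congr 1
    have : dot k x = dot (fun j => k j - n j * (2 * Real.pi)) x +
        ((∑ j, n j * x j : ℤ) : ℝ) * (2 * Real.pi) := by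
      unfold dot
      push_cast
      rw [Finset.sum_mul, ← Finset.sum_add_distrib]
      exact Finset.sum_congr rfl fun j _ => by ring
    rw [this, Real.cos_add_int_mul_two_pi]
  · unfold DhatD
    simp only [Real.cos_sub_int_mul_two_pi]

theorem Ef_eq {lam : List (Pt d) → ℝ≥0} {z : ℝ≥0} :
    Ef lam z = conv (nb d z) (gf lam z) := conv_comm _ _

/-- The inputs of the bootstrap argument. -/
structure Boot (lam : List (Pt d) → ℝ≥0) (z : ℝ≥0) (K : ℝ≥0∞) : Prop where
  symm : SymmAssumption lam
  torus : TorusConst K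
  dim : 16 ≤ d
  nice : Nice (gf lam z)
  step : (z : ℝ) * (2 * d) ≤ 4
  green : ∀ l, |ft (gf lam z) l| * (1 - DhatD d l) ≤ 16
  finite : ∑' u, hf lam z u ≠ ⊤

namespace Boot

variable {lam : List (Pt d) → ℝ≥0} {z : ℝ≥0} {K : ℝ≥0∞} (B : Boot lam z K)

include B

theorem ofReal_abs_ft_le (l : Fin d → ℝ) : ENNReal.ofReal |ft (gf lam z) l| ≤ 16 * Hh d l := by
  unfold Hh
  rcases (sub_nonneg.2 (DhatD_le_one l)).eq_or_lt with h | h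
  · rw [← h]
    simp
  · rw [← ENNReal.ofReal_inv_of_pos h, show (16 : ℝ≥0∞) = ENNReal.ofReal 16 by simp,
      ← ENNReal.ofReal_mul (by norm_num)]
    refine ENNReal.ofReal_le_ofReal ?_
    rw [← div_eq_mul_inv, le_div_iff₀ h]
    exact B.green l

theorem gf_zero_le : gf lam z 0 ≤ 32 * K := by
  calc gf lam z 0 ≤ ∫⁻ l, ENNReal.ofReal |ft (gf lam z) l| ∂nu d := B.nice.le_lintegral 0
    _ ≤ ∫⁻ l, 16 * Hh d l ∂nu d := lintegral_mono B.ofReal_abs_ft_le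
    _ = 16 * ∫⁻ l, Hh d l ∂nu d := lintegral_const_mul _ measurable_Hh
    _ ≤ 16 * (2 * K) := mul_le_mul_right (B.torus.Hh_one B.dim) _
    _ = _ := by ring

theorem abs_ft_nb_sq_le (l : Fin d → ℝ) : ft (nb d z) l ^ 2 ≤ 16 * DhatD d l ^ 2 := by
  rw [ft_nb (by have := B.dim; omega), mul_pow]
  have h0 : (0 : ℝ) ≤ z * (2 * d) := by positivity
  have := B.step
  gcongr
  nlinarith

theorem nice_Ef : Nice (Ef lam z) := by
  rw [Ef_eq]
  exact (nice_nb z).conv B.nice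

theorem nb_le_div (x : Pt d) : nb d z x ≤ 2 / d := by
  refine (nb_le z x).trans ?_
  have hd : (0 : ℝ) < d := by exact_mod_cast (by have := B.dim; omega : 0 < d)
  have h : (z : ℝ) ≤ 2 / d := by
    rw [le_div_iff₀ hd]
    linarith [B.step]
  calc (z : ℝ≥0∞) = ENNReal.ofReal (z : ℝ) := (ENNReal.ofReal_coe_nnreal).symm
    _ ≤ ENNReal.ofReal (2 / d) := ENNReal.ofReal_le_ofReal h
    _ = _ := by
      rw [ENNReal.ofReal_div_of_pos hd, ENNReal.ofReal_natCast]
      simp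

theorem conv_nb_Ef_le (x : Pt d) : conv (nb d z) (Ef lam z) x ≤ 1024 * K / d := by
  have hm : Measurable fun l : Fin d → ℝ => ENNReal.ofReal (DhatD d l ^ 2) * Hh d l :=
    ((continuous_DhatD.pow 2).measurable.ennreal_ofReal).mul measurable_Hh
  calc _ ≤ ∫⁻ l, ENNReal.ofReal |ft (conv (nb d z) (Ef lam z)) l| ∂nu d :=
        ((nice_nb z).conv B.nice_Ef).le_lintegral x
    _ ≤ ∫⁻ l, 256 * (ENNReal.ofReal (DhatD d l ^ 2) * Hh d l) ∂nu d := by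
        refine lintegral_mono fun l => ?_
        simp only
        rw [(nice_nb z).ft_conv B.nice_Ef, Ef_eq, (nice_nb z).ft_conv B.nice, ← mul_assoc,
          ← pow_two, abs_mul, abs_of_nonneg (sq_nonneg _), ENNReal.ofReal_mul (sq_nonneg _)]
        calc _ ≤ ENNReal.ofReal (16 * DhatD d l ^ 2) * (16 * Hh d l) :=
              mul_le_mul' (ENNReal.ofReal_le_ofReal (B.abs_ft_nb_sq_le l)) (B.ofReal_abs_ft_le l)
          _ = _ := by
              rw [ENNReal.ofReal_mul (by norm_num), show ENNReal.ofReal 16 = 16 by simp]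
              ring
    _ = 256 * ∫⁻ l, ENNReal.ofReal (DhatD d l ^ 2) * Hh d l ∂nu d := lintegral_const_mul _ hm
    _ ≤ 256 * (4 * K / d) := mul_le_mul_right (B.torus.DhatD_sq_Hh B.dim) _
    _ = _ := by rw [div_eq_mul_inv, div_eq_mul_inv]; ring

theorem conv_conv_nb_Ef_le (x : Pt d) :
    conv (conv (nb d z) (Ef lam z)) (gf lam z) x ≤ 8192 * K / d := by
  have hm : Measurable fun l : Fin d → ℝ => ENNReal.ofReal (DhatD d l ^ 2) * Hh d l ^ 2 :=
    ((continuous_DhatD.pow 2).measurable.ennreal_ofReal).mul (measurable_Hh.pow_const 2)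
  have hN := (nice_nb z).conv B.nice_Ef
  calc _ ≤ ∫⁻ l, ENNReal.ofReal |ft (conv (conv (nb d z) (Ef lam z)) (gf lam z)) l| ∂nu d :=
        (hN.conv B.nice).le_lintegral x
    _ ≤ ∫⁻ l, 4096 * (ENNReal.ofReal (DhatD d l ^ 2) * Hh d l ^ 2) ∂nu d := by
        refine lintegral_mono fun l => ?_
        simp only
        rw [hN.ft_conv B.nice, (nice_nb z).ft_conv B.nice_Ef, Ef_eq, (nice_nb z).ft_conv B.nice,
          ← mul_assoc, ← pow_two, abs_mul, abs_mul, abs_of_nonneg (sq_nonneg _),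
          ENNReal.ofReal_mul (by positivity), ENNReal.ofReal_mul (sq_nonneg _)]
        calc _ ≤ ENNReal.ofReal (16 * DhatD d l ^ 2) * (16 * Hh d l) * (16 * Hh d l) :=
              mul_le_mul' (mul_le_mul' (ENNReal.ofReal_le_ofReal (B.abs_ft_nb_sq_le l))
                (B.ofReal_abs_ft_le l)) (B.ofReal_abs_ft_le l)
          _ = _ := by
              rw [ENNReal.ofReal_mul (by norm_num), show ENNReal.ofReal 16 = 16 by simp]
              ring
    _ = 4096 * ∫⁻ l, ENNReal.ofReal (DhatD d l ^ 2) * Hh d l ^ 2 ∂nu d := lintegral_const_mul _ hm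
    _ ≤ 4096 * (2 * K / d) := mul_le_mul_right (B.torus.DhatD_sq_Hh_sq B.dim) _
    _ = _ := by rw [div_eq_mul_inv, div_eq_mul_inv]; ring

theorem Ef_le_add (x : Pt d) :
    Ef lam z x ≤ gf lam z 0 * (nb d z x + conv (nb d z) (Ef lam z) x) := by
  rw [Ef_eq]
  calc conv (nb d z) (gf lam z) x
      ≤ conv (nb d z) (fun y => ind (y = 0) * gf lam z 0 + gf lam z 0 * Ef lam z y) x :=
        conv_mono (fun _ => le_rfl) (fun y => gf_le B.symm z y) x
    _ = (∑' y, ind (x = y) * (nb d z y * gf lam z 0)) +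
        gf lam z 0 * conv (nb d z) (Ef lam z) x := by
        unfold conv
        rw [← ENNReal.tsum_mul_left, ← ENNReal.tsum_add]
        refine tsum_congr fun y => ?_
        beta_reduce
        rw [ind_congr (sub_eq_zero (a := x) (b := y))]
        ring
    _ = _ := by
        rw [tsum_ind_eq_mul, ← Ef_eq]
        ring

theorem conv_Ef_gf_le (s : Pt d) :
    conv (Ef lam z) (gf lam z) s ≤ 2000000 * K ^ 3 / d := by
  have h1 : ∀ x, Ef lam z x ≤ gf lam z 0 * (2 / d + 1024 * K / d) := fun x =>
    (B.Ef_le_add x).trans (mul_le_mul_right (add_le_add (B.nb_le_div x) (B.conv_nb_Ef_le x)) _)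
  calc conv (Ef lam z) (gf lam z) s
      ≤ conv (fun x => gf lam z 0 * (nb d z x + conv (nb d z) (Ef lam z) x)) (gf lam z) s :=
        conv_mono B.Ef_le_add (fun _ => le_rfl) s
    _ = gf lam z 0 * (Ef lam z s + conv (conv (nb d z) (Ef lam z)) (gf lam z) s) := by
        have e : Ef lam z s = ∑' y, nb d z y * gf lam z (s - y) := congrFun Ef_eq s
        rw [e]
        unfold conv
        rw [← ENNReal.tsum_add, ← ENNReal.tsum_mul_left]
        exact tsum_congr fun y => by ring
    _ ≤ 32 * K * (32 * K * (2 / d + 1024 * K / d) + 8192 * K / d) := by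
        refine mul_le_mul' B.gf_zero_le (add_le_add ((h1 s).trans ?_) (B.conv_conv_nb_Ef_le s))
        exact mul_le_mul_left B.gf_zero_le _
    _ ≤ 32 * K * (32 * K * (2 * K / d + 1024 * K / d) + 8192 * K * K / d) := by
        have hk : ∀ a : ℝ≥0∞, a ≤ a * K := fun a => le_mul_of_one_le_right zero_le B.torus.one_le
        gcongr
        · exact hk _
        · exact hk _
    _ = (32 * 32 * 1026 + 32 * 8192 * 1) * K ^ 3 / d * 1 := by
        simp only [div_eq_mul_inv]
        ring
    _ ≤ _ := by
        rw [mul_one]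
        gcongr
        norm_num

theorem small {M : ℝ≥0} (hM : ∀ l, IsSAPList l → lam l ≤ M)
    (hs : 64 * (32 * K + M) ^ 4 * (2000000 * K ^ 3 / d) ≤ 1) :
    Small lam z (32 * K + M) (2000000 * K ^ 3 / d) where
  symm := B.symm
  bdd := ⟨M, le_add_self, hM⟩
  one_le := by
    refine le_trans ?_ le_self_add
    exact B.torus.one_le.trans (le_mul_of_one_le_left zero_le (by norm_num))
  small := hs
  nb_le := by
    rw [tsum_nb]
    have := B.step
    have h : (2 : ℝ≥0) * d * z ≤ 4 := by
      rw [← NNReal.coe_le_coe]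
      push_cast
      linarith
    exact_mod_cast h
  gf_zero := B.gf_zero_le.trans le_self_add
  conv := B.conv_Ef_gf_le
  finite := B.finite

end Boot

end Bootstrap

section Reduction

variable {d : ℕ} {lam : List (Pt d) → ℝ≥0}

theorem toReal_eexp {x : ℝ≥0∞} (hx : x ≠ ⊤) : (eexp x).toReal = Real.exp x.toReal := by
  rw [eexp, if_neg hx, ENNReal.toReal_ofReal (Real.exp_pos _).le]

theorem mu_ne_top (hsym : SymmAssumption lam) {M : ℝ≥0} (hM : ∀ l, IsSAPList l → lam l ≤ M)
    {z : ℝ≥0} (hg : Nice (gf lam z)) (hh : ∑' u, hf lam z u ≠ ⊤) (B : Set (Pt d)) :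
    mu lam z {0} B ≠ ⊤ := by
  refine ne_top_of_le_ne_top ?_ (mu_le hsym hM z B)
  have hE : Ef lam z 0 ≠ ⊤ := by
    rw [Ef_eq]
    exact ((nice_nb z).conv hg).ne_top 0
  refine ENNReal.add_ne_top.2 ⟨ENNReal.mul_ne_top ENNReal.coe_ne_top
    (ENNReal.mul_ne_top (hg.ne_top 0) hE), ne_top_of_le_ne_top hh ?_⟩
  exact ENNReal.tsum_le_tsum fun u => mul_le_of_le_one_right' (ind_le_one _)

/-- The parameter of the comparison walk, normalised to lie below one. -/
def sOf (lam : List (Pt d) → ℝ≥0) (z : ℝ) : ℝ := 1 - alpha0R lam z / (chi lam z).toReal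

theorem Chat_pOf (hd : 0 < d) (z : ℝ) (k : Fin d → ℝ) :
    Chat d (pOf lam z) k = (1 - sOf lam z * DhatD d k)⁻¹ := by
  have : (d : ℝ) ≠ 0 := by positivity
  rw [Chat, pOf, ← sOf, div_mul_cancel₀ _ (by positivity)]

theorem abs_DhatD_le (k : Fin d → ℝ) : |DhatD d k| ≤ 1 :=
  abs_le.2 ⟨neg_one_le_DhatD k, DhatD_le_one k⟩

theorem abs_Ghat_mul_le_f2 (hd : 0 < d) {z : ℝ} (hg : Nice (gf lam z.toNNReal)) {k : Fin d → ℝ}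
    (hk : k ∈ box d) : |Ghat lam z k| * (1 - sOf lam z * DhatD d k) ≤ f2 lam z := by
  refine le_csSup ?_ ⟨k, hk, ?_⟩
  · refine ⟨(∑' x, gf lam z.toNNReal x).toReal * (1 + |sOf lam z|), ?_⟩
    rintro _ ⟨l, -, rfl⟩
    rw [Chat_pOf hd, div_inv_eq_mul, ← ft_gf]
    refine mul_le_mul_of_nonneg (hg.abs_ft_le l) ?_ (abs_nonneg _) (by positivity)
    have : |sOf lam z * DhatD d l| ≤ |sOf lam z| := by
      rw [abs_mul]
      exact mul_le_of_le_one_right (abs_nonneg _) (abs_DhatD_le l)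
    linarith [neg_abs_le (sOf lam z * DhatD d l)]
  · rw [Chat_pOf hd, div_inv_eq_mul]

theorem boot_of_fBoot_le (hsym : SymmAssumption lam) {M : ℝ≥0}
    (hM : ∀ l, IsSAPList l → lam l ≤ M) {K : ℝ≥0∞} (hK : TorusConst K) (hd : 16 ≤ d) {z : ℝ}
    (hz : 0 < z) (hz' : z < zc lam) (h : fBoot lam z ≤ 4) : Boot lam z.toNNReal K := by
  have hd0 : 0 < d := by omega
  obtain ⟨z', hzz', hz'χ⟩ := exists_chi_ne_top hz hz'
  have hcz : ((z.toNNReal : ℝ≥0) : ℝ) = z := Real.coe_toNNReal z hz.le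
  have hcz' : ((z'.toNNReal : ℝ≥0) : ℝ) = z' := Real.coe_toNNReal z' (hz.trans hzz').le
  have hχ : chi lam z ≠ ⊤ := ne_top_of_le_ne_top hz'χ (chi_mono hzz'.le)
  have hg : Nice (gf lam z.toNNReal) := nice_gf hsym (by rwa [hcz])
  have hh : ∑' u, hf lam z.toNNReal u ≠ ⊤ :=
    tsum_hf_ne_top (z' := z'.toNNReal) (by simpa using hz)
      ((Real.toNNReal_lt_toNNReal_iff (hz.trans hzz')).2 hzz') (by rwa [hcz'])
  have hα : ∀ B, 1 ≤ (eexp (mu lam z.toNNReal {0} B)).toReal := fun B => by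
    rw [toReal_eexp (mu_ne_top hsym hM hg hh B)]
    exact Real.one_le_exp ENNReal.toReal_nonneg
  have hf1 : f1 lam z ≤ 4 := (le_max_left _ _).trans h
  have hf2 : f2 lam z ≤ 4 := (le_max_left _ _).trans ((le_max_right _ _).trans h)
  have hbox : ∀ k ∈ box d, |Ghat lam z k| * (1 - sOf lam z * DhatD d k) ≤ 4 := fun k hk =>
    (abs_Ghat_mul_le_f2 hd0 hg hk).trans hf2
  set χ := (chi lam z).toReal with hχdef
  have hχg : χ = (∑' x, gf lam z.toNNReal x).toReal := by rw [hχdef, ← chi_eq, hcz]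
  have hχ1 : 1 ≤ χ := by
    rw [hχg, ← ENNReal.toReal_one]
    exact ENNReal.toReal_mono hg.fin ((one_le_gf_zero _).trans (ENNReal.le_tsum _))
  have hα0 : alpha0R lam z ≤ 4 := by
    have h0 := hbox 0 (fun i => by simpa using Real.pi_pos.le)
    have hD : DhatD d 0 = 1 := by
      simp only [DhatD, Pi.zero_apply, Real.cos_zero, Finset.sum_const, Finset.card_univ,
        Fintype.card_fin, nsmul_eq_mul, mul_one]
      exact one_div_mul_cancel (by positivity)
    rw [← ft_gf, hg.ft_zero, ← hχg, hD, abs_of_nonneg (by linarith), sOf, ← hχdef] at h0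
    have : χ * (1 - (1 - alpha0R lam z / χ) * 1) = alpha0R lam z := by
      field_simp
      ring
    rwa [this] at h0
  have hα0' : 1 ≤ alpha0R lam z := hα ∅
  refine ⟨hsym, hK, hd, hg, ?_, fun l => ?_, hh⟩
  · rw [hcz]
    have h1 : 1 ≤ alphaR lam z := hα {e0 d}
    rw [f1] at hf1
    have : 0 ≤ z * (2 * d) := by positivity
    nlinarith
  · obtain ⟨k, hk, hft, hD⟩ := exists_mem_box l
    rw [← hft, ← hD]
    have h1 := DhatD_le_one k
    have h2 := neg_one_le_DhatD k
    rcases le_total χ 8 with h8 | h8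
    · have : |ft (gf lam z.toNNReal) k| ≤ 8 := (hg.abs_ft_le k).trans (hχg ▸ h8)
      nlinarith [abs_nonneg (ft (gf lam z.toNNReal) k)]
    · have hb := hbox k hk
      rw [← ft_gf] at hb
      have hs1 : sOf lam z ≤ 1 := by
        rw [sOf, ← hχdef, sub_le_self_iff]
        positivity
      have hs2 : 1 / 2 ≤ sOf lam z := by
        rw [sOf, ← hχdef]
        have : alpha0R lam z / χ ≤ 1 / 2 := by
          rw [div_le_iff₀ (by linarith)]
          linarith
        linarith
      have hs : (1 - DhatD d k) * (1 / 2) ≤ 1 - sOf lam z * DhatD d k := by nlinarith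
      nlinarith [abs_nonneg (ft (gf lam z.toNNReal) k)]

end Reduction

section LaceFourier

variable {d : ℕ} {lam : List (Pt d) → ℝ≥0} {z : ℝ≥0} {L ε : ℝ≥0∞}

/-- A majorant of the difference between the lace kernel and the nearest-neighbour kernel. -/
def laceErr (lam : List (Pt d) → ℝ≥0) (z : ℝ≥0) (L ε : ℝ≥0∞) (x : Pt d) : ℝ≥0∞ :=
  L ^ 2 * ε * nb d z x + ∑' n, Jf lam z (n + 1) x

/-- The alternating sum of the lace kernels. -/
def laceJ (lam : List (Pt d) → ℝ≥0) (z : ℝ≥0) (x : Pt d) : ℝ :=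
  ∑' n : ℕ, (-1) ^ n * (Jf lam z n x).toReal

theorem abs_neg_one_pow_mul (n : ℕ) (a : ℝ≥0∞) : |(-1) ^ n * a.toReal| = a.toReal := by
  rw [abs_mul, abs_pow, abs_neg, abs_one, one_pow, one_mul, abs_of_nonneg ENNReal.toReal_nonneg]

namespace Small

variable (S : Small lam z L ε)

include S

theorem sq_mul_le_one : L ^ 2 * ε ≤ 1 := by
  refine le_trans ?_ S.small
  calc L ^ 2 * ε = L ^ 2 * 1 * ε := by rw [mul_one]
    _ ≤ L ^ 2 * (64 * L ^ 2) * ε := by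
        gcongr
        calc (1 : ℝ≥0∞) = 1 * 1 ^ 2 := by simp
          _ ≤ 64 * L ^ 2 := by
            gcongr
            · norm_num
            · exact S.one_le
    _ = _ := by ring

theorem tsum_laceErr_le : ∑' x, laceErr lam z L ε x ≤ 20 * (L ^ 2 * ε) := by
  unfold laceErr
  rw [ENNReal.tsum_add, ENNReal.tsum_mul_left, ENNReal.tsum_comm]
  calc _ ≤ L ^ 2 * ε * 4 + 16 * L ^ 2 * ε :=
        add_le_add (mul_le_mul_right S.nb_le _) S.tsum_tsum_Jf_le
    _ = _ := by ring

theorem tsum_laceErr_weight_le {c : Pt d → ℝ≥0∞} (hc : IsWeight c) {Bc : ℝ≥0∞}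
    (hBc : ∀ s, ∑' y, c y * (gf lam z y * gf lam z (s - y)) ≤ Bc) :
    ∑' x, laceErr lam z L ε x * c x ≤ 3001 * L ^ 3 * ε * ((∑' x, nb d z x * c x) + Bc) := by
  unfold laceErr
  simp_rw [add_mul, mul_assoc (L ^ 2 * ε), ← ENNReal.tsum_mul_right]
  rw [ENNReal.tsum_add, ENNReal.tsum_mul_left, ENNReal.tsum_comm]
  calc _ ≤ L ^ 3 * ε * ((∑' x, nb d z x * c x) + Bc) +
        3000 * L ^ 3 * ε * ((∑' x, nb d z x * c x) + Bc) := by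
        refine add_le_add ?_ (S.tsum_tsum_Jf_weight_le hc hBc)
        refine mul_le_mul' (mul_le_mul_left (pow_le_pow_right₀ S.one_le (by norm_num)) _)
          le_self_add
    _ = _ := by ring

theorem nice_laceErr : Nice (laceErr lam z L ε) where
  fin := ne_top_of_le_ne_top (ENNReal.mul_ne_top (by norm_num)
    (ne_top_of_le_ne_top ENNReal.one_ne_top S.sq_mul_le_one)) S.tsum_laceErr_le
  neg x := by
    unfold laceErr
    simp_rw [Jf_neg S.symm]
    rw [(nice_nb z).neg]

theorem Jf_zero_le_add (x : Pt d) : Jf lam z 0 x ≤ nb d z x + L ^ 2 * ε * nb d z x := by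
  refine (Jf_zero_le S.symm z x).trans ((mul_le_mul_right S.gf_zero_le_one_add _).trans ?_)
  exact le_of_eq (by ring)

theorem tsum_Jf_le_add (x : Pt d) : ∑' n, Jf lam z n x ≤ nb d z x + laceErr lam z L ε x := by
  rw [tsum_eq_zero_add' ENNReal.summable, laceErr, ← add_assoc]
  exact add_le_add (S.Jf_zero_le_add x) le_rfl

theorem nice_majorant : Nice fun x => nb d z x + laceErr lam z L ε x :=
  (nice_nb z).add S.nice_laceErr

theorem tsum_Jf_ne_top (x : Pt d) : ∑' n, Jf lam z n x ≠ ⊤ :=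
  ne_top_of_le_ne_top (S.nice_majorant.ne_top x) (S.tsum_Jf_le_add x)

theorem tsum_tsum_Jf_ne_top : ∑' n, ∑' x, Jf lam z n x ≠ ⊤ := by
  rw [ENNReal.tsum_comm]
  exact ne_top_of_le_ne_top S.nice_majorant.fin (ENNReal.tsum_le_tsum S.tsum_Jf_le_add)

theorem nice_Jf (n : ℕ) : Nice (Jf lam z n) where
  fin := ne_top_of_le_ne_top S.tsum_tsum_Jf_ne_top (ENNReal.le_tsum n)
  neg := Jf_neg S.symm z n

theorem abs_laceJ_sub_le (x : Pt d) :
    |laceJ lam z x - (nb d z x).toReal| ≤ (laceErr lam z L ε x).toReal := by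
  have hs : Summable fun n => (Jf lam z n x).toReal := ENNReal.summable_toReal (S.tsum_Jf_ne_top x)
  have hs' : Summable fun n : ℕ => (-1) ^ n * (Jf lam z n x).toReal :=
    Summable.of_norm_bounded hs fun n => (abs_neg_one_pow_mul n _).le
  have hs1 : Summable fun n => (Jf lam z (n + 1) x).toReal := (summable_nat_add_iff 1).2 hs
  have hfin : ∑' n, Jf lam z (n + 1) x ≠ ⊤ :=
    ne_top_of_le_ne_top (S.nice_laceErr.ne_top x) le_add_self
  have h1 : |∑' n : ℕ, (-1) ^ (n + 1) * (Jf lam z (n + 1) x).toReal| ≤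
      (∑' n, Jf lam z (n + 1) x).toReal := by
    rw [ENNReal.tsum_toReal_eq fun n => (S.nice_Jf (n + 1)).ne_top x]
    exact tsum_of_norm_bounded (f := fun n : ℕ => (-1 : ℝ) ^ (n + 1) * (Jf lam z (n + 1) x).toReal)
      hs1.hasSum fun n => (abs_neg_one_pow_mul _ _).le
  have hE : L ^ 2 * ε * nb d z x ≠ ⊤ :=
    ne_top_of_le_ne_top (S.nice_laceErr.ne_top x) le_self_add
  have h2 := ENNReal.toReal_mono (ENNReal.add_ne_top.2 ⟨(nice_nb z).ne_top x, hE⟩)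
    (S.Jf_zero_le_add x)
  rw [ENNReal.toReal_add ((nice_nb z).ne_top x) hE] at h2
  have h3 := ENNReal.toReal_mono ((S.nice_Jf 0).ne_top x) (le_Jf_zero (lam := lam) z x)
  rw [laceJ, hs'.tsum_eq_zero_add, laceErr, ENNReal.toReal_add hE hfin, pow_zero, one_mul]
  rw [abs_le] at h1 ⊢
  constructor <;> linarith [h1.1, h1.2]

theorem abs_laceJ_le (x : Pt d) :
    |laceJ lam z x| ≤ (nb d z x + laceErr lam z L ε x).toReal := by
  rw [ENNReal.toReal_add ((nice_nb z).ne_top x) (S.nice_laceErr.ne_top x)]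
  have h1 := S.abs_laceJ_sub_le x
  have h2 : 0 ≤ (nb d z x).toReal := ENNReal.toReal_nonneg
  rw [abs_le] at h1 ⊢
  constructor <;> linarith [h1.1, h1.2]

theorem nice_laceRem (hg : Nice (gf lam z)) (n : ℕ) : Nice (laceRem lam z n) := by
  have hsum : ∀ n x, laceRem lam z n x + laceRem lam z (n + 1) x =
      LWW.conv (gf lam z) (Jf lam z n) x := laceRem_add_laceRem_succ' S.symm z
  have hfin : ∀ n x, laceRem lam z n x ≠ ⊤ := fun n x =>
    ne_top_of_le_ne_top ((hg.conv (S.nice_Jf n)).ne_top x) (le_self_add.trans_eq (hsum n x))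
  refine ⟨ne_top_of_le_ne_top (hg.conv (S.nice_Jf n)).fin (ENNReal.tsum_le_tsum fun x =>
    le_self_add.trans_eq (hsum n x)), ?_⟩
  induction n with
  | zero =>
    intro x
    have h1 := G_zero_eq lam z x
    have h2 := G_zero_eq lam z (-x)
    rw [show G lam z 0 (-x) = G lam z 0 x from hg.neg x, h1,
      ind_congr (neg_eq_zero (a := x))] at h2
    refine ((ENNReal.add_right_inj ?_).1 h2).symm
    exact ne_top_of_le_ne_top (hg.ne_top x) (le_self_add.trans_eq h1.symm)
  | succ n ih =>
    intro x
    have h := hsum n (-x)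
    rw [(hg.conv (S.nice_Jf n)).neg, ih, ← hsum n x] at h
    exact (ENNReal.add_right_inj (hfin n x)).1 h

theorem ft_gf_eq_sum (hg : Nice (gf lam z)) (k : Fin d → ℝ) (N : ℕ) :
    ft (gf lam z) k = (gf lam z 0).toReal +
      ft (gf lam z) k * ∑ n ∈ Finset.range N, (-1) ^ n * ft (Jf lam z n) k +
      (-1) ^ N * ft (laceRem lam z N) k := by
  induction N with
  | zero =>
    simp only [Finset.range_zero, Finset.sum_empty, mul_zero, add_zero, pow_zero, one_mul]
    have hR := S.nice_laceRem hg 0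
    have h0 : Nice fun x : Pt d => ind (x = 0) * gf lam z 0 :=
      ⟨ne_top_of_le_ne_top hg.fin (ENNReal.tsum_le_tsum fun x =>
        le_self_add.trans_eq (G_zero_eq lam z x).symm),
      fun x => by rw [ind_congr (neg_eq_zero (a := x))]⟩
    have h1 : gf lam z = fun x => ind (x = 0) * gf lam z 0 + laceRem lam z 0 x :=
      funext fun x => G_zero_eq lam z x
    conv_lhs => rw [h1, h0.ft_add hR]
    congr 1
    unfold ft
    rw [tsum_eq_single 0]
    · simp [dot_zero_right, ind_true]
    · intro x hx
      simp [ind_false hx]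
  | succ N ih =>
    have hR := S.nice_laceRem hg
    have h : ft (laceRem lam z N) k + ft (laceRem lam z (N + 1)) k =
        ft (gf lam z) k * ft (Jf lam z N) k := by
      rw [← hg.ft_conv (S.nice_Jf N), ← (hR N).ft_add (hR (N + 1))]
      congr 1
      exact funext fun x => laceRem_add_laceRem_succ' S.symm z N x
    rw [Finset.sum_range_succ]
    conv_lhs => rw [ih]
    rw [mul_add, pow_succ]
    linear_combination (-1) ^ N * h

theorem abs_ft_laceRem_le (hg : Nice (gf lam z)) (k : Fin d → ℝ) (N : ℕ) :
    |ft (laceRem lam z N) k| ≤ ((∑' x, gf lam z x) * ∑' x, Jf lam z N x).toReal := by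
  refine ((S.nice_laceRem hg N).abs_ft_le k).trans
    (ENNReal.toReal_mono (ENNReal.mul_ne_top hg.fin (S.nice_Jf N).fin) ?_)
  rw [← tsum_conv]
  exact ENNReal.tsum_le_tsum fun x =>
    le_self_add.trans_eq (laceRem_add_laceRem_succ' S.symm z N x)

theorem hasSum_ft_Jf (k : Fin d → ℝ) :
    HasSum (fun n : ℕ => (-1) ^ n * ft (Jf lam z n) k)
      (∑' x, Real.cos (dot k x) * laceJ lam z x) := by
  have h0 : Summable fun p : ℕ × Pt d => (Jf lam z p.1 p.2).toReal := by
    refine ENNReal.summable_toReal ?_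
    rw [ENNReal.tsum_prod']
    exact S.tsum_tsum_Jf_ne_top
  have h1 : Summable fun p : ℕ × Pt d =>
      ((-1) ^ p.1 * Real.cos (dot k p.2)) * (Jf lam z p.1 p.2).toReal := by
    refine summable_mul_of_abs_le_one h0 (fun _ => ENNReal.toReal_nonneg) fun p => ?_
    rw [abs_mul, abs_pow, abs_neg, abs_one, one_pow, one_mul]
    exact Real.abs_cos_le_one _
  have e : ∀ n, ∑' x, ((-1) ^ n * Real.cos (dot k x)) * (Jf lam z n x).toReal =
      (-1) ^ n * ft (Jf lam z n) k := fun n => by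
    unfold ft
    rw [← tsum_mul_left]
    exact tsum_congr fun x => by ring
  have h2 := h1.prod
  simp only [e] at h2
  have h3 : ∑' n, (-1) ^ n * ft (Jf lam z n) k = ∑' x, Real.cos (dot k x) * laceJ lam z x := by
    simp only [← e]
    rw [Summable.tsum_comm (f := fun x n =>
      ((-1) ^ n * Real.cos (dot k x)) * (Jf lam z n x).toReal) h1.prod_symm]
    refine tsum_congr fun x => ?_
    rw [laceJ, ← tsum_mul_left]
    exact tsum_congr fun n => by ring
  rw [← h3]
  exact h2.hasSum

theorem ft_gf_mul (hg : Nice (gf lam z)) (k : Fin d → ℝ) :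
    ft (gf lam z) k * (1 - ∑' x, Real.cos (dot k x) * laceJ lam z x) = (gf lam z 0).toReal := by
  have h1 := (S.hasSum_ft_Jf k).tendsto_sum_nat
  have h2 : Filter.Tendsto (fun N : ℕ => (-1) ^ N * ft (laceRem lam z N) k) Filter.atTop
      (nhds 0) := by
    refine squeeze_zero_norm (a := fun N => (∑' x, gf lam z x).toReal *
      (∑' x, Jf lam z N x).toReal) (fun N => ?_) ?_
    · rw [Real.norm_eq_abs, abs_mul, abs_pow, abs_neg, abs_one, one_pow, one_mul,
        ← ENNReal.toReal_mul]
      exact S.abs_ft_laceRem_le hg k N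
    · have := (ENNReal.summable_toReal S.tsum_tsum_Jf_ne_top).tendsto_atTop_zero.const_mul
        (∑' x, gf lam z x).toReal
      rwa [mul_zero] at this
  have h3 := ((h1.const_mul (ft (gf lam z) k)).const_add (gf lam z 0).toReal).add h2
  have h4 := tendsto_nhds_unique_of_eventuallyEq h3 tendsto_const_nhds
    (Filter.Eventually.of_forall fun N => (S.ft_gf_eq_sum hg k N).symm)
  linarith

end Small

end LaceFourier

section Increments

variable {d : ℕ}

/-- The weight `1 - cos (k · x)`. -/
def ck (k : Fin d → ℝ) (x : Pt d) : ℝ≥0∞ := ENNReal.ofReal (1 - Real.cos (dot k x))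

theorem toReal_ck (k : Fin d → ℝ) (x : Pt d) : (ck k x).toReal = 1 - Real.cos (dot k x) :=
  ENNReal.toReal_ofReal (sub_nonneg.2 (Real.cos_le_one _))

theorem one_sub_cos_add_le (a b : ℝ) :
    1 - Real.cos (a + b) ≤ 2 * (1 - Real.cos a) + 2 * (1 - Real.cos b) := by
  rw [Real.cos_add]
  nlinarith [Real.sin_sq_add_cos_sq a, Real.sin_sq_add_cos_sq b, Real.cos_le_one a,
    Real.cos_le_one b, sq_nonneg (Real.sin a - Real.sin b),
    sq_nonneg (2 - Real.cos a - Real.cos b)]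

theorem isWeight_ck (k : Fin d → ℝ) : IsWeight (ck k) where
  zero := by simp [ck, dot_zero_right]
  neg x := by rw [ck, dot_neg_right, Real.cos_neg, ck]
  add_le x y := by
    have h : ∀ a : ℝ, 0 ≤ 2 * (1 - Real.cos a) := fun a => by linarith [Real.cos_le_one a]
    unfold ck
    rw [dot_add_right, show (2 : ℝ≥0∞) = ENNReal.ofReal 2 by simp,
      ← ENNReal.ofReal_mul (by norm_num), ← ENNReal.ofReal_mul (by norm_num),
      ← ENNReal.ofReal_add (h _) (h _)]
    exact ENNReal.ofReal_le_ofReal (one_sub_cos_add_le _ _)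
  le_two x := by
    unfold ck
    rw [show (2 : ℝ≥0∞) = ENNReal.ofReal 2 by simp]
    exact ENNReal.ofReal_le_ofReal (by linarith [Real.neg_one_le_cos (dot k x)])

/-- The variation of the cosine transform at the origin. -/
def vart (f : Pt d → ℝ≥0∞) (k : Fin d → ℝ) : ℝ :=
  ∑' x, (1 - Real.cos (dot k x)) * (f x).toReal

theorem vart_nonneg (f : Pt d → ℝ≥0∞) (k : Fin d → ℝ) : 0 ≤ vart f k :=
  tsum_nonneg fun _ => mul_nonneg (sub_nonneg.2 (Real.cos_le_one _)) ENNReal.toReal_nonneg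

namespace Nice

variable {f : Pt d → ℝ≥0∞} (hf : Nice f)

include hf

theorem summable_one_sub_cos (k : Fin d → ℝ) :
    Summable fun x => (1 - Real.cos (dot k x)) * (f x).toReal := by
  simp_rw [sub_mul, one_mul]
  exact hf.summable.sub (hf.summable_cos k)

theorem vart_eq (k : Fin d → ℝ) : vart f k = (∑' x, f x).toReal - ft f k := by
  unfold vart ft
  simp_rw [sub_mul, one_mul]
  rw [hf.summable.tsum_sub (hf.summable_cos k), ENNReal.tsum_toReal_eq hf.ne_top]

theorem vart_le (k : Fin d → ℝ) : vart f k ≤ 2 * (∑' x, f x).toReal := by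
  rw [hf.vart_eq]
  linarith [neg_le_of_abs_le (hf.abs_ft_le k)]

theorem tsum_mul_ck (k : Fin d → ℝ) : ∑' x, f x * ck k x = ENNReal.ofReal (vart f k) := by
  unfold vart
  rw [ENNReal.ofReal_tsum_of_nonneg (fun x => mul_nonneg (sub_nonneg.2 (Real.cos_le_one _))
    ENNReal.toReal_nonneg) (hf.summable_one_sub_cos k)]
  refine tsum_congr fun x => ?_
  rw [ENNReal.ofReal_mul (sub_nonneg.2 (Real.cos_le_one _)), ENNReal.ofReal_toReal (hf.ne_top x),
    mul_comm, ck]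

theorem mul_ck (k : Fin d → ℝ) : Nice fun x => ck k x * f x where
  fin := by
    simp_rw [mul_comm (ck k _)]
    rw [hf.tsum_mul_ck]
    exact ENNReal.ofReal_ne_top
  neg x := by rw [(isWeight_ck k).neg, hf.neg]

theorem ft_mul_ck (k l : Fin d → ℝ) :
    ft (fun x => ck k x * f x) l = ft f l - (ft f (l + k) + ft f (l - k)) / 2 := by
  unfold ft
  rw [← (hf.summable_cos _).tsum_add (hf.summable_cos _), ← tsum_div_const,
    ← (hf.summable_cos _).tsum_sub (((hf.summable_cos _).add (hf.summable_cos _)).div_const 2)]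
  refine tsum_congr fun x => ?_
  rw [ENNReal.toReal_mul, toReal_ck, dot_add_left, dot_sub_left, Real.cos_add, Real.cos_sub]
  ring

/-- The increments of the transform of a kernel dominated by `f`. -/
theorem exists_increments {J : Pt d → ℝ} (hJ : ∀ x, |J x| ≤ (f x).toReal) (k l : Fin d → ℝ) :
    ∃ a b : ℝ,
      ∑' x, Real.cos (dot (l + k) x) * J x = ∑' x, Real.cos (dot l x) * J x - a - b ∧
      ∑' x, Real.cos (dot (l - k) x) * J x = ∑' x, Real.cos (dot l x) * J x - a + b ∧
      |a| ≤ vart f k ∧ b ^ 2 ≤ 4 * vart f k * vart f l := by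
  have hs : ∀ φ : Pt d → ℝ, (∀ x, |φ x| ≤ 1) → Summable fun x => φ x * J x := fun φ hφ => by
    refine Summable.of_norm_bounded hf.summable fun x => ?_
    rw [Real.norm_eq_abs, abs_mul]
    exact (mul_le_of_le_one_left (abs_nonneg _) (hφ x)).trans (hJ x)
  have hcos := fun k => hs (fun x => Real.cos (dot k x)) fun x => Real.abs_cos_le_one _
  have hcc := hs (fun x => Real.cos (dot l x) * Real.cos (dot k x)) fun x => by
    rw [abs_mul]
    exact mul_le_one₀ (Real.abs_cos_le_one _) (abs_nonneg _) (Real.abs_cos_le_one _)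
  have hss := hs (fun x => Real.sin (dot l x) * Real.sin (dot k x)) fun x => by
    rw [abs_mul]
    exact mul_le_one₀ (Real.abs_sin_le_one _) (abs_nonneg _) (Real.abs_sin_le_one _)
  refine ⟨∑' x, Real.cos (dot l x) * (1 - Real.cos (dot k x)) * J x,
    ∑' x, Real.sin (dot l x) * Real.sin (dot k x) * J x, ?_, ?_, ?_, ?_⟩
  · have ha : Summable fun x => Real.cos (dot l x) * (1 - Real.cos (dot k x)) * J x :=
      ((hcos l).sub hcc).congr fun x => by ring
    rw [← (hcos l).tsum_sub ha, ← ((hcos l).sub ha).tsum_sub hss]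
    refine tsum_congr fun x => ?_
    rw [dot_add_left, Real.cos_add]
    ring
  · have ha : Summable fun x => Real.cos (dot l x) * (1 - Real.cos (dot k x)) * J x :=
      ((hcos l).sub hcc).congr fun x => by ring
    rw [← (hcos l).tsum_sub ha, ← ((hcos l).sub ha).tsum_add hss]
    refine tsum_congr fun x => ?_
    rw [dot_sub_left, Real.cos_sub]
    ring
  · rw [← Real.norm_eq_abs]
    refine tsum_of_norm_bounded (hf.summable_one_sub_cos k).hasSum fun x => ?_
    have h1 : 0 ≤ 1 - Real.cos (dot k x) := sub_nonneg.2 (Real.cos_le_one _)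
    rw [Real.norm_eq_abs, abs_mul, abs_mul, abs_of_nonneg h1]
    exact mul_le_mul (mul_le_of_le_one_left h1 (Real.abs_cos_le_one _)) (hJ x) (abs_nonneg _) h1
  · set b := ∑' x, Real.sin (dot l x) * Real.sin (dot k x) * J x
    have key : ∀ u : ℝ, 0 ≤ (2 * vart f l) * (u * u) + (2 * b) * u + 2 * vart f k := by
      intro u
      have e : (2 * vart f l) * (u * u) + (2 * b) * u + 2 * vart f k =
          ∑' x, ((2 * (u * u)) * ((1 - Real.cos (dot l x)) * (f x).toReal) +
            (2 * u) * (Real.sin (dot l x) * Real.sin (dot k x) * J x) +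
            2 * ((1 - Real.cos (dot k x)) * (f x).toReal)) := by
        rw [((((hf.summable_one_sub_cos l).mul_left _).add (hss.mul_left _))).tsum_add
          ((hf.summable_one_sub_cos k).mul_left _),
          ((hf.summable_one_sub_cos l).mul_left _).tsum_add (hss.mul_left _),
          tsum_mul_left, tsum_mul_left, tsum_mul_left]
        simp only [vart, b]
        ring
      rw [e]
      refine tsum_nonneg fun x => ?_
      have h1 : ∀ a : ℝ, Real.sin a ^ 2 ≤ 2 * (1 - Real.cos a) := fun a => by
        nlinarith [Real.sin_sq_add_cos_sq a, sq_nonneg (1 - Real.cos a)]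
      have h2 := abs_le.1 (hJ x)
      have h3 : 0 ≤ (f x).toReal := ENNReal.toReal_nonneg
      have h4 : |(2 * u) * (Real.sin (dot l x) * Real.sin (dot k x) * J x)| ≤
          (u ^ 2 * Real.sin (dot l x) ^ 2 + Real.sin (dot k x) ^ 2) * (f x).toReal := by
        rw [show (2 * u) * (Real.sin (dot l x) * Real.sin (dot k x) * J x) =
          (2 * (u * Real.sin (dot l x)) * Real.sin (dot k x)) * J x by ring, abs_mul]
        refine mul_le_mul ?_ (hJ x) (abs_nonneg _) (by positivity)
        rw [abs_le]
        constructor <;>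
          nlinarith [sq_nonneg (u * Real.sin (dot l x) - Real.sin (dot k x)),
            sq_nonneg (u * Real.sin (dot l x) + Real.sin (dot k x))]
      have h5 := neg_le_of_abs_le h4
      have h6 : u ^ 2 * Real.sin (dot l x) ^ 2 ≤ u ^ 2 * (2 * (1 - Real.cos (dot l x))) :=
        mul_le_mul_of_nonneg_left (h1 _) (sq_nonneg _)
      have h7 := mul_le_mul_of_nonneg_right (add_le_add h6 (h1 (dot k x))) h3
      nlinarith
    have := discrim_le_zero key
    rw [discrim] at this
    nlinarith

end Nice

end Increments

section Variation

open MeasureTheory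

variable {d : ℕ} {lam : List (Pt d) → ℝ≥0} {z : ℝ≥0} {K L ε : ℝ≥0∞}

theorem second_difference {g gp gm g0 F a b : ℝ} (h : g * F = g0) (hp : gp * (F + a + b) = g0)
    (hm : gm * (F + a - b) = g0) :
    (gp + gm - 2 * g) * g0 ^ 2 = (-2 * a * F - 2 * a ^ 2 + 2 * b ^ 2) * (g * gp * gm) := by
  have e1 : gp * g0 ^ 2 = gp * ((g * F) * (gm * (F + a - b))) := by rw [h, hm]; ring
  have e2 : gm * g0 ^ 2 = gm * ((g * F) * (gp * (F + a + b))) := by rw [h, hp]; ring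
  have e3 : g * g0 ^ 2 = g * ((gp * (F + a + b)) * (gm * (F + a - b))) := by rw [hm, hp]; ring
  linear_combination e1 + e2 - 2 * e3

/-- The transform of the kernel in the denominator of the two-point function. -/
def laceF (lam : List (Pt d) → ℝ≥0) (z : ℝ≥0) (k : Fin d → ℝ) : ℝ :=
  1 - ∑' x, Real.cos (dot k x) * laceJ lam z x

/-- The variation of the majorant of the lace kernel. -/
def laceVar (lam : List (Pt d) → ℝ≥0) (z : ℝ≥0) (L ε : ℝ≥0∞) (k : Fin d → ℝ) : ℝ :=
  vart (fun x => nb d z x + laceErr lam z L ε x) k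

theorem laceVar_nonneg (k : Fin d → ℝ) : 0 ≤ laceVar lam z L ε k := vart_nonneg _ k

theorem one_le_toReal_gf (hg : Nice (gf lam z)) : 1 ≤ (gf lam z 0).toReal := by
  rw [← ENNReal.toReal_one]
  exact ENNReal.toReal_mono (hg.ne_top 0) (one_le_gf_zero z)

variable (S : Small lam z L ε)

include S

theorem Small.tsum_majorant_le : (∑' x, (nb d z x + laceErr lam z L ε x)).toReal ≤ 24 := by
  rw [show (24 : ℝ) = (24 : ℝ≥0∞).toReal by norm_num]
  refine ENNReal.toReal_mono (by norm_num) ?_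
  rw [ENNReal.tsum_add]
  calc _ ≤ (4 : ℝ≥0∞) + 20 * 1 := add_le_add S.nb_le
        (S.tsum_laceErr_le.trans (mul_le_mul_right S.sq_mul_le_one _))
    _ = 24 := by norm_num

theorem Small.abs_laceF_le (k : Fin d → ℝ) : |laceF lam z k| ≤ 25 := by
  have h : |∑' x, Real.cos (dot k x) * laceJ lam z x| ≤ 24 := by
    refine le_trans ?_ S.tsum_majorant_le
    rw [ENNReal.tsum_toReal_eq S.nice_majorant.ne_top, ← Real.norm_eq_abs]
    refine tsum_of_norm_bounded S.nice_majorant.summable.hasSum fun x => ?_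
    rw [Real.norm_eq_abs, abs_mul]
    exact (mul_le_of_le_one_left (abs_nonneg _) (Real.abs_cos_le_one _)).trans (S.abs_laceJ_le x)
  rw [abs_le] at h ⊢
  unfold laceF
  constructor <;> linarith [h.1, h.2]

theorem Small.laceVar_le (k : Fin d → ℝ) : laceVar lam z L ε k ≤ 48 := by
  have := S.nice_majorant.vart_le k
  rw [laceVar]
  linarith [S.tsum_majorant_le]

theorem Small.exists_laceF_add (k l : Fin d → ℝ) : ∃ a b : ℝ,
    laceF lam z (l + k) = laceF lam z l + a + b ∧ laceF lam z (l - k) = laceF lam z l + a - b ∧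
    |a| ≤ laceVar lam z L ε k ∧ b ^ 2 ≤ 4 * laceVar lam z L ε k * laceVar lam z L ε l := by
  obtain ⟨a, b, h1, h2, h3, h4⟩ := S.nice_majorant.exists_increments S.abs_laceJ_le k l
  refine ⟨a, b, ?_, ?_, h3, h4⟩
  · unfold laceF
    rw [h1]
    ring
  · unfold laceF
    rw [h2]
    ring

theorem Small.abs_ft_mul_ck_le (hg : Nice (gf lam z)) (k l : Fin d → ℝ) :
    |ft (fun x => ck k x * gf lam z x) l| ≤ 265 * laceVar lam z L ε k *
      (|ft (gf lam z) l| * |ft (gf lam z) (l + k)| * |ft (gf lam z) (l - k)|) := by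
  obtain ⟨a, b, hp, hm, ha, hb⟩ := S.exists_laceF_add k l
  have e0 : ft (gf lam z) l * laceF lam z l = _ := S.ft_gf_mul hg l
  have ep : ft (gf lam z) (l + k) * laceF lam z (l + k) = _ := S.ft_gf_mul hg (l + k)
  have em : ft (gf lam z) (l - k) * laceF lam z (l - k) = _ := S.ft_gf_mul hg (l - k)
  rw [hp] at ep
  rw [hm] at em
  have key := second_difference e0 ep em
  set g0 := (gf lam z 0).toReal
  set P := ft (gf lam z) l * ft (gf lam z) (l + k) * ft (gf lam z) (l - k) with hP
  have hg0 : 1 ≤ g0 := one_le_toReal_gf hg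
  have hF := S.abs_laceF_le l
  have hk := S.laceVar_le k
  have hl := S.laceVar_le l
  have hk0 := laceVar_nonneg (lam := lam) (z := z) (L := L) (ε := ε) k
  set j := laceVar lam z L ε k
  set F := laceF lam z l
  have h1 : |a * F| ≤ 25 * j := by
    rw [abs_mul]
    nlinarith [abs_nonneg a, abs_nonneg F]
  have h2 : a ^ 2 ≤ 48 * j := by
    rw [← sq_abs]
    nlinarith [abs_nonneg a]
  have h3 : b ^ 2 ≤ 192 * j := hb.trans (by nlinarith)
  have h4 : |-2 * a * F - 2 * a ^ 2 + 2 * b ^ 2| ≤ 530 * j := by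
    rw [abs_le] at h1 ⊢
    constructor <;> nlinarith [h1.1, h1.2, sq_nonneg a, sq_nonneg b]
  rw [hg.ft_mul_ck, ← abs_mul, ← abs_mul, ← hP]
  set X := ft (gf lam z) (l + k) + ft (gf lam z) (l - k) - 2 * ft (gf lam z) l with hX
  have h5 : |X| ≤ 530 * j * |P| := by
    calc |X| ≤ |X| * g0 ^ 2 := le_mul_of_one_le_right (abs_nonneg _) (one_le_pow₀ hg0)
      _ = |X * g0 ^ 2| := by rw [abs_mul, abs_of_nonneg (sq_nonneg g0)]
      _ = |-2 * a * F - 2 * a ^ 2 + 2 * b ^ 2| * |P| := by rw [key, abs_mul]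
      _ ≤ _ := mul_le_mul_of_nonneg_right h4 (abs_nonneg _)
  rw [show ft (gf lam z) l - (ft (gf lam z) (l + k) + ft (gf lam z) (l - k)) / 2 = -X / 2 by
    rw [hX]; ring, abs_div, abs_neg, abs_two]
  linarith

theorem Small.tsum_ck_le (B : Boot lam z K) (k : Fin d → ℝ) (s : Pt d) :
    ∑' y, ck k y * (gf lam z y * gf lam z (s - y)) ≤
      53000000 * K * ENNReal.ofReal (laceVar lam z L ε k) := by
  have hg := B.nice
  set j := laceVar lam z L ε k with hj
  have hj0 : 0 ≤ j := laceVar_nonneg k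
  have hm : Measurable fun l : Fin d → ℝ => Hh d l ^ 2 * Hh d (l + k) * Hh d (l - k) :=
    ((measurable_Hh.pow_const 2).mul (measurable_Hh.comp (measurable_id.add_const k))).mul
      (measurable_Hh.comp (measurable_id.sub_const k))
  calc _ = LWW.conv (fun x => ck k x * gf lam z x) (gf lam z) s :=
        tsum_congr fun y => (mul_assoc _ _ _).symm
    _ ≤ ∫⁻ l, ENNReal.ofReal |ft (LWW.conv (fun x => ck k x * gf lam z x) (gf lam z)) l| ∂nu d :=
        ((hg.mul_ck k).conv hg).le_lintegral s
    _ ≤ ∫⁻ l, (265 * 65536 * ENNReal.ofReal j) *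
          (Hh d l ^ 2 * Hh d (l + k) * Hh d (l - k)) ∂nu d := by
        refine lintegral_mono fun l => ?_
        simp only
        rw [(hg.mul_ck k).ft_conv hg, abs_mul, ENNReal.ofReal_mul (abs_nonneg _)]
        calc _ ≤ ENNReal.ofReal (265 * j * (|ft (gf lam z) l| * |ft (gf lam z) (l + k)| *
              |ft (gf lam z) (l - k)|)) * (16 * Hh d l) :=
              mul_le_mul' (ENNReal.ofReal_le_ofReal (S.abs_ft_mul_ck_le hg k l))
                (B.ofReal_abs_ft_le l)
          _ ≤ (265 * ENNReal.ofReal j * ((16 * Hh d l) * (16 * Hh d (l + k)) *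
              (16 * Hh d (l - k)))) * (16 * Hh d l) := by
              rw [ENNReal.ofReal_mul (by positivity), ENNReal.ofReal_mul (by norm_num),
                ENNReal.ofReal_mul (by positivity), ENNReal.ofReal_mul (by positivity),
                show ENNReal.ofReal 265 = 265 by simp]
              exact mul_le_mul_left (mul_le_mul_right (mul_le_mul' (mul_le_mul'
                (B.ofReal_abs_ft_le l) (B.ofReal_abs_ft_le _)) (B.ofReal_abs_ft_le _)) _) _
          _ = _ := by ring
    _ = (265 * 65536 * ENNReal.ofReal j) *
          ∫⁻ l, Hh d l ^ 2 * Hh d (l + k) * Hh d (l - k) ∂nu d := lintegral_const_mul _ hm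
    _ ≤ (265 * 65536 * ENNReal.ofReal j) * (3 * K) :=
        mul_le_mul_right (B.torus.Hh_triple B.dim k) _
    _ = (265 * 65536 * 3) * (K * ENNReal.ofReal j) := by ring
    _ ≤ 53000000 * (K * ENNReal.ofReal j) := mul_le_mul_left (by norm_num) _
    _ = _ := by ring

end Variation

section Estimates

variable {d : ℕ} {lam : List (Pt d) → ℝ≥0} {z : ℝ≥0} {K L ε : ℝ≥0∞} {δ : ℝ}

theorem vart_nb (hd : 0 < d) (z : ℝ≥0) (k : Fin d → ℝ) :
    vart (nb d z) k = z * (2 * d) * (1 - DhatD d k) := by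
  rw [(nice_nb z).vart_eq, ft_nb hd, tsum_nb]
  simp
  ring

theorem vart_add {f g : Pt d → ℝ≥0∞} (hf : Nice f) (hg : Nice g) (k : Fin d → ℝ) :
    vart (fun x => f x + g x) k = vart f k + vart g k := by
  rw [(hf.add hg).vart_eq, hf.vart_eq, hg.vart_eq, hf.ft_add hg, ENNReal.tsum_add,
    ENNReal.toReal_add hf.fin hg.fin]
  ring

variable (S : Small lam z L ε) (hK : 1 ≤ K) (hδ : 10 ^ 13 * L ^ 4 * K * ε ≤ ENNReal.ofReal δ)

include S hK

theorem Small.pow_mul_le {n : ℕ} (hn : n ≤ 4) {a : ℝ≥0∞} (ha : a ≤ 10 ^ 13) :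
    a * (L ^ n * ε) ≤ 10 ^ 13 * L ^ 4 * K * ε := by
  calc a * (L ^ n * ε) = a * L ^ n * 1 * ε := by ring
    _ ≤ _ := by
      gcongr
      exact S.one_le

include hδ

theorem Small.toReal_gf_zero_le (hδ0 : 0 ≤ δ) : (gf lam z 0).toReal ≤ 1 + δ := by
  rw [← ENNReal.toReal_ofReal (by linarith : 0 ≤ 1 + δ), ENNReal.ofReal_add zero_le_one hδ0,
    ENNReal.ofReal_one]
  refine ENNReal.toReal_mono (by finiteness) (S.gf_zero_le_one_add.trans ?_)
  have := S.pow_mul_le hK (n := 2) (a := 1) (by norm_num) (by norm_num)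
  rw [one_mul] at this
  gcongr
  exact this.trans hδ

theorem Small.toReal_tsum_laceErr_le (hδ0 : 0 ≤ δ) : (∑' x, laceErr lam z L ε x).toReal ≤ δ := by
  refine ENNReal.toReal_le_of_le_ofReal hδ0 (S.tsum_laceErr_le.trans (le_trans ?_ hδ))
  exact S.pow_mul_le hK (by norm_num) (by norm_num)

theorem Small.toReal_mu_le (hδ0 : 0 ≤ δ) (B : Set (Pt d)) : (mu lam z {0} B).toReal ≤ δ := by
  obtain ⟨M, hML, hM⟩ := S.bdd
  refine ENNReal.toReal_le_of_le_ofReal hδ0 ((mu_le S.symm hM z B).trans (le_trans ?_ hδ))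
  calc _ ≤ L * (L * ε) + 8 * L ^ 4 * ε :=
        add_le_add (mul_le_mul' hML (mul_le_mul' S.gf_zero (S.Ef_le 0))) S.tsum_hf_ne_le
    _ = 1 * (L ^ 2 * ε) + 8 * (L ^ 4 * ε) := by ring
    _ ≤ 1 * (L ^ 4 * ε) + 8 * (L ^ 4 * ε) := by
        gcongr
        · exact S.one_le
        · norm_num
    _ = 9 * (L ^ 4 * ε) := by ring
    _ ≤ _ := S.pow_mul_le hK le_rfl (by norm_num)

theorem Small.vart_laceErr_le (B : Boot lam z K) (hδ0 : 0 ≤ δ) (hδ1 : δ ≤ 1) (k : Fin d → ℝ) :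
    vart (laceErr lam z L ε) k ≤ δ * (1 - DhatD d k) := by
  set v := vart (laceErr lam z L ε) k with hv
  set n := vart (nb d z) k with hn
  have hv0 : 0 ≤ v := vart_nonneg _ k
  have hn0 : 0 ≤ n := vart_nonneg _ k
  have hj : laceVar lam z L ε k = n + v := vart_add (nice_nb z) S.nice_laceErr k
  have h1 := S.tsum_laceErr_weight_le (isWeight_ck k) (S.tsum_ck_le B k)
  rw [S.nice_laceErr.tsum_mul_ck, (nice_nb z).tsum_mul_ck, ← hv, ← hn, hj] at h1
  have h2 : ENNReal.ofReal v ≤ ENNReal.ofReal (δ / 8 * (n + v)) := by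
    have h8 : 8 * (3001 * L ^ 3 * ε * (1 + 53000000 * K)) ≤ 8 * ENNReal.ofReal (δ / 8) := by
      rw [show (8 : ℝ≥0∞) = ENNReal.ofReal 8 by simp, ← ENNReal.ofReal_mul (by norm_num),
        mul_div_cancel₀ _ (by norm_num : (8 : ℝ) ≠ 0)]
      refine le_trans ?_ hδ
      calc _ ≤ ENNReal.ofReal 8 * (3001 * L ^ 4 * ε * (1 * K + 53000000 * K)) := by
            gcongr
            · exact S.one_le
            · norm_num
            · rwa [one_mul]
        _ = (8 * 3001 * 53000001) * (L ^ 4 * K * ε) := by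
            rw [show ENNReal.ofReal 8 = 8 by simp]
            ring
        _ ≤ 10 ^ 13 * (L ^ 4 * K * ε) := mul_le_mul_left (by norm_num) _
        _ = _ := by ring
    have h8' := (ENNReal.mul_le_mul_iff_right (by norm_num) (by norm_num)).1 h8
    rw [ENNReal.ofReal_mul (by positivity)]
    refine h1.trans (le_trans ?_ (mul_le_mul_left h8' (ENNReal.ofReal (n + v))))
    rw [mul_assoc (3001 * L ^ 3 * ε) (1 + 53000000 * K)]
    refine mul_le_mul_right ?_ (3001 * L ^ 3 * ε)
    rw [add_mul, one_mul]
    gcongr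
    linarith
  rw [ENNReal.ofReal_le_ofReal_iff (by positivity)] at h2
  have h3 : n ≤ 4 * (1 - DhatD d k) := by
    rw [hn, vart_nb (by have := B.dim; omega)]
    exact mul_le_mul_of_nonneg_right B.step (by linarith [DhatD_le_one k])
  nlinarith [DhatD_le_one k]

end Estimates

section Comparison

variable {d : ℕ} {lam : List (Pt d) → ℝ≥0} {z : ℝ≥0} {K L ε : ℝ≥0∞} {δ : ℝ}

theorem add_le_six_mul {τ a : ℝ} (h0 : 0 ≤ τ) (h1 : τ ≤ 1) (ha : 0 ≤ a) (ha2 : a ≤ 2) :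
    τ + a ≤ 6 * (τ + (1 - τ) * a) := by
  rcases le_total τ (1 / 2) with h | h <;> nlinarith

theorem abs_sub_le_of_increments {τ a t g F₀ F : ℝ} (h0 : 0 ≤ τ) (h1 : τ ≤ 1) (ha : 0 ≤ a)
    (ha2 : a ≤ 2) (hδ : 0 ≤ δ) (hF₀ : F₀ = g * τ) (hg : 1 ≤ g) (hg' : g ≤ 1 + δ)
    (ht : |1 - F₀ - t| ≤ δ) (hF : |F - F₀ - t * a| ≤ δ * a) :
    |F - (τ + (1 - τ) * a)| ≤ 18 * δ * (τ + (1 - τ) * a) := by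
  have h6 := add_le_six_mul h0 h1 ha ha2
  have e1 : |F₀ - τ| ≤ δ * τ := by
    rw [hF₀, show g * τ - τ = (g - 1) * τ by ring, abs_of_nonneg (by nlinarith)]
    exact mul_le_mul_of_nonneg_right (by linarith) h0
  have e2 : |t - 1 + τ| ≤ 2 * δ := by
    rw [abs_le] at *
    constructor <;> nlinarith [ht.1, ht.2, e1.1, e1.2]
  have e3 : |(t - 1 + τ) * a| ≤ 2 * δ * a := by
    rw [abs_mul, abs_of_nonneg ha]
    exact mul_le_mul_of_nonneg_right e2 ha
  have h7 : 3 * δ * (τ + a) ≤ 3 * δ * (6 * (τ + (1 - τ) * a)) := by gcongr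
  have h8 : 0 ≤ δ * τ := by positivity
  rw [abs_le] at *
  constructor <;> nlinarith [e1.1, e1.2, e3.1, e3.2, hF.1, hF.2]

/-- The denominator of the comparison Green function with unit mass. -/
def massD (lam : List (Pt d) → ℝ≥0) (z : ℝ≥0) (k : Fin d → ℝ) : ℝ :=
  (ft (gf lam z) 0)⁻¹ + (1 - (ft (gf lam z) 0)⁻¹) * (1 - DhatD d k)

theorem one_le_ft_zero (hg : Nice (gf lam z)) : 1 ≤ ft (gf lam z) 0 := by
  rw [hg.ft_zero, ← ENNReal.toReal_one]
  exact ENNReal.toReal_mono hg.fin ((one_le_gf_zero z).trans (ENNReal.le_tsum 0))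

theorem inv_ft_zero_pos (hg : Nice (gf lam z)) : 0 < (ft (gf lam z) 0)⁻¹ :=
  inv_pos.2 (zero_lt_one.trans_le (one_le_ft_zero hg))

theorem inv_ft_zero_le_one (hg : Nice (gf lam z)) : (ft (gf lam z) 0)⁻¹ ≤ 1 :=
  inv_le_one_of_one_le₀ (one_le_ft_zero hg)

theorem add_le_massD (hg : Nice (gf lam z)) (k : Fin d → ℝ) :
    (ft (gf lam z) 0)⁻¹ + (1 - DhatD d k) ≤ 6 * massD lam z k :=
  add_le_six_mul (inv_ft_zero_pos hg).le (inv_ft_zero_le_one hg)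
    (sub_nonneg.2 (DhatD_le_one k)) (by linarith [neg_one_le_DhatD k])

theorem massD_pos (hg : Nice (gf lam z)) (k : Fin d → ℝ) : 0 < massD lam z k := by
  linarith [add_le_massD hg k, inv_ft_zero_pos hg, DhatD_le_one k]

variable (S : Small lam z L ε) (B : Boot lam z K)

include S

theorem Small.abs_tsum_sub_le {φ : Pt d → ℝ} {C : ℝ} (h0 : ∀ x, 0 ≤ φ x) (hC : ∀ x, φ x ≤ C) :
    |∑' x, φ x * laceJ lam z x - ∑' x, φ x * (nb d z x).toReal| ≤
      ∑' x, φ x * (laceErr lam z L ε x).toReal := by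
  have hs : ∀ (u : Pt d → ℝ) (m : Pt d → ℝ≥0∞), Nice m → (∀ x, |u x| ≤ (m x).toReal) →
      Summable fun x => φ x * u x := fun u m hm hu => by
    refine Summable.of_norm_bounded (hm.summable.mul_left C) fun x => ?_
    rw [Real.norm_eq_abs, abs_mul, abs_of_nonneg (h0 x)]
    exact mul_le_mul (hC x) (hu x) (abs_nonneg _) ((h0 x).trans (hC x))
  have hself : ∀ m : Pt d → ℝ≥0∞, ∀ x, |(m x).toReal| ≤ (m x).toReal := fun m x =>
    (abs_of_nonneg ENNReal.toReal_nonneg).le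
  rw [← (hs _ _ S.nice_majorant S.abs_laceJ_le).tsum_sub (hs _ _ (nice_nb z) (hself _)),
    ← Real.norm_eq_abs]
  refine tsum_of_norm_bounded (hs _ _ S.nice_laceErr (hself _)).hasSum fun x => ?_
  rw [Real.norm_eq_abs, ← mul_sub, abs_mul, abs_of_nonneg (h0 x)]
  exact mul_le_mul_of_nonneg_left (S.abs_laceJ_sub_le x) (h0 x)

include B

theorem Small.laceF_zero : laceF lam z 0 = (gf lam z 0).toReal * (ft (gf lam z) 0)⁻¹ := by
  have h : ft (gf lam z) 0 * laceF lam z 0 = _ := S.ft_gf_mul B.nice 0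
  have h0 : ft (gf lam z) 0 ≠ 0 := by linarith [one_le_ft_zero B.nice]
  rw [← h]
  field_simp

variable (hδ : 10 ^ 13 * L ^ 4 * K * ε ≤ ENNReal.ofReal δ) (hδ0 : 0 ≤ δ)

include hδ hδ0

theorem Small.abs_one_sub_laceF_zero_sub_le :
    |1 - laceF lam z 0 - z * (2 * d)| ≤ δ := by
  have h := S.abs_tsum_sub_le (φ := fun _ => 1) (C := 1) (fun _ => zero_le_one) fun _ => le_rfl
  simp only [one_mul] at h
  rw [← ENNReal.tsum_toReal_eq S.nice_laceErr.ne_top, ← ENNReal.tsum_toReal_eq (nice_nb z).ne_top,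
    tsum_nb] at h
  have h2 := S.toReal_tsum_laceErr_le B.torus.one_le hδ hδ0
  have e : 1 - laceF lam z 0 = ∑' x, laceJ lam z x := by
    unfold laceF
    simp [dot_zero_left]
  rw [e, show (z : ℝ) * (2 * d) = (2 * d * (z : ℝ≥0∞)).toReal by simp; ring]
  exact h.trans h2

theorem Small.step_le : z * (2 * d) ≤ 1 - (ft (gf lam z) 0)⁻¹ + δ := by
  have h := abs_le.1 (S.abs_one_sub_laceF_zero_sub_le B hδ hδ0)
  rw [S.laceF_zero B] at h
  have := mul_le_mul_of_nonneg_right (one_le_toReal_gf B.nice) (inv_ft_zero_pos B.nice).le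
  linarith [h.1]

variable (hδ1 : δ ≤ 1 / 900)

include hδ1

theorem Small.abs_laceF_sub_le (k : Fin d → ℝ) :
    |laceF lam z k - laceF lam z 0 - z * (2 * d) * (1 - DhatD d k)| ≤ δ * (1 - DhatD d k) := by
  have h := S.abs_tsum_sub_le (φ := fun x => 1 - Real.cos (dot k x)) (C := 2)
    (fun x => sub_nonneg.2 (Real.cos_le_one _)) fun x => by linarith [Real.neg_one_le_cos (dot k x)]
  have h2 := S.vart_laceErr_le B.torus.one_le hδ B hδ0 (hδ1.trans (by norm_num)) k
  have h3 := vart_nb (by have := B.dim; omega) z k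
  have hs : ∀ φ : Pt d → ℝ, (∀ x, |φ x| ≤ 1) → Summable fun x => φ x * laceJ lam z x :=
    fun φ hφ => by
      refine Summable.of_norm_bounded S.nice_majorant.summable fun x => ?_
      rw [Real.norm_eq_abs, abs_mul]
      exact (mul_le_of_le_one_left (abs_nonneg _) (hφ x)).trans (S.abs_laceJ_le x)
  have e : laceF lam z k - laceF lam z 0 = ∑' x, (1 - Real.cos (dot k x)) * laceJ lam z x := by
    unfold laceF
    rw [sub_sub_sub_cancel_left,
      ← (hs (fun x => Real.cos (dot 0 x)) fun x => Real.abs_cos_le_one _).tsum_sub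
        (hs (fun x => Real.cos (dot k x)) fun x => Real.abs_cos_le_one _)]
    refine tsum_congr fun x => ?_
    rw [dot_zero_left, Real.cos_zero]
    ring
  rw [e, ← h3]
  exact h.trans h2

theorem Small.abs_laceF_sub_massD_le (k : Fin d → ℝ) :
    |laceF lam z k - massD lam z k| ≤ 18 * δ * massD lam z k :=
  abs_sub_le_of_increments (inv_ft_zero_pos B.nice).le (inv_ft_zero_le_one B.nice)
    (sub_nonneg.2 (DhatD_le_one k)) (by linarith [neg_one_le_DhatD k]) hδ0 (S.laceF_zero B)
    (one_le_toReal_gf B.nice) (S.toReal_gf_zero_le B.torus.one_le hδ hδ0)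
    (S.abs_one_sub_laceF_zero_sub_le B hδ hδ0) (S.abs_laceF_sub_le B hδ hδ0 hδ1 k)

theorem Small.laceVar_le_massD (k : Fin d → ℝ) :
    laceVar lam z L ε k ≤ (1 + 18 * δ) * massD lam z k := by
  have h1 : laceVar lam z L ε k = vart (nb d z) k + vart (laceErr lam z L ε) k :=
    vart_add (nice_nb z) S.nice_laceErr k
  rw [h1, vart_nb (by have := B.dim; omega)]
  have h2 := S.vart_laceErr_le B.torus.one_le hδ B hδ0 (hδ1.trans (by norm_num)) k
  have h3 := mul_le_mul_of_nonneg_right (S.step_le B hδ hδ0) (sub_nonneg.2 (DhatD_le_one k))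
  have h4 := mul_le_mul_of_nonneg_left (add_le_massD B.nice k) hδ0
  have h5 := mul_nonneg hδ0 (inv_ft_zero_pos B.nice).le
  have h6 := mul_nonneg hδ0 (massD_pos B.nice k).le
  have h7 := inv_ft_zero_pos B.nice
  have h8 : massD lam z k = (ft (gf lam z) 0)⁻¹ +
    (1 - (ft (gf lam z) 0)⁻¹) * (1 - DhatD d k) := rfl
  nlinarith

end Comparison

section Improvement

variable {d : ℕ} {lam : List (Pt d) → ℝ≥0} {z : ℝ} {K L ε : ℝ≥0∞} {δ : ℝ}

theorem abs_mul_le_of_comparison {g g₀ F N T : ℝ} (h : g * F = g₀) (hg0 : 0 ≤ g₀)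
    (hg : g₀ ≤ 1 + δ) (hδ0 : 0 ≤ δ) (hδ1 : δ ≤ 1 / 900) (hN : 0 < N)
    (hF : |F - N| ≤ 18 * δ * N) (hT : |T - N| ≤ 18 * δ * N) : |g| * T ≤ 1 + 72 * δ := by
  rw [abs_le] at hF hT
  have hδN : δ * N ≤ 1 / 900 * N := mul_le_mul_of_nonneg_right hδ1 hN.le
  have hFpos : 0 < F := by linarith
  have hgn : 0 ≤ g := by
    by_contra hc
    push Not at hc
    nlinarith
  rw [abs_of_nonneg hgn]
  refine le_of_mul_le_mul_right ?_ hFpos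
  have h1 : g * T * F = g₀ * T := by rw [← h]; ring
  have hTpos : 0 ≤ T := by linarith
  rw [h1]
  have h2 : g₀ * T ≤ (1 + δ) * ((1 + 18 * δ) * N) :=
    mul_le_mul hg (by linarith [hT.2]) hTpos (by linarith)
  have h3 : (1 + 72 * δ) * ((1 - 18 * δ) * N) ≤ (1 + 72 * δ) * F :=
    mul_le_mul_of_nonneg_left (by linarith [hF.1]) (by linarith)
  have h4 : (1 + δ) * (1 + 18 * δ) ≤ (1 + 72 * δ) * (1 - 18 * δ) := by nlinarith
  nlinarith

theorem second_difference_le {g gp gm g₀ F a b j j' N N' Np Nm : ℝ} (h : g * F = g₀)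
    (hp : gp * (F + a + b) = g₀) (hm : gm * (F + a - b) = g₀) (hg1 : 1 ≤ g₀) (hg2 : g₀ ≤ 1.02)
    (hN : 0 < N) (hN' : 0 < N') (hNp : 0 < Np) (hNm : 0 < Nm) (ha : |a| ≤ j)
    (hb : b ^ 2 ≤ 4 * j * j') (hj0 : 0 ≤ j) (hj : j ≤ 1.02 * N) (hj' : j' ≤ 1.02 * N')
    (hF : |F - N'| ≤ 0.02 * N') (hFp : |F + a + b - Np| ≤ 0.02 * Np)
    (hFm : |F + a - b - Nm| ≤ 0.02 * Nm) : gp + gm - 2 * g ≤ 12 * N / (Np * Nm) := by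
  have key := second_difference h hp hm
  rw [abs_le] at hF hFp hFm
  set Fp := F + a + b
  set Fm := F + a - b
  have hF0 : 0 < F := by linarith
  have hFp0 : 0 < Fp := by linarith
  have hFm0 : 0 < Fm := by linarith
  have hX : -2 * a * F - 2 * a ^ 2 + 2 * b ^ 2 ≤ 10.6 * N * F := by
    have e1 : -a * F ≤ j * F := mul_le_mul_of_nonneg_right ((neg_le_abs a).trans ha) hF0.le
    have e2 : j' ≤ 1.0409 * F := by linarith
    have e3 : j * j' ≤ j * (1.0409 * F) := mul_le_mul_of_nonneg_left e2 hj0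
    have e4 : j * F ≤ 1.02 * N * F := mul_le_mul_of_nonneg_right hj hF0.le
    have e5 : 0 < N * F := mul_pos hN hF0
    nlinarith [sq_nonneg a]
  have e : gp + gm - 2 * g = g₀ * (-2 * a * F - 2 * a ^ 2 + 2 * b ^ 2) / (F * Fp * Fm) := by
    have hg0 : g₀ ≠ 0 := by linarith
    rw [← eq_div_iff hF0.ne'] at h
    rw [← eq_div_iff hFp0.ne'] at hp
    rw [← eq_div_iff hFm0.ne'] at hm
    rw [h, hp, hm] at key ⊢
    rw [← mul_left_inj' (pow_ne_zero 2 hg0), key]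
    field_simp
  rw [e, div_le_div_iff₀ (by positivity) (by positivity)]
  have h1 : g₀ * (-2 * a * F - 2 * a ^ 2 + 2 * b ^ 2) ≤ 1.02 * (10.6 * N * F) :=
    (mul_le_mul_of_nonneg_left hX (by linarith)).trans
      (mul_le_mul_of_nonneg_right hg2 (by positivity))
  have h2 : 0.98 * Np * (0.98 * Nm) ≤ Fp * Fm :=
    mul_le_mul (by linarith) (by linarith) (by positivity) hFp0.le
  calc _ ≤ 1.02 * (10.6 * N * F) * (Np * Nm) := mul_le_mul_of_nonneg_right h1 (by positivity)
    _ ≤ 12 * N * F * (0.98 * Np * (0.98 * Nm)) := by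
        have : 0 < N * F * (Np * Nm) := by positivity
        nlinarith
    _ ≤ 12 * N * F * (Fp * Fm) := mul_le_mul_of_nonneg_left h2 (by positivity)
    _ = _ := by ring

theorem le_comparison_kernel {N Np Nm T T' Tp Tm : ℝ} (hN : 0 < N) (hNp : 0 < Np) (hNm : 0 < Nm)
    (hT' : 0 < T') (hT : |T - N| ≤ 0.02 * N) (hTp : |Tp - Np| ≤ 0.02 * Np)
    (hTm : |Tm - Nm| ≤ 0.02 * Nm) :
    12 * N / (Np * Nm) ≤ 16 * T * (Tm⁻¹ * T'⁻¹ + Tp⁻¹ * T'⁻¹ + Tm⁻¹ * Tp⁻¹) := by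
  rw [abs_le] at hT hTp hTm
  have hT0 : 0 < T := by linarith
  have hTp0 : 0 < Tp := by linarith
  have hTm0 : 0 < Tm := by linarith
  calc 12 * N / (Np * Nm) ≤ 16 * T / (Tp * Tm) := by
        rw [div_le_div_iff₀ (by positivity) (by positivity)]
        have h2 : Tp * Tm ≤ 1.02 * Np * (1.02 * Nm) :=
          mul_le_mul (by linarith) (by linarith) hTm0.le (by positivity)
        calc _ ≤ 12 * N * (1.02 * Np * (1.02 * Nm)) :=
              mul_le_mul_of_nonneg_left h2 (by positivity)
          _ ≤ 16 * (0.98 * N) * (Np * Nm) := by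
              have : 0 < N * (Np * Nm) := by positivity
              nlinarith
          _ ≤ _ := mul_le_mul_of_nonneg_right (by linarith) (by positivity)
    _ = 16 * T * (0 + 0 + Tm⁻¹ * Tp⁻¹) := by
        field_simp
        ring
    _ ≤ _ := by gcongr <;> positivity

theorem exp_le_one_add {x : ℝ} (h0 : 0 ≤ x) (h1 : x ≤ 1) : Real.exp x ≤ 1 + 2 * x := by
  have := Real.abs_exp_sub_one_le (x := x) (by rwa [abs_of_nonneg h0])
  rw [abs_of_nonneg h0] at this
  linarith [le_of_abs_le this]

variable (S : Small lam z.toNNReal L ε) (B : Boot lam z.toNNReal K)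
  (hδ : 10 ^ 13 * L ^ 4 * K * ε ≤ ENNReal.ofReal δ) (hδ0 : 0 ≤ δ) (hδ1 : δ ≤ 1 / 900)

include S B hδ hδ0 hδ1

theorem Small.toReal_eexp_mu (A : Set (Pt d)) :
    1 ≤ (eexp (mu lam z.toNNReal {0} A)).toReal ∧
      (eexp (mu lam z.toNNReal {0} A)).toReal ≤ 1 + 2 * δ := by
  obtain ⟨M, -, hM⟩ := S.bdd
  rw [toReal_eexp (mu_ne_top S.symm hM B.nice S.finite A)]
  have h1 := S.toReal_mu_le B.torus.one_le hδ hδ0 A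
  refine ⟨Real.one_le_exp ENNReal.toReal_nonneg, ?_⟩
  exact (exp_le_one_add ENNReal.toReal_nonneg (by linarith)).trans (by linarith)

theorem Small.abs_one_sub_sOf_sub_le (hz : 0 < z) (k : Fin d → ℝ) :
    |1 - sOf lam z * DhatD d k - massD lam z.toNNReal k| ≤
      18 * δ * massD lam z.toNNReal k := by
  have hα := S.toReal_eexp_mu B hδ hδ0 hδ1 ∅
  have hχ : (chi lam z).toReal = ft (gf lam z.toNNReal) 0 := by
    rw [B.nice.ft_zero, ← chi_eq, Real.coe_toNNReal z hz.le]
  have hτ := inv_ft_zero_pos B.nice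
  have e : 1 - sOf lam z * DhatD d k - massD lam z.toNNReal k =
      (alpha0R lam z - 1) * (ft (gf lam z.toNNReal) 0)⁻¹ * DhatD d k := by
    rw [sOf, hχ, massD, div_eq_mul_inv]
    ring
  have h6 := add_le_massD B.nice k
  rw [e, abs_mul, abs_mul, abs_of_nonneg hτ.le,
    abs_of_nonneg (show 0 ≤ alpha0R lam z - 1 from sub_nonneg.2 hα.1)]
  have h1 : alpha0R lam z - 1 ≤ 2 * δ := by
    rw [alpha0R]
    linarith [hα.2]
  calc _ ≤ 2 * δ * (ft (gf lam z.toNNReal) 0)⁻¹ * 1 := by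
        gcongr
        exact abs_DhatD_le k
    _ ≤ 2 * δ * (6 * massD lam z.toNNReal k) := by
        rw [mul_one]
        exact mul_le_mul_of_nonneg_left (by linarith [DhatD_le_one k]) (by linarith)
    _ ≤ _ := by nlinarith [mul_nonneg hδ0 (massD_pos B.nice k).le]

theorem Small.f1_le (hz : 0 < z) : f1 lam z ≤ 1 + 72 * δ := by
  have hα := S.toReal_eexp_mu B hδ hδ0 hδ1 {e0 d}
  have h1 := S.step_le B hδ hδ0
  rw [Real.coe_toNNReal z hz.le] at h1
  have h2 := inv_ft_zero_pos B.nice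
  have h3 : 0 ≤ z * (2 * d) := by positivity
  rw [f1, alphaR]
  set α := (eexp (mu lam z.toNNReal {0} {e0 d})).toReal
  calc z * α * (2 * d) = z * (2 * d) * α := by ring
    _ ≤ (1 + δ) * (1 + 2 * δ) := mul_le_mul (by linarith) hα.2 (by linarith [hα.1]) (by linarith)
    _ ≤ _ := by nlinarith

theorem Small.f2_le (hz : 0 < z) : f2 lam z ≤ 1 + 72 * δ := by
  refine Real.sSup_le ?_ (by linarith)
  rintro _ ⟨k, -, rfl⟩
  rw [Chat_pOf (by have := B.dim; omega), div_inv_eq_mul, ← ft_gf]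
  exact abs_mul_le_of_comparison (S.ft_gf_mul B.nice k) ENNReal.toReal_nonneg
    (S.toReal_gf_zero_le B.torus.one_le hδ hδ0) hδ0 hδ1 (massD_pos B.nice k)
    (S.abs_laceF_sub_massD_le B hδ hδ0 hδ1 k) (S.abs_one_sub_sOf_sub_le B hδ hδ0 hδ1 hz k)

theorem Small.f3_le (hz : 0 < z) : f3 lam z ≤ 1 := by
  refine Real.sSup_le ?_ zero_le_one
  rintro _ ⟨k, -, l, -, rfl⟩
  have hd : 0 < d := by have := B.dim; omega
  have hM := fun k => massD_pos B.nice k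
  have hη : ∀ k, 18 * δ * massD lam z.toNNReal k ≤ 0.02 * massD lam z.toNNReal k := fun k =>
    mul_le_mul_of_nonneg_right (by linarith) (hM k).le
  have hF := fun k => (S.abs_laceF_sub_massD_le B hδ hδ0 hδ1 k).trans (hη k)
  have hT := fun k => (S.abs_one_sub_sOf_sub_le B hδ hδ0 hδ1 hz k).trans (hη k)
  have hT0 : ∀ k, 0 < 1 - sOf lam z * DhatD d k := fun k => by
    linarith [neg_le_of_abs_le (hT k), hM k]
  have hj : ∀ k, laceVar lam z.toNNReal L ε k ≤ 1.02 * massD lam z.toNNReal k := fun k => by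
    linarith [S.laceVar_le_massD B hδ hδ0 hδ1 k, hη k]
  obtain ⟨a, b, hp, hm, ha, hb⟩ := S.exists_laceF_add k l
  have hFp := hF (l + k)
  have hFm := hF (l - k)
  have e0 : ft (gf lam z.toNNReal) l * laceF lam z.toNNReal l = _ := S.ft_gf_mul B.nice l
  have ep : ft (gf lam z.toNNReal) (l + k) * laceF lam z.toNNReal (l + k) = _ :=
    S.ft_gf_mul B.nice (l + k)
  have em : ft (gf lam z.toNNReal) (l - k) * laceF lam z.toNNReal (l - k) = _ :=
    S.ft_gf_mul B.nice (l - k)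
  rw [hp] at hFp ep
  rw [hm] at hFm em
  have h1 := second_difference_le e0 ep em (one_le_toReal_gf B.nice)
    ((S.toReal_gf_zero_le B.torus.one_le hδ hδ0).trans (by linarith)) (hM k) (hM l) (hM (l + k))
    (hM (l - k)) ha hb (laceVar_nonneg k) (hj k) (hj l) (hF l) hFp hFm
  have h2 := le_comparison_kernel (hM k) (hM (l + k)) (hM (l - k)) (hT0 l) (hT k) (hT (l + k))
    (hT (l - k))
  refine div_le_one_of_le₀ ?_ ?_
  · simp only [Ufun, Chat_pOf hd, DeltaGhat, ← ft_gf, inv_inv]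
    exact h1.trans h2
  · simp only [Ufun, Chat_pOf hd, inv_inv]
    have h3 := hT0 k
    have h4 := hT0 l
    have h5 := hT0 (l + k)
    have h6 := hT0 (l - k)
    positivity

end Improvement

/-- **Key bootstrap improvement.**  Let `λ` be nonnegative loop activities (given on
`ℤ^d` for each dimension `d`) satisfying the symmetry assumption and the boundedness
assumption.  There exist constants `c > 0` and `d₀` (depending only on `λ`) such that
for every dimension `d ≥ d₀` and every `z ∈ (0, z_c(λ))`: if `f(z) ≤ 4` then
`f(z) ≤ 1 + c/d`. -/
theorem bootstrap_improvement (Λ : ∀ d : ℕ, List (Pt d) → ℝ≥0)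
    (hsym : ∀ d : ℕ, SymmAssumption (Λ d))
    (hbdd : ∃ M : ℝ≥0, ∀ d : ℕ, ∀ l : List (Pt d), IsSAPList l → Λ d l ≤ M) :
    ∃ c : ℝ, 0 < c ∧ ∃ d₀ : ℕ, ∀ d : ℕ, d₀ ≤ d → ∀ z : ℝ, 0 < z → z < zc (Λ d) →
      fBoot (Λ d) z ≤ 4 → fBoot (Λ d) z ≤ 1 + c / (d : ℝ) := by
  obtain ⟨M, hM⟩ := hbdd
  obtain ⟨K, hK⟩ := exists_torusConst
  have hKtop : K ≠ ⊤ := hK.ne_top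
  set A : ℝ≥0∞ := 10 ^ 13 * (32 * K + M) ^ 4 * K * (2000000 * K ^ 3) with hA
  have hAtop : A ≠ ⊤ := by
    rw [hA]
    finiteness
  have hA0 : 0 ≤ A.toReal := ENNReal.toReal_nonneg
  refine ⟨72 * A.toReal + 1, by positivity, max 16 (⌈900 * A.toReal⌉₊ + 1),
    fun d hd z hz hzc hf => ?_⟩
  have hd16 : 16 ≤ d := (le_max_left _ _).trans hd
  have hd0 : (0 : ℝ) < d := by exact_mod_cast (by omega : 0 < d)
  have hdA : 900 * A.toReal ≤ d := (Nat.le_ceil _).trans <| by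
    exact_mod_cast (Nat.le_succ _).trans ((le_max_right _ _).trans hd)
  have hδ0 : 0 ≤ A.toReal / d := by positivity
  have hδ1 : A.toReal / d ≤ 1 / 900 := by
    rw [div_le_div_iff₀ hd0 (by norm_num)]
    linarith
  have hδ : 10 ^ 13 * (32 * K + M) ^ 4 * K * (2000000 * K ^ 3 / d)
      ≤ ENNReal.ofReal (A.toReal / d) := by
    rw [ENNReal.ofReal_div_of_pos hd0, ENNReal.ofReal_toReal hAtop, ENNReal.ofReal_natCast,
      ← mul_div_assoc]
  have B := boot_of_fBoot_le (hsym d) (hM d) hK hd16 hz hzc hf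
  have hs : 64 * (32 * K + M) ^ 4 * (2000000 * K ^ 3 / d) ≤ 1 := calc
    _ = 64 * (32 * K + M) ^ 4 * 1 * (2000000 * K ^ 3 / d) := by rw [mul_one]
    _ ≤ 10 ^ 13 * (32 * K + M) ^ 4 * K * (2000000 * K ^ 3 / d) := by
      gcongr
      · norm_num
      · exact hK.one_le
    _ ≤ _ := hδ
    _ ≤ 1 := ENNReal.ofReal_le_one.2 (hδ1.trans (by norm_num))
  have S := B.small (hM d) hs
  have hc : 1 + 72 * (A.toReal / d) ≤ 1 + (72 * A.toReal + 1) / d := by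
    rw [← mul_div_assoc]
    gcongr
    linarith
  exact max_le ((S.f1_le B hδ hδ0 hδ1 hz).trans hc) <|
    max_le ((S.f2_le B hδ hδ0 hδ1 hz).trans hc) <|
      (S.f3_le B hδ hδ0 hδ1 hz).trans (le_trans (by linarith) hc)

end LWW
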